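/- Let E be a non-vanishing extended multi-segment datum whose order satisfies (P′), and let T be any one of the following operators: a row exchange R_k; a union–intersection ui_{i,j} that is applicable on E; the composition dual∘ui_{i,j}∘dual where ui_{i,j} is applicable on dual(E); or a partial dual dual_k that is applicable. Then T(E) is again an extended multi-segment datum — every row of T(E) satisfies 0 ≤ l ≤ b/2 and A+B ≥ 0, and its listed order is admissible — and moreover the sign product ∏_{rows} (−1)^{⌊b/2⌋+l} η^b taken over the rows of T(E) equals the corresponding product over the rows of E. (This is the combinatorial content of part (1) of the paper's Main Theorem: each of the four operators sends extended multi-segments for G_n to extended multi-segments for G_n.) -/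

import Mathlib

/-!
Common combinatorial setting for extended multi-segments (Moeglin-Atobe theory),
following Hazeltine-Liu-Lo, "On the intersection of local Arthur packets".
Rows of symbols are 0-indexed; row labels of labeled symbols are natural numbers.
-/

namespace LocalArthur

/-- A row `([A,B], l, eta)` of a symbol (an extended segment with the bound on `l` dropped). -/
structure Row where
  A : ℚ
  B : ℚ
  l : ℚ
  eta : ℤ
deriving DecidableEq

/-- `a = A + B + 1`. -/
def Row.a (r : Row) : ℚ := r.A + r.B + 1

/-- `b = A - B + 1`. -/
def Row.b (r : Row) : ℚ := r.A - r.B + 1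

/-- A rational number is an integer. -/
def IsInt (x : ℚ) : Prop := x.den = 1

instance (x : ℚ) : Decidable (IsInt x) := by unfold IsInt; infer_instance

/-- `(-1)^x` for an integer-valued rational `x` (junk value on non-integers). -/
def m1pow (x : ℚ) : ℤ := if x.num % 2 = 0 then 1 else -1

/-- Validity of a single row: `2A, 2B ∈ ℤ`, `A - B ∈ ℕ`, `l ∈ ℤ`, `eta = ±1`. -/
def Row.IsES (r : Row) : Prop :=
  IsInt (2 * r.A) ∧ IsInt (2 * r.B) ∧ (∃ n : ℕ, r.A - r.B = (n : ℚ)) ∧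
    IsInt r.l ∧ (r.eta = 1 ∨ r.eta = -1)

/-- The segment `[A,B]` of `r` is contained in that of `s`. -/
def Row.subseg (r s : Row) : Prop := s.B ≤ r.B ∧ r.A ≤ s.A

instance (r s : Row) : Decidable (r.subseg s) := by unfold Row.subseg; infer_instance

/-- A symbol: valid rows, `A_i + B_i ≥ 0`, all `A_i` congruent mod `ℤ`, and the
listed order admissible, i.e. condition (P). -/
def IsSymbol (E : List Row) : Prop :=
  (∀ r ∈ E, r.IsES) ∧ (∀ r ∈ E, 0 ≤ r.A + r.B) ∧
    (∀ r ∈ E, ∀ s ∈ E, IsInt (r.A - s.A)) ∧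
    E.Pairwise (fun r s => ¬ (s.A < r.A ∧ s.B < r.B))

/-- An extended multi-segment datum: a symbol with `0 ≤ l_i ≤ b_i / 2`. -/
def IsEMS (E : List Row) : Prop :=
  IsSymbol E ∧ ∀ r ∈ E, 0 ≤ r.l ∧ r.l ≤ r.b / 2

/-- The listed order satisfies (P'). -/
def Pprime (E : List Row) : Prop := E.Pairwise (fun r s => r.B ≤ s.B)

/-- Equivalence of extended segments. -/
def Row.Equiv (r s : Row) : Prop :=
  r.A = s.A ∧ r.B = s.B ∧ r.l = s.l ∧ (r.eta = s.eta ∨ r.l = r.b / 2)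

/-- Rowwise equivalence of symbols. -/
def SymEquiv (E F : List Row) : Prop := List.Forall₂ Row.Equiv E F

/-- Shift of one row: `[A,B] ↦ [A+d, B+d]`. -/
def Row.sh (r : Row) (d : ℤ) : Row := { r with A := r.A + d, B := r.B + d }

/-- Add on one row: `([A,B],l) ↦ ([A+d, B-d], l+d)`. -/
def Row.addOp (r : Row) (d : ℤ) : Row :=
  { r with A := r.A + d, B := r.B - d, l := r.l + d }

/-- `sh^d` applied to every row. -/
def shAll (d : ℤ) (E : List Row) : List Row := E.map fun r => r.sh d

/-- The updated pair of rows in a row exchange of rows `r = row k` and `s = row k+1`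
(assuming one of the segments contains the other); the first component is the new row
at position `k` (the updated `s`) and the second the new row at position `k+1`
(the updated `r`). -/
def rexPair (r s : Row) : Row × Row :=
  if r.subseg s then
    -- Case `[A_k,B_k] ⊆ [A_{k+1},B_{k+1}]`
    (if m1pow (r.A - r.B) * r.eta * s.eta = 1 then
        if s.b - 2 * s.l < 2 * (r.b - 2 * r.l) then
          (⟨s.A, s.B, s.b - (s.l + (r.b - 2 * r.l)), m1pow (r.A - r.B) * s.eta⟩ : Row)
        else ⟨s.A, s.B, s.l + (r.b - 2 * r.l), m1pow (r.A - r.B + 1) * s.eta⟩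
      else ⟨s.A, s.B, s.l - (r.b - 2 * r.l), m1pow (r.A - r.B + 1) * s.eta⟩,
     ⟨r.A, r.B, r.l, m1pow (s.A - s.B) * r.eta⟩)
  else
    -- Case `[A_{k+1},B_{k+1}] ⊊ [A_k,B_k]`
    (⟨s.A, s.B, s.l, m1pow (r.A - r.B) * s.eta⟩,
     if m1pow (r.A - r.B) * r.eta * s.eta = 1 then
        if r.b - 2 * r.l < 2 * (s.b - 2 * s.l) then
          (⟨r.A, r.B, r.b - (r.l + (s.b - 2 * s.l)), m1pow (s.A - s.B) * r.eta⟩ : Row)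
        else ⟨r.A, r.B, r.l + (s.b - 2 * s.l), m1pow (s.A - s.B + 1) * r.eta⟩
      else ⟨r.A, r.B, r.l - (s.b - 2 * s.l), m1pow (s.A - s.B + 1) * r.eta⟩)

/-- Row exchange `R_k` at positions `k, k+1` (0-indexed). -/
def rex (k : ℕ) (E : List Row) : List Row :=
  match E[k]?, E[k+1]? with
  | some r, some s =>
      if r.subseg s ∨ s.subseg r then
        E.take k ++ (rexPair r s).1 :: (rexPair r s).2 :: E.drop (k + 2)
      else E
  | _, _ => E

/-- One row exchange step. -/
def ReorderStep (E F : List Row) : Prop := ∃ k, F = rex k E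

/-- Admissible reorderings: finite sequences of row exchanges. -/
def Reorder : List Row → List Row → Prop := Relation.ReflTransGen ReorderStep

/-- Coincidence up to row exchanges (in either direction) and rowwise equivalence. -/
def UpToRex (E F : List Row) : Prop :=
  ∃ G, Relation.ReflTransGen (fun X Y => ReorderStep X Y ∨ ReorderStep Y X) E G ∧
    SymEquiv G F

/-- `α_i = ∑_{j<i} (A_j + B_j + 1)`. -/
def alphaAt (E : List Row) (i : ℕ) : ℚ := ((E.take i).map Row.a).sum

/-- `β_i = ∑_{j>i} (A_j - B_j + 1)`. -/
def betaAt (E : List Row) (i : ℕ) : ℚ := ((E.drop (i + 1)).map Row.b).sum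

/-- `γ_i = ∑_{j>i} (A_j + B_j + 1)`. -/
def gammaAt (E : List Row) (i : ℕ) : ℚ := ((E.drop (i + 1)).map Row.a).sum

/-- Condition (∗) of the non-vanishing criterion. -/
def StarCond (E : List Row) : Prop :=
  ∀ i : ℕ, ∀ r : Row, E[i]? = some r →
    (IsInt r.B → 0 ≤ r.B + r.l) ∧
    (¬ IsInt r.B → r.eta = - m1pow (alphaAt E i) → (1 / 2 : ℚ) ≤ r.B + r.l) ∧
    (¬ IsInt r.B → r.eta = m1pow (alphaAt E i) → -(1 / 2 : ℚ) ≤ r.B + r.l)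

/-- Xu's non-vanishing conditions at an adjacent pair of rows `(r, s) = (row k, row k+1)`. -/
def XuPair (r s : Row) : Prop :=
  ((r.A ≤ s.A ∧ r.B ≤ s.B) →
    (m1pow (r.A - r.B) * r.eta * s.eta = 1 →
        r.B + r.l ≤ s.B + s.l ∧ r.A - r.l ≤ s.A - s.l) ∧
    (m1pow (r.A - r.B) * r.eta * s.eta = -1 → r.A - r.l < s.B + s.l)) ∧
  ((r.subseg s ∧ ¬ s.subseg r) →
    (m1pow (r.A - r.B) * r.eta * s.eta = 1 → 0 ≤ s.l - r.l ∧ s.l - r.l ≤ s.b - r.b) ∧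
    (m1pow (r.A - r.B) * r.eta * s.eta = -1 → r.b ≤ r.l + s.l)) ∧
  ((s.subseg r ∧ ¬ r.subseg s) →
    (m1pow (r.A - r.B) * r.eta * s.eta = 1 → 0 ≤ r.l - s.l ∧ r.l - s.l ≤ r.b - s.b) ∧
    (m1pow (r.A - r.B) * r.eta * s.eta = -1 → s.b ≤ r.l + s.l))

/-- Xu's non-vanishing conditions at every adjacent pair of rows. -/
def XuAll (E : List Row) : Prop := E.Chain' XuPair

/-- The non-vanishing criterion for an extended multi-segment datum. -/
def NonVanishing (E : List Row) : Prop :=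
  StarCond E ∧
    ∀ d : ℕ, (∀ r ∈ E, 0 ≤ r.B + (d : ℚ)) →
      ∀ F, Reorder (shAll d E) F → XuAll F

/-- Applicability of a union-intersection at an adjacent pair of rows. -/
def uiApplicablePair (r s : Row) : Prop :=
  r.A < s.A ∧ r.B < s.B ∧
    ((m1pow (r.A - r.B) * r.eta * s.eta = 1 ∧
        (s.A - s.l = r.A - r.l ∨ s.B + s.l = r.B + r.l)) ∨
      (m1pow (r.A - r.B) * r.eta * s.eta = -1 ∧ s.B + s.l = r.A - r.l + 1))

instance (r s : Row) : Decidable (uiApplicablePair r s) := by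
  unfold uiApplicablePair; infer_instance

/-- Type 3' of a union-intersection at an adjacent pair. -/
def uiT3 (r s : Row) : Prop :=
  r.l = 0 ∧ s.l = 0 ∧ m1pow (r.A - r.B) * r.eta * s.eta = -1

instance (r s : Row) : Decidable (uiT3 r s) := by unfold uiT3; infer_instance

/-- The pair of rows produced by a union-intersection at an adjacent applicable pair. -/
def uiPair (r s : Row) : Row × Row :=
  if m1pow (r.A - r.B) * r.eta * s.eta = 1 then
    if s.A - s.l = r.A - r.l then
      -- Case 1
      ((⟨s.A, r.B, r.l, r.eta⟩ : Row),
       (⟨r.A, s.B, s.l - (s.A - r.A), m1pow (s.A - r.A) * s.eta⟩ : Row))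
    else
      -- Case 2
      if s.A - r.A ≤ r.b - 2 * r.l then
        (⟨s.A, r.B, r.l + (s.A - r.A), r.eta⟩,
         ⟨r.A, s.B, s.l, m1pow (s.A - r.A) * s.eta⟩)
      else
        (⟨s.A, r.B, r.b - r.l, - r.eta⟩,
         ⟨r.A, s.B, s.l, m1pow (s.A - r.A) * s.eta⟩)
  else
    -- Case 3
    if s.l ≤ r.l then
      (⟨s.A, r.B, r.l, r.eta⟩, ⟨r.A, s.B, s.l, m1pow (s.A - r.A) * s.eta⟩)
    else
      (⟨s.A, r.B, r.l, r.eta⟩, ⟨r.A, s.B, r.l, m1pow (s.A - r.A + 1) * s.eta⟩)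

/-- Union-intersection at positions `k, k+1` (deleting the second new row in type 3'). -/
def uiAt (k : ℕ) (E : List Row) : List Row :=
  match E[k]?, E[k+1]? with
  | some r, some s =>
      if uiApplicablePair r s then
        if uiT3 r s then
          E.take k ++ (uiPair r s).1 :: E.drop (k + 2)
        else
          E.take k ++ (uiPair r s).1 :: (uiPair r s).2 :: E.drop (k + 2)
      else E
  | _, _ => E

/-- Minimality: no union-intersection is applicable. -/
def MinimalP (E : List Row) : Prop :=
  ∀ F, Reorder E F → ∀ k r s, F[k]? = some r → F[k+1]? = some s →
    ¬ uiApplicablePair r s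

/-- The image of a row under Atobe's dual. -/
def dualRow (E : List Row) (i : ℕ) (r : Row) : Row :=
  let α := alphaAt E i
  let β := betaAt E i
  let η₀ : ℤ := if ¬ IsInt r.B ∧ r.l = r.b / 2 then - m1pow α else r.eta
  if IsInt r.B then
    ⟨r.A, -r.B, r.l + r.B, m1pow (α + β) * η₀⟩
  else
    ⟨r.A, -r.B, r.l + r.B + ((m1pow α * η₀ : ℤ) : ℚ) / 2, - (m1pow (α + β) * η₀)⟩

/-- Atobe's dual of a symbol whose order satisfies (P'). -/
def dual (E : List Row) : List Row :=
  (E.mapIdx fun i r => dualRow E i r).reverse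

/-- Applicability of the partial dual `dual_k^+` at position `k` (0-indexed). -/
def DualPlusApplicable (E : List Row) (k : ℕ) : Prop :=
  ∃ r, E[k]? = some r ∧ r.B = 1 / 2 ∧ r.l = 0 ∧ r.eta = - m1pow (alphaAt E k) ∧
    ∀ i, i < k → ∀ s, E[i]? = some s → s.B < 1 / 2

/-- The partial dual `dual_k^+` at position `k`. -/
def dualPlus (k : ℕ) (E : List Row) : List Row :=
  match E[k]? with
  | some rk =>
      (dual ((dual E).set (E.length - 1 - k)
          ⟨rk.A, 1 / 2, 0, - m1pow (gammaAt E k)⟩)).take k ++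
        (⟨rk.A, -(1 / 2), 0, - rk.eta⟩ : Row) :: E.drop (k + 1)
  | none => E

/-- Applicability of the partial dual `dual_k^-`. -/
def DualMinusApplicable (E : List Row) (k : ℕ) : Prop :=
  DualPlusApplicable (dual E) (E.length - 1 - k)

/-- The partial dual `dual_k^-`. -/
def dualMinus (k : ℕ) (E : List Row) : List Row :=
  dual (dualPlus (E.length - 1 - k) (dual E))

/-- Maximality: `E` is not, up to row exchanges, the result of a union-intersection
applied to a non-vanishing extended multi-segment datum. -/
def Maximal (E : List Row) : Prop :=
  ¬ ∃ (E'' F : List Row) (k : ℕ) (r s : Row), IsEMS E'' ∧ NonVanishing E'' ∧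
      Reorder E'' F ∧ F[k]? = some r ∧ F[k+1]? = some s ∧ uiApplicablePair r s ∧
      UpToRex (uiAt k F) E

/-- Absolute maximality. -/
def AbsolutelyMaximal (E : List Row) : Prop := Maximal E ∧ MinimalP (dual E)

/-- The sign `(-1)^{⌊b/2⌋ + l} * eta^b` of a row. -/
def rowSign (r : Row) : ℤ :=
  (if (⌊r.b / 2⌋ + ⌊r.l⌋) % 2 = 0 then (1 : ℤ) else -1) * r.eta ^ (⌊r.b⌋.toNat)

/-- The sign product of a symbol. -/
def signProd (E : List Row) : ℤ := (E.map rowSign).prod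

/-! ### Labeled symbols: rows carry labels that travel with them under reorderings. -/

/-- A labeled row. -/
abbrev LRow := ℕ × Row

/-- The underlying list of rows of a labeled symbol. -/
def rows (L : List LRow) : List Row := L.map Prod.snd

/-- `sh_i^d`, acting on the row labeled `i`. -/
def shL (i : ℕ) (d : ℤ) (L : List LRow) : List LRow :=
  L.map fun p => if p.1 = i then (p.1, p.2.sh d) else p

/-- `add_i^d`, acting on the row labeled `i`. -/
def addL (i : ℕ) (d : ℤ) (L : List LRow) : List LRow :=
  L.map fun p => if p.1 = i then (p.1, p.2.addOp d) else p

/-- `sh^d` on a labeled symbol. -/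
def shAllL (d : ℤ) (L : List LRow) : List LRow := L.map fun p => (p.1, p.2.sh d)

/-- Row exchange at positions `k, k+1` on a labeled symbol. -/
def rexL (k : ℕ) (L : List LRow) : List LRow :=
  match L[k]?, L[k+1]? with
  | some (a, r), some (c, s) =>
      if r.subseg s ∨ s.subseg r then
        L.take k ++ (c, (rexPair r s).1) :: (a, (rexPair r s).2) :: L.drop (k + 2)
      else L
  | _, _ => L

/-- One row exchange step on labeled symbols. -/
def ReorderStepL (L M : List LRow) : Prop := ∃ k, M = rexL k L

/-- Admissible reorderings of labeled symbols. -/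
def ReorderL : List LRow → List LRow → Prop := Relation.ReflTransGen ReorderStepL

/-- Labelwise equivalence of labeled symbols. -/
def LSymEquiv (L M : List LRow) : Prop :=
  List.Forall₂ (fun p q => p.1 = q.1 ∧ Row.Equiv p.2 q.2) L M

/-- `M` coincides with `L` up to row exchanges and rowwise equivalence (labels forgotten). -/
def CoincidesUpToRex (L M : List LRow) : Prop :=
  ∃ L', Relation.ReflTransGen (fun X Y => ReorderStepL X Y ∨ ReorderStepL Y X) L L' ∧
    SymEquiv (rows L') (rows M)

/-- Union-intersection at positions `k, k+1` on a labeled symbol. -/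
def uiAtL (k : ℕ) (L : List LRow) : List LRow :=
  match L[k]?, L[k+1]? with
  | some (a, r), some (c, s) =>
      if uiApplicablePair r s then
        if uiT3 r s then
          L.take k ++ (a, (uiPair r s).1) :: L.drop (k + 2)
        else
          L.take k ++ (a, (uiPair r s).1) :: (c, (uiPair r s).2) :: L.drop (k + 2)
      else L
  | _, _ => L

/-- The relation `M = ui_{i,j}(L)`, with a constraint `P` on the adjacent pair used:
some admissible reordering `L'` of `L` puts the row labeled `i` immediately before the
row labeled `j`, `ui` is applicable there, and `M` is obtained from the result by row
exchanges restoring the original relative order of the (surviving) labels. -/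
def UIrelWith (P : Row → Row → Prop) (L : List LRow) (i j : ℕ) (M : List LRow) : Prop :=
  ∃ (L' : List LRow) (k : ℕ) (r s : Row),
    ReorderL L L' ∧ L'[k]? = some (i, r) ∧ L'[k+1]? = some (j, s) ∧
    uiApplicablePair r s ∧ P r s ∧
    ReorderL (uiAtL k L') M ∧
    M.map Prod.fst =
      (L.map Prod.fst).filter fun x => decide (x ∈ (uiAtL k L').map Prod.fst)

/-- The relation `M = ui_{i,j}(L)`. -/
def UIrel (L : List LRow) (i j : ℕ) (M : List LRow) : Prop :=
  UIrelWith (fun _ _ => True) L i j M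

/-- Atobe's dual of a labeled symbol. -/
def dualL (L : List LRow) : List LRow :=
  (L.mapIdx fun i p => (p.1, dualRow (rows L) i p.2)).reverse

/-- The partial dual `dual^+` at position `k` on a labeled symbol. -/
def dualPlusL (k : ℕ) (L : List LRow) : List LRow :=
  match L[k]? with
  | some (lab, rk) =>
      (dualL ((dualL L).set (L.length - 1 - k)
          (lab, ⟨rk.A, 1 / 2, 0, - m1pow (gammaAt (rows L) k)⟩))).take k ++
        (lab, (⟨rk.A, -(1 / 2), 0, - rk.eta⟩ : Row)) :: L.drop (k + 1)
  | none => L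

/-- Position of the row labeled `i`. -/
def posOf (L : List LRow) (i : ℕ) : ℕ := L.findIdx fun p => p.1 == i

/-- The partial dual `dual_i^+`, acting at the row labeled `i`. -/
def dualPlusLab (i : ℕ) (L : List LRow) : List LRow := dualPlusL (posOf L i) L

/-- Applicability of `dual_i^+` on a labeled symbol. -/
def DualPlusApplicableLab (i : ℕ) (L : List LRow) : Prop :=
  i ∈ L.map Prod.fst ∧ DualPlusApplicable (rows L) (posOf L i)

/-- The partial dual `dual_i^-` on a labeled symbol. -/
def dualMinusLab (i : ℕ) (L : List LRow) : List LRow := dualL (dualPlusLab i (dualL L))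

/-- Applicability of `dual_i^-` on a labeled symbol. -/
def DualMinusApplicableLab (i : ℕ) (L : List LRow) : Prop :=
  DualPlusApplicableLab i (dualL L)

/-- One basic operator step: a row exchange, a union-intersection, a composition
`dual ∘ ui_{i,j} ∘ dual`, or an inverse of one of these. -/
def BasicStep (L M : List LRow) : Prop :=
  (∃ k, M = rexL k L) ∨ (∃ k, L = rexL k M) ∨
  (∃ i j, UIrel L i j M) ∨ (∃ i j, UIrel M i j L) ∨
  (∃ i j N, UIrel (dualL L) i j N ∧ M = dualL N) ∨
  (∃ i j N, UIrel (dualL M) i j N ∧ L = dualL N)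

/-- Finite sequences of basic operators. -/
def Basic : List LRow → List LRow → Prop := Relation.ReflTransGen BasicStep

/-- Shift every row after position `j` one step to the right. -/
def shAfter (j : ℕ) (E : List Row) : List Row :=
  E.mapIdx fun i r => if j < i then r.sh 1 else r

/-- Shift every row with `B_i ≥ B` one step to the left. -/
def shiftGE (B : ℚ) (E : List Row) : List Row :=
  E.map fun r => if B ≤ r.B then r.sh (-1) else r

/-- Shift every row with `B_i ≥ 1/2` one step to the left, deleting the rows of the
form `([1/2,1/2], 0, η)`. -/
def shiftHalfDel (E : List Row) : List Row :=
  (E.filter fun r => !decide (r.A = 1 / 2 ∧ r.B = 1 / 2 ∧ r.l = 0)).map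
    fun r => if (1 / 2 : ℚ) ≤ r.B then r.sh (-1) else r

/-- The rows `([A-r, -(A-r)-1], ⌊A⌋-r, 1)` for `r = 0, …, ⌊A⌋`. -/
def prefixRows (A : ℚ) : List Row :=
  (List.range (⌊A⌋.toNat + 1)).map fun r =>
    ⟨A - r, -(A - r) - 1, (⌊A⌋ : ℚ) - r, 1⟩

/-! ### Exchanges at the level of signed lengths -/

section SignedLengths

open scoped Classical

variable {A B : ℕ → ℚ}

/-- Containment of the segment labeled `m` in the segment labeled `n`. -/
def Sub (A B : ℕ → ℚ) (m n : ℕ) : Prop := B n ≤ B m ∧ A m ≤ A n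

theorem Sub.trans {m n k : ℕ} (h : Sub A B m n) (h' : Sub A B n k) : Sub A B m k :=
  ⟨h'.1.trans h.1, h.2.trans h'.2⟩

/-- An exchange of two neighbours, one of which contains the other: the larger one is
reflected in the smaller one. -/
inductive ZStep (A B : ℕ → ℚ) (C : ℕ → ℕ → Prop) : List (ℕ × ℚ) → List (ℕ × ℚ) → Prop
  | lo (S T : List (ℕ × ℚ)) (p q : ℕ × ℚ) (hC : C p.1 q.1) (h : Sub A B p.1 q.1) :
      ZStep A B C (S ++ p :: q :: T) (S ++ (q.1, 2 * p.2 - q.2) :: p :: T)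
  | hi (S T : List (ℕ × ℚ)) (p q : ℕ × ℚ) (hC : C p.1 q.1) (h : Sub A B q.1 p.1)
      (h' : ¬ Sub A B p.1 q.1) :
      ZStep A B C (S ++ p :: q :: T) (S ++ q :: (p.1, 2 * q.2 - p.2) :: T)

/-- Reachability by exchanges. -/
def ZReach (A B : ℕ → ℚ) (C : ℕ → ℕ → Prop) : List (ℕ × ℚ) → List (ℕ × ℚ) → Prop :=
  Relation.ReflTransGen (ZStep A B C)

/-- Any exchange is allowed. -/
def AnyC : ℕ → ℕ → Prop := fun _ _ => True

theorem ZStep.mono {C C' : ℕ → ℕ → Prop} (hC : ∀ m n, C m n → C' m n)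
    {Z Z' : List (ℕ × ℚ)} (h : ZStep A B C Z Z') : ZStep A B C' Z Z' := by
  cases h with
  | lo S T p q h1 h2 => exact .lo S T p q (hC _ _ h1) h2
  | hi S T p q h1 h2 h3 => exact .hi S T p q (hC _ _ h1) h2 h3

theorem ZReach.mono {C C' : ℕ → ℕ → Prop} (hC : ∀ m n, C m n → C' m n)
    {Z Z' : List (ℕ × ℚ)} (h : ZReach A B C Z Z') : ZReach A B C' Z Z' := by
  induction h with
  | refl => exact .refl
  | tail _ h ih => exact ih.tail (h.mono hC)

theorem ZStep.context {C : ℕ → ℕ → Prop} {Z Z' : List (ℕ × ℚ)} (S T : List (ℕ × ℚ))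
    (h : ZStep A B C Z Z') : ZStep A B C (S ++ Z ++ T) (S ++ Z' ++ T) := by
  cases h with
  | lo S' T' p q h1 h2 => simpa using ZStep.lo (S ++ S') (T' ++ T) p q h1 h2
  | hi S' T' p q h1 h2 h3 => simpa using ZStep.hi (S ++ S') (T' ++ T) p q h1 h2 h3

theorem ZReach.context {C : ℕ → ℕ → Prop} {Z Z' : List (ℕ × ℚ)} (S T : List (ℕ × ℚ))
    (h : ZReach A B C Z Z') : ZReach A B C (S ++ Z ++ T) (S ++ Z' ++ T) := by
  induction h with
  | refl => exact .refl
  | tail _ h ih => exact ih.tail (h.context S T)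

theorem ZReach.cons {C : ℕ → ℕ → Prop} {Z Z' : List (ℕ × ℚ)} (p : ℕ × ℚ)
    (h : ZReach A B C Z Z') : ZReach A B C (p :: Z) (p :: Z') := by
  simpa using h.context [p] []

theorem ZReach.append {C : ℕ → ℕ → Prop} {Z Z' : List (ℕ × ℚ)} (T : List (ℕ × ℚ))
    (h : ZReach A B C Z Z') : ZReach A B C (Z ++ T) (Z' ++ T) := by
  simpa using h.context [] T

/-- The labels of a list of labeled numbers. -/
abbrev labs (Z : List (ℕ × ℚ)) : List ℕ := Z.map Prod.fst

theorem ZStep.perm {C : ℕ → ℕ → Prop} {Z Z' : List (ℕ × ℚ)} (h : ZStep A B C Z Z') :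
    (labs Z).Perm (labs Z') := by
  cases h with
  | lo S T p q _ _ =>
    simp only [List.map_append, List.map_cons]
    exact (List.Perm.swap _ _ _).append_left _
  | hi S T p q _ _ _ =>
    simp only [List.map_append, List.map_cons]
    exact (List.Perm.swap _ _ _).append_left _

theorem ZReach.perm {C : ℕ → ℕ → Prop} {Z Z' : List (ℕ × ℚ)} (h : ZReach A B C Z Z') :
    (labs Z).Perm (labs Z') := by
  induction h with
  | refl => exact .refl _
  | tail _ h ih => exact ih.trans h.perm

/-- Admissibility of an order. -/
def Adm (A B : ℕ → ℚ) (O : List ℕ) : Prop :=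
  O.Pairwise fun m n => ¬ (A n < A m ∧ B n < B m)

theorem Adm.swap {S T : List ℕ} {m n : ℕ} (h : Adm A B (S ++ m :: n :: T))
    (hc : Sub A B m n ∨ Sub A B n m) : Adm A B (S ++ n :: m :: T) := by
  unfold Adm at *
  simp only [List.pairwise_append, List.pairwise_cons, List.mem_cons] at h ⊢
  obtain ⟨h1, ⟨h2, h3, h4⟩, h5⟩ := h
  refine ⟨h1, ⟨?_, ?_, h4⟩, ?_⟩
  · rintro a (rfl | ha)
    · rintro ⟨ha, hb⟩
      rcases hc with hc | hc
      · exact absurd hc.1 (not_le.2 hb)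
      · exact absurd hc.2 (not_le.2 ha)
    · exact h3 a ha
  · exact fun a ha => h2 a (Or.inr ha)
  · rintro a ha b (rfl | rfl | hb)
    · exact h5 a ha _ (by simp)
    · exact h5 a ha _ (by simp)
    · exact h5 a ha b (by simp [hb])

theorem ZStep.adm {C : ℕ → ℕ → Prop} {Z Z' : List (ℕ × ℚ)} (h : ZStep A B C Z Z')
    (ha : Adm A B (labs Z)) : Adm A B (labs Z') := by
  cases h with
  | lo S T p q _ h =>
    simp only [List.map_append, List.map_cons] at ha ⊢
    exact ha.swap (Or.inl h)
  | hi S T p q _ h _ =>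
    simp only [List.map_append, List.map_cons] at ha ⊢
    exact ha.swap (Or.inr h)

theorem ZReach.adm {C : ℕ → ℕ → Prop} {Z Z' : List (ℕ × ℚ)} (h : ZReach A B C Z Z')
    (ha : Adm A B (labs Z)) : Adm A B (labs Z') := by
  induction h with
  | refl => exact ha
  | tail _ h ih => exact h.adm ih

/-- The value of the row labeled `n` after all rows contained in it which precede it have
been moved behind it. -/
noncomputable def unw (A B : ℕ → ℚ) (n : ℕ) : List (ℕ × ℚ) → ℚ
  | [] => 0
  | t :: T => if t.1 = n then t.2 else if Sub A B t.1 n then 2 * t.2 - unw A B n T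
      else unw A B n T

theorem unw_append_congr (n : ℕ) (S : List (ℕ × ℚ)) {T T' : List (ℕ × ℚ)}
    (h : unw A B n T = unw A B n T') : unw A B n (S ++ T) = unw A B n (S ++ T') := by
  induction S with
  | nil => simpa using h
  | cons t S ih => simp [unw, ih]

theorem unw_step {C : ℕ → ℕ → Prop} {Z Z' : List (ℕ × ℚ)} (h : ZStep A B C Z Z')
    (hn : (labs Z).Nodup)
    (heq : ∀ S p q T, Z = S ++ p :: q :: T → Sub A B p.1 q.1 → Sub A B q.1 p.1 → p.2 = q.2)
    (n : ℕ) : unw A B n Z' = unw A B n Z := by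
  cases h with
  | lo S T p q _ h =>
    have hpq : p.1 ≠ q.1 := by
      simp only [List.map_append, List.map_cons] at hn
      have := (List.nodup_append.1 hn).2.1
      simp only [List.nodup_cons, List.mem_cons, not_or] at this
      exact this.1.1
    have he := heq S p q T rfl h
    apply unw_append_congr
    simp only [unw]
    by_cases h1 : q.1 = n
    · simp [h1, h1 ▸ hpq, h1 ▸ h]
    by_cases h2 : p.1 = n
    · subst h2
      simp only [h1, if_false, if_true]
      split_ifs with h3
      · have := he h3; linarith
      · rfl
    · simp only [h1, h2, if_false]
      by_cases h3 : Sub A B q.1 n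
      · simp only [h3, h.trans h3, if_true]; ring
      · simp only [h3, if_false]
  | hi S T p q _ h h' =>
    have hpq : p.1 ≠ q.1 := by
      simp only [List.map_append, List.map_cons] at hn
      have := (List.nodup_append.1 hn).2.1
      simp only [List.nodup_cons, List.mem_cons, not_or] at this
      exact this.1.1
    apply unw_append_congr
    simp only [unw]
    by_cases h1 : q.1 = n
    · subst h1
      simp [hpq, h']
    by_cases h2 : p.1 = n
    · subst h2
      simp only [h1, if_false, if_true, h]
      ring
    · simp only [h1, h2, if_false]
      by_cases h3 : Sub A B p.1 n
      · simp only [h3, h.trans h3, if_true]; ring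
      · simp only [h3, if_false]

/-- The unwound values are given by `u`. -/
def Unwinds (A B : ℕ → ℚ) (u : ℕ → ℚ) (Z : List (ℕ × ℚ)) : Prop :=
  (labs Z).Nodup ∧ ∀ n ∈ labs Z, unw A B n Z = u n

/-- Equal segments carry equal values. -/
def EqSeg (A B : ℕ → ℚ) (u : ℕ → ℚ) (O : List ℕ) : Prop :=
  ∀ m ∈ O, ∀ n ∈ O, Sub A B m n → Sub A B n m → u m = u n

theorem EqSeg.perm {u : ℕ → ℚ} {O O' : List ℕ} (h : EqSeg A B u O) (hp : O.Perm O') :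
    EqSeg A B u O' := fun m hm n hn => h m (hp.mem_iff.2 hm) n (hp.mem_iff.2 hn)

theorem unw_sub_eq (m n : ℕ) (hmn : Sub A B m n) (hnm : Sub A B n m) (S : List (ℕ × ℚ))
    (hm : m ∉ labs S) (hn : n ∉ labs S) (T T' : List (ℕ × ℚ)) :
    |unw A B m (S ++ T) - unw A B n (S ++ T')| = |unw A B m T - unw A B n T'| := by
  induction S with
  | nil => rfl
  | cons t S ih =>
    simp only [List.map_cons, List.mem_cons, not_or] at hm hn
    have ih := ih hm.2 hn.2
    have h1 : Sub A B t.1 m ↔ Sub A B t.1 n := ⟨fun h => h.trans hmn, fun h => h.trans hnm⟩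
    simp only [List.cons_append, unw, Ne.symm hm.1, Ne.symm hn.1, if_false, h1]
    split_ifs
    · rw [← ih, ← abs_neg]; congr 1; ring
    · exact ih

theorem Unwinds.adjacent_eq {u : ℕ → ℚ} {Z : List (ℕ × ℚ)} (h : Unwinds A B u Z)
    (he : EqSeg A B u (labs Z)) (S : List (ℕ × ℚ)) (p q : ℕ × ℚ) (T : List (ℕ × ℚ))
    (hZ : Z = S ++ p :: q :: T) (hpq : Sub A B p.1 q.1) (hqp : Sub A B q.1 p.1) :
    p.2 = q.2 := by
  obtain ⟨hn, hu⟩ := h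
  have e1 := hu p.1 (by simp [hZ])
  have e2 := hu q.1 (by simp [hZ])
  have e3 := he p.1 (by simp [hZ]) q.1 (by simp [hZ]) hpq hqp
  rw [hZ] at hn e1 e2
  simp only [List.map_append, List.map_cons] at hn
  have h1 := List.nodup_append.1 hn
  have h2 := h1.2.1
  simp only [List.nodup_cons, List.mem_cons, not_or] at h2
  have hp : p.1 ∉ labs S := fun hm => h1.2.2 _ hm p.1 (by simp) rfl
  have hq : q.1 ∉ labs S := fun hm => h1.2.2 _ hm q.1 (by simp) rfl
  have := unw_sub_eq p.1 q.1 hpq hqp S hp hq (p :: q :: T) (p :: q :: T)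
  rw [e1, e2, e3, sub_self, abs_zero] at this
  have := abs_eq_zero.1 this.symm
  simp [unw, h2.1.1, hpq] at this
  linarith

theorem Unwinds.step {u : ℕ → ℚ} {C : ℕ → ℕ → Prop} {Z Z' : List (ℕ × ℚ)}
    (h : Unwinds A B u Z) (he : EqSeg A B u (labs Z)) (hs : ZStep A B C Z Z') :
    Unwinds A B u Z' := by
  refine ⟨hs.perm.nodup_iff.1 h.1, fun n hn => ?_⟩
  rw [unw_step hs h.1 (fun S p q T hZ => h.adjacent_eq he S p q T hZ) n]
  exact h.2 n (hs.perm.mem_iff.2 hn)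

theorem Unwinds.reach {u : ℕ → ℚ} {C : ℕ → ℕ → Prop} {Z Z' : List (ℕ × ℚ)}
    (h : Unwinds A B u Z) (he : EqSeg A B u (labs Z)) (hs : ZReach A B C Z Z') :
    Unwinds A B u Z' := by
  induction hs with
  | refl => exact h
  | tail h1 h2 ih => exact ih.step (he.perm (ZReach.perm h1)) h2

/-- Exchanges are reversible as soon as neighbouring equal segments carry equal values. -/
theorem ZStep.symm {C : ℕ → ℕ → Prop} {Z Z' : List (ℕ × ℚ)} (h : ZStep A B C Z Z')
    (heq : ∀ S p q T, Z = S ++ p :: q :: T → Sub A B p.1 q.1 → Sub A B q.1 p.1 → p.2 = q.2)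
    (hC : ∀ m n, C m n → C n m) : ZStep A B C Z' Z := by
  cases h with
  | lo S T p q h1 h2 =>
    by_cases h3 : Sub A B q.1 p.1
    · have e := heq S p q T rfl h2 h3
      have := ZStep.lo (C := C) S T (q.1, 2 * p.2 - q.2) p (hC _ _ h1) h3
      convert this using 3
      · ext <;> simp; linarith
      · simp only [List.cons.injEq, and_true]
        ext <;> simp; linarith
    · have := ZStep.hi (C := C) S T (q.1, 2 * p.2 - q.2) p (hC _ _ h1) h2 h3
      simpa using this
  | hi S T p q h1 h2 h3 =>
    have := ZStep.lo (C := C) S T q (p.1, 2 * q.2 - p.2) (hC _ _ h1) h2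
    simpa using this

theorem Unwinds.reach_symm {u : ℕ → ℚ} {C : ℕ → ℕ → Prop} {Z Z' : List (ℕ × ℚ)}
    (h : Unwinds A B u Z) (he : EqSeg A B u (labs Z)) (hs : ZReach A B C Z Z')
    (hC : ∀ m n, C m n → C n m) : ZReach A B C Z' Z := by
  induction hs with
  | refl => exact .refl
  | tail h1 h2 ih =>
    have hu := h.reach he h1
    exact Relation.ReflTransGen.head
      (h2.symm (fun S p q T hZ => hu.adjacent_eq (he.perm (ZReach.perm h1)) S p q T hZ) hC) ih

theorem exists_insert {C r : ℕ → ℕ → Prop} (htot : ∀ m n, r m n ∨ r n m)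
    (htr : ∀ m n k, r m n → r n k → r m k)
    (hC : ∀ m n, C m n → Sub A B m n ∨ Sub A B n m) (Z : List (ℕ × ℚ)) :
    ∀ x : ℕ × ℚ, (labs Z).Pairwise r → (∀ n ∈ labs Z, ¬ r x.1 n → C x.1 n) →
      ∃ Z', ZReach A B C (x :: Z) Z' ∧ (labs Z').Pairwise r := by
  induction Z with
  | nil => exact fun x _ _ => ⟨[x], .refl, by simp⟩
  | cons y Z ih =>
    intro x hs hx
    simp only [List.map_cons, List.pairwise_cons, List.mem_cons] at hs hx
    by_cases h : r x.1 y.1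
    · refine ⟨x :: y :: Z, .refl, ?_⟩
      simp only [List.map_cons, List.pairwise_cons, List.mem_cons]
      refine ⟨?_, hs⟩
      rintro n (rfl | hn)
      · exact h
      · exact htr _ _ _ h (hs.1 n hn)
    · have hCxy := hx y.1 (Or.inl rfl) h
      have key : ∃ y' x' : ℕ × ℚ, y'.1 = y.1 ∧ x'.1 = x.1 ∧
          ZStep A B C (x :: y :: Z) (y' :: x' :: Z) := by
        by_cases h1 : Sub A B x.1 y.1
        · exact ⟨(y.1, 2 * x.2 - y.2), x, rfl, rfl, ZStep.lo [] Z x y hCxy h1⟩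
        · exact ⟨y, (x.1, 2 * y.2 - x.2), rfl, rfl,
            ZStep.hi [] Z x y hCxy ((hC _ _ hCxy).resolve_left h1) h1⟩
      obtain ⟨y', x', hy', hx', hst⟩ := key
      obtain ⟨Z', hr, hp⟩ := ih x' hs.2 (by rw [hx']; exact fun n hn => hx n (Or.inr hn))
      refine ⟨y' :: Z', Relation.ReflTransGen.head hst (hr.cons y'), ?_⟩
      simp only [List.map_cons, List.pairwise_cons]
      refine ⟨fun n hn => ?_, hp⟩
      have hn' := hr.perm.mem_iff.2 hn
      simp only [List.map_cons, List.mem_cons] at hn'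
      rw [hy']
      rcases hn' with rfl | hn'
      · rw [hx']; exact (htot _ _).resolve_left h
      · exact hs.1 n hn'

theorem exists_sort {C r : ℕ → ℕ → Prop} (htot : ∀ m n, r m n ∨ r n m)
    (htr : ∀ m n k, r m n → r n k → r m k)
    (hC : ∀ m n, C m n → Sub A B m n ∨ Sub A B n m) (Z : List (ℕ × ℚ))
    (h : (labs Z).Pairwise fun m n => ¬ r m n → C m n) :
    ∃ Z', ZReach A B C Z Z' ∧ (labs Z').Pairwise r := by
  induction Z with
  | nil => exact ⟨[], .refl, by simp⟩
  | cons x Z ih =>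
    simp only [List.map_cons, List.pairwise_cons] at h
    obtain ⟨Z1, h1, h2⟩ := ih h.2
    obtain ⟨Z2, h3, h4⟩ := exists_insert (A := A) (B := B) htot htr hC Z1 x h2
      (fun n hn => h.1 n (h1.perm.mem_iff.2 hn))
    exact ⟨Z2, (h1.cons x).trans h3, h4⟩

/-- The order by increasing `B`, ties being broken by decreasing `A` and then by labels. -/
def Rk (A B : ℕ → ℚ) (m n : ℕ) : Prop :=
  B m < B n ∨ (B m = B n ∧ (A n < A m ∨ (A m = A n ∧ m ≤ n)))

theorem Rk.total (m n : ℕ) : Rk A B m n ∨ Rk A B n m := by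
  unfold Rk
  rcases lt_trichotomy (B m) (B n) with h | h | h
  · exact .inl (.inl h)
  · rcases lt_trichotomy (A m) (A n) with h' | h' | h'
    · exact .inr (.inr ⟨h.symm, .inl h'⟩)
    · rcases le_total m n with h'' | h''
      · exact .inl (.inr ⟨h, .inr ⟨h', h''⟩⟩)
      · exact .inr (.inr ⟨h.symm, .inr ⟨h'.symm, h''⟩⟩)
    · exact .inl (.inr ⟨h, .inl h'⟩)
  · exact .inr (.inl h)

theorem Rk.trans (m n k : ℕ) : Rk A B m n → Rk A B n k → Rk A B m k := by
  unfold Rk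
  rintro (h | ⟨h, h' | ⟨h', h''⟩⟩) (g | ⟨g, g' | ⟨g', g''⟩⟩)
  · exact .inl (h.trans g)
  · exact .inl (h.trans_eq g)
  · exact .inl (h.trans_eq g)
  · exact .inl (h.trans_lt g)
  · exact .inr ⟨h.trans g, .inl (g'.trans h')⟩
  · exact .inr ⟨h.trans g, .inl (g'.symm.trans_lt h')⟩
  · exact .inl (h.trans_lt g)
  · exact .inr ⟨h.trans g, .inl (g'.trans_eq h'.symm)⟩
  · exact .inr ⟨h.trans g, .inr ⟨h'.trans g', h''.trans g''⟩⟩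

theorem Rk.le {m n : ℕ} (h : Rk A B m n) : B m ≤ B n := by
  rcases h with h | ⟨h, _⟩
  · exact h.le
  · exact h.le

theorem Rk.antisymm {m n : ℕ} (h : Rk A B m n) (h' : Rk A B n m) : m = n := by
  unfold Rk at h h'
  rcases h with h | ⟨h, k | ⟨k, l⟩⟩ <;> rcases h' with h' | ⟨h', k' | ⟨k', l'⟩⟩ <;>
    first | exact le_antisymm l l' | (exfalso; linarith)

theorem Adm.exists_sort {Z : List (ℕ × ℚ)} (h : Adm A B (labs Z)) :
    ∃ Z', ZReach A B AnyC Z Z' ∧ (labs Z').Pairwise (Rk A B) := by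
  obtain ⟨Z', h1, h2⟩ := LocalArthur.exists_sort (A := A) (B := B)
    (C := fun m n => Sub A B m n ∨ Sub A B n m) (r := Rk A B) Rk.total Rk.trans
    (fun _ _ h => h) Z (by
      refine List.Pairwise.imp (fun {m n} ha hr => ?_) h
      have hr' := (Rk.total (A := A) (B := B) m n).resolve_left hr
      rcases hr' with hb | ⟨hb, _⟩
      · left
        refine ⟨hb.le, ?_⟩
        by_contra hc
        exact ha ⟨not_le.1 hc, hb⟩
      · rcases le_total (A m) (A n) with hA | hA
        · exact .inl ⟨hb.le, hA⟩
        · exact .inr ⟨hb.ge, hA⟩)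
  exact ⟨Z', h1.mono fun _ _ _ => trivial, h2⟩

end SignedLengths

/-! ### Iterated reflections and the generalized Lipschitz property -/

section Reflections

open scoped Classical

variable {A B : ℕ → ℚ}

/-- The composition of the reflections in the values of the labels satisfying `K`. -/
noncomputable def refl (K : ℕ → Prop) (u : ℕ → ℚ) : List ℕ → ℚ → ℚ
  | [], v => v
  | t :: T, v => if K t then 2 * u t - refl K u T v else refl K u T v

/-- The linear part of `refl`. -/
noncomputable def rsg (K : ℕ → Prop) : List ℕ → ℚ
  | [] => 1
  | t :: T => if K t then - rsg K T else rsg K T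

theorem rsg_eq (K : ℕ → Prop) (O : List ℕ) : rsg K O = 1 ∨ rsg K O = -1 := by
  induction O with
  | nil => exact .inl rfl
  | cons t T ih =>
    simp only [rsg]
    split_ifs
    · rcases ih with h | h <;> simp [h]
    · exact ih

theorem rsg_mul_self (K : ℕ → Prop) (O : List ℕ) : rsg K O * rsg K O = 1 := by
  rcases rsg_eq K O with h | h <;> simp [h]

theorem abs_rsg (K : ℕ → Prop) (O : List ℕ) : |rsg K O| = 1 := by
  rcases rsg_eq K O with h | h <;> simp [h]

theorem refl_sub (K : ℕ → Prop) (u : ℕ → ℚ) (O : List ℕ) (v w : ℚ) :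
    refl K u O v - refl K u O w = rsg K O * (v - w) := by
  induction O with
  | nil => simp [refl, rsg]
  | cons t T ih =>
    simp only [refl, rsg]
    split_ifs
    · linear_combination -ih
    · exact ih

theorem refl_eq_add (K : ℕ → Prop) (u : ℕ → ℚ) (O : List ℕ) (v w : ℚ) :
    refl K u O (v + w) = refl K u O v + rsg K O * w := by
  have := refl_sub K u O (v + w) v
  linear_combination this

theorem abs_refl_sub (K : ℕ → Prop) (u : ℕ → ℚ) (O : List ℕ) (v w : ℚ) :
    |refl K u O v - refl K u O w| = |v - w| := by
  rw [refl_sub, abs_mul, abs_rsg, one_mul]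

theorem refl_append (K : ℕ → Prop) (u : ℕ → ℚ) (O O' : List ℕ) (v : ℚ) :
    refl K u (O ++ O') v = refl K u O (refl K u O' v) := by
  induction O with
  | nil => rfl
  | cons t T ih => simp [refl, ih]

theorem rsg_append (K : ℕ → Prop) (O O' : List ℕ) :
    rsg K (O ++ O') = rsg K O * rsg K O' := by
  induction O with
  | nil => simp [rsg]
  | cons t T ih =>
    simp only [List.cons_append, rsg, ih]
    split_ifs <;> ring

theorem refl_congr {K K' : ℕ → Prop} {u u' : ℕ → ℚ} {O : List ℕ}
    (h : ∀ t ∈ O, K t ↔ K' t) (hu : ∀ t ∈ O, K t → u t = u' t) (v : ℚ) :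
    refl K u O v = refl K' u' O v := by
  induction O with
  | nil => rfl
  | cons t T ih =>
    have ih := ih (fun t ht => h t (by simp [ht])) (fun t ht => hu t (by simp [ht]))
    have h1 := h t (by simp)
    simp only [refl, ih]
    by_cases h2 : K t
    · rw [if_pos h2, if_pos (h1.1 h2), hu t (by simp) h2]
    · rw [if_neg h2, if_neg (fun h3 => h2 (h1.2 h3))]

theorem refl_congr_left {K K' : ℕ → Prop} {u : ℕ → ℚ} {O : List ℕ}
    (h : ∀ t ∈ O, K t ↔ K' t) (v : ℚ) : refl K u O v = refl K' u O v :=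
  refl_congr h (fun _ _ _ => rfl) v

theorem rsg_congr {K K' : ℕ → Prop} {O : List ℕ} (h : ∀ t ∈ O, K t ↔ K' t) :
    rsg K O = rsg K' O := by
  induction O with
  | nil => rfl
  | cons t T ih =>
    have ih := ih (fun t ht => h t (by simp [ht]))
    have h1 := h t (by simp)
    simp only [rsg, ih, h1]

theorem refl_of_not {K : ℕ → Prop} (u : ℕ → ℚ) {O : List ℕ} (h : ∀ t ∈ O, ¬ K t) (v : ℚ) :
    refl K u O v = v := by
  induction O with
  | nil => rfl
  | cons t T ih =>
    simp only [refl, if_neg (h t (by simp)), ih (fun t ht => h t (by simp [ht]))]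

theorem rsg_of_not {K : ℕ → Prop} {O : List ℕ} (h : ∀ t ∈ O, ¬ K t) : rsg K O = 1 := by
  induction O with
  | nil => rfl
  | cons t T ih =>
    simp only [rsg, if_neg (h t (by simp)), ih (fun t ht => h t (by simp [ht]))]

theorem refl_reverse_refl (K : ℕ → Prop) (u : ℕ → ℚ) (O : List ℕ) (v : ℚ) :
    refl K u O (refl K u O.reverse v) = v := by
  induction O generalizing v with
  | nil => rfl
  | cons t T ih =>
    simp only [List.reverse_cons, refl_append, refl]
    split_ifs
    · rw [ih]; ring
    · rw [ih]

theorem abs_sub_refl_reverse (K : ℕ → Prop) (u : ℕ → ℚ) (O : List ℕ) (x y : ℚ) :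
    |y - refl K u O.reverse x| = |x - refl K u O y| := by
  rw [← abs_refl_sub K u O, refl_reverse_refl, abs_sub_comm]

theorem refl_const_sub (K : ℕ → Prop) (u : ℕ → ℚ) (κ : ℚ) (O : List ℕ) (v : ℚ) :
    refl K (fun n => κ - u n) O (κ - v) = κ - refl K u O v := by
  induction O with
  | nil => rfl
  | cons t T ih =>
    simp only [refl, ih]
    split_ifs <;> ring

/-- The list of labeled values with labels `O` and values given by `u`. -/
abbrev withVal (u : ℕ → ℚ) (O : List ℕ) : List (ℕ × ℚ) := O.map fun n => (n, u n)

theorem labs_withVal (u : ℕ → ℚ) (O : List ℕ) : labs (withVal u O) = O := by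
  simp [labs, withVal, Function.comp_def]

/-- The distance of two segments. -/
def sdist (A B : ℕ → ℚ) (m n : ℕ) : ℚ := |A m - A n| + |B m - B n|

theorem sdist_comm (m n : ℕ) : sdist A B m n = sdist A B n m := by
  unfold sdist; rw [abs_sub_comm, abs_sub_comm (B m)]

theorem sdist_of_le {m n : ℕ} (h : B m ≤ B n) : sdist A B m n = |A m - A n| + (B n - B m) := by
  unfold sdist; rw [abs_sub_comm (B m), abs_of_nonneg (sub_nonneg.2 h)]

theorem sdist_of_ge {m n : ℕ} (h : B m ≤ B n) (h' : A n ≤ A m) :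
    sdist A B m n = A m - A n + (B n - B m) := by
  rw [sdist_of_le h, abs_of_nonneg (sub_nonneg.2 h')]

theorem sdist_eq_zero {m n : ℕ} (h : Sub A B m n) (h' : Sub A B n m) : sdist A B m n = 0 := by
  unfold sdist
  rw [le_antisymm h.2 h'.2, le_antisymm h'.1 h.1]; simp

/-- Neighbours differ by at most the distance of their segments. -/
def Lip (A B : ℕ → ℚ) (Z : List (ℕ × ℚ)) : Prop :=
  ∀ S p q T, Z = S ++ p :: q :: T → |p.2 - q.2| ≤ sdist A B p.1 q.1

/-- All reorderings are Lipschitz. -/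
def LipAll (A B : ℕ → ℚ) (Z : List (ℕ × ℚ)) : Prop :=
  ∀ Z', ZReach A B AnyC Z Z' → Lip A B Z'

theorem LipAll.reach {Z Z' : List (ℕ × ℚ)} (h : LipAll A B Z) (hr : ZReach A B AnyC Z Z') :
    LipAll A B Z' := fun _ h' => h _ (hr.trans h')

theorem Lip.adjacent_eq {Z : List (ℕ × ℚ)} (h : Lip A B Z) (S : List (ℕ × ℚ)) (p q : ℕ × ℚ)
    (T : List (ℕ × ℚ)) (hZ : Z = S ++ p :: q :: T) (h1 : Sub A B p.1 q.1)
    (h2 : Sub A B q.1 p.1) : p.2 = q.2 := by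
  have := h S p q T hZ
  rw [sdist_eq_zero h1 h2] at this
  exact sub_eq_zero.1 (abs_eq_zero.1 (le_antisymm this (abs_nonneg _)))

theorem LipAll.reach_symm {C : ℕ → ℕ → Prop} {Z Z' : List (ℕ × ℚ)} (h : LipAll A B Z)
    (hr : ZReach A B C Z Z') (hC : ∀ m n, C m n → C n m) : ZReach A B C Z' Z := by
  induction hr with
  | refl => exact .refl
  | tail h1 h2 ih =>
    have h3 := h _ (ZReach.mono (fun _ _ _ => trivial) h1)
    exact Relation.ReflTransGen.head (h2.symm (fun S p q T hZ => h3.adjacent_eq S p q T hZ) hC) ih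

theorem LipAll.hiStep {S T : List (ℕ × ℚ)} {p q : ℕ × ℚ} (h : LipAll A B (S ++ p :: q :: T))
    (hs : Sub A B q.1 p.1) :
    ZReach A B AnyC (S ++ p :: q :: T) (S ++ q :: (p.1, 2 * q.2 - p.2) :: T) := by
  by_cases h' : Sub A B p.1 q.1
  · have e := (h _ .refl).adjacent_eq S p q T rfl h' hs
    have := ZStep.lo (A := A) (B := B) (C := AnyC) S T p q trivial h'
    apply Relation.ReflTransGen.single
    convert this using 3
    · ext <;> simp; linarith
    · simp only [List.cons.injEq, and_true]
      ext <;> simp; linarith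
  · exact Relation.ReflTransGen.single (.hi S T p q trivial hs h')

theorem LipAll.moveLeft {s : ℕ × ℚ} {T : List (ℕ × ℚ)} (H : List (ℕ × ℚ)) :
    ∀ S, LipAll A B (S ++ (H ++ s :: T)) → (∀ h ∈ labs H, Sub A B s.1 h) →
      ∃ H', labs H' = labs H ∧
        ZReach A B AnyC (S ++ (H ++ s :: T)) (S ++ s :: (H' ++ T)) := by
  induction H with
  | nil => exact fun S _ _ => ⟨[], rfl, .refl⟩
  | cons t H ih =>
    intro S h hs
    simp only [List.map_cons, List.mem_cons, forall_eq_or_imp] at hs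
    obtain ⟨H', h1, h2⟩ := ih (S ++ [t]) (by simpa using h) hs.2
    simp only [List.append_assoc, List.cons_append, List.nil_append] at h2
    have h3 : LipAll A B (S ++ t :: s :: (H' ++ T)) := h.reach (by simpa using h2)
    refine ⟨(t.1, 2 * s.2 - t.2) :: H', by simp [h1], ?_⟩
    exact Relation.ReflTransGen.trans (show ZReach A B AnyC _ _ by simpa using h2) (h3.hiStep hs.1)

/-- Reflections in the second components. -/
noncomputable def reflZ (K : ℕ → Prop) : List (ℕ × ℚ) → ℚ → ℚ
  | [], v => v
  | t :: T, v => if K t.1 then 2 * t.2 - reflZ K T v else reflZ K T v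

theorem reflZ_withVal (K : ℕ → Prop) (u : ℕ → ℚ) (O : List ℕ) (v : ℚ) :
    reflZ K (withVal u O) v = refl K u O v := by
  induction O with
  | nil => rfl
  | cons t T ih => simp only [withVal, List.map_cons, reflZ, refl] at ih ⊢; rw [ih]

theorem LipAll.reflZ_le (K : ℕ → Prop) (y : ℕ × ℚ) (Q : List (ℕ × ℚ)) (S : List (ℕ × ℚ)) :
    ∀ (P : List (ℕ × ℚ)) (x : ℕ × ℚ) (H : List (ℕ × ℚ)),
      LipAll A B (P ++ x :: (H ++ (S ++ y :: Q))) →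
      (∀ s ∈ labs S, K s → Sub A B s x.1) → (∀ s ∈ labs S, ¬ K s → Sub A B y.1 s) →
      (∀ h ∈ labs H, Sub A B y.1 h) →
      (∀ h ∈ labs H, ∀ s ∈ labs S, K s → Sub A B s h) →
      (labs S).Pairwise (fun h s => ¬ K h → K s → Sub A B s h) →
      |x.2 - reflZ K S y.2| ≤ sdist A B x.1 y.1 := by
  induction S with
  | nil =>
    intro P x H h _ _ h1 _ _
    obtain ⟨H', _, h2⟩ := LipAll.moveLeft (s := y) (T := Q) H (P ++ [x]) (by simpa using h) h1
    have h3 := h _ (by simpa using h2)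
    exact h3 P x y (H' ++ Q) (by simp)
  | cons s S ih =>
    intro P x H h h1 h2 h3 h4 h5
    simp only [List.map_cons, List.mem_cons, forall_eq_or_imp, List.pairwise_cons] at h1 h2 h4 h5
    by_cases hK : K s.1
    · have h6 : ∀ t ∈ labs (x :: H), Sub A B s.1 t := by
        simp only [List.map_cons, List.mem_cons, forall_eq_or_imp]
        exact ⟨h1.1 hK, fun t ht => (h4 t ht).1 hK⟩
      obtain ⟨H', e, hr⟩ := LipAll.moveLeft (s := s) (T := S ++ y :: Q) H (P ++ [x])
        (by simpa using h) (fun t ht => (h4 t ht).1 hK)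
      simp only [List.append_assoc, List.cons_append, List.nil_append] at hr
      have hL : LipAll A B (P ++ x :: s :: (H' ++ (S ++ y :: Q))) := h.reach (by simpa using hr)
      have hL' := hL.reach (hL.hiStep (h1.1 hK))
      have := ih (P ++ [s]) (x.1, 2 * s.2 - x.2) H' (by simpa using hL') h1.2 h2.2
        (by rw [e]; exact h3) (by rw [e]; exact fun t ht => (h4 t ht).2) h5.2
      simp only [reflZ, if_pos hK]
      calc |x.2 - (2 * s.2 - reflZ K S y.2)| = |2 * s.2 - x.2 - reflZ K S y.2| := by
            rw [← abs_neg]; congr 1; ring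
        _ ≤ _ := this
    · have := ih P x (H ++ [s]) (by simpa using h) h1.2 h2.2 (by
          simp only [List.map_append, List.map_cons, List.map_nil, List.mem_append,
            List.mem_singleton]
          rintro t (ht | rfl)
          · exact h3 t ht
          · exact h2.1 hK) (by
          simp only [List.map_append, List.map_cons, List.map_nil, List.mem_append,
            List.mem_singleton]
          rintro t (ht | rfl) r hr
          · exact (h4 t ht).2 r hr
          · exact h5.1 r hr hK) h5.2
      simpa only [reflZ, if_neg hK] using this

/-- The generalized Lipschitz property of an order with values `u`. -/
def GenLip (A B : ℕ → ℚ) (u : ℕ → ℚ) (O : List ℕ) : Prop :=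
  ∀ (K : ℕ → Prop) (P : List ℕ) (x : ℕ) (S : List ℕ) (y : ℕ) (Q : List ℕ),
    O = P ++ x :: (S ++ y :: Q) → (∀ s ∈ S, K s → A s ≤ A x) → (∀ s ∈ S, ¬ K s → A y ≤ A s) →
    S.Pairwise (fun h s => ¬ K h → K s → A s ≤ A h) →
    |u x - refl K u S (u y)| ≤ sdist A B x y

/-- A weak form of `GenLip`. -/
def WeakLip (A B : ℕ → ℚ) (u : ℕ → ℚ) (O : List ℕ) : Prop :=
  ∀ (K : ℕ → Prop) (P : List ℕ) (x : ℕ) (S : List ℕ) (y : ℕ) (Q : List ℕ),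
    O = P ++ x :: (S ++ y :: Q) → (∀ s ∈ S, K s → A s ≤ A x ∧ A s ≤ A y) →
    (∀ s ∈ S, ¬ K s → A x ≤ A s ∧ A y ≤ A s) →
    |u x - refl K u S (u y)| ≤ sdist A B x y

theorem LipAll.genLip {u : ℕ → ℚ} {O : List ℕ} (h : LipAll A B (withVal u O))
    (hO : O.Pairwise fun m n => B m ≤ B n) : GenLip A B u O := by
  rintro K P x S y Q rfl h1 h2 h3
  simp only [List.pairwise_append, List.pairwise_cons, List.mem_cons, List.mem_append] at hO
  obtain ⟨_, ⟨hx, hS, _, hSy⟩, _⟩ := hO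
  have := LipAll.reflZ_le (A := A) (B := B) K (y, u y) (withVal u Q) (withVal u S)
    (withVal u P) (x, u x) [] (by simpa [withVal] using h)
    (by
      rw [labs_withVal]
      exact fun s hs hK => ⟨hx s (.inl hs), h1 s hs hK⟩)
    (by
      rw [labs_withVal]
      exact fun s hs hK => ⟨hSy s hs y (.inl rfl), h2 s hs hK⟩)
    (by simp) (by simp)
    (by
      rw [labs_withVal]
      exact (h3.and hS).imp fun {a b} hab ha hb => ⟨hab.2, hab.1 ha hb⟩)
  rwa [reflZ_withVal] at this

theorem GenLip.weak {u : ℕ → ℚ} {O : List ℕ} (h : GenLip A B u O) : WeakLip A B u O := by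
  intro K P x S y Q hO h1 h2
  refine h K P x S y Q hO (fun s hs hK => (h1 s hs hK).1) (fun s hs hK => (h2 s hs hK).2) ?_
  rw [List.pairwise_iff_forall_sublist]
  intro a b hab ha hb
  have ha' := hab.subset (List.mem_cons_self (a := a) (l := [b]))
  have hb' := hab.subset (by simp : b ∈ [a, b])
  exact (h1 b hb' hb).1.trans (h2 a ha' ha).1

theorem WeakLip.dual {u : ℕ → ℚ} {O : List ℕ} (h : WeakLip A B u O) (κ : ℚ) :
    WeakLip A (fun n => - B n) (fun n => κ - u n) O.reverse := by
  intro K P x S y Q hO h1 h2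
  have hO' : O = Q.reverse ++ y :: (S.reverse ++ x :: P.reverse) := by
    rw [← List.reverse_reverse O, hO]; simp
  have := h K _ y _ x _ hO'
    (fun s hs hK => (h1 s (by simpa using hs) hK).symm)
    (fun s hs hK => (h2 s (by simpa using hs) hK).symm)
  rw [abs_sub_refl_reverse] at this
  rw [refl_const_sub]
  have e : sdist A (fun n => - B n) x y = sdist A B y x := by
    unfold sdist
    rw [abs_sub_comm (A x)]
    congr 2; ring
  rw [e]
  refine le_trans (le_of_eq ?_) this
  rw [← abs_neg]; congr 1; ring

theorem exists_last {p : ℕ → Prop} (S : List ℕ) (h : ∃ s ∈ S, p s) :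
    ∃ S1 s S2, S = S1 ++ s :: S2 ∧ p s ∧ ∀ t ∈ S2, ¬ p t := by
  induction S with
  | nil => simp at h
  | cons a S ih =>
    by_cases h' : ∃ s ∈ S, p s
    · obtain ⟨S1, s, S2, e, h1, h2⟩ := ih h'
      exact ⟨a :: S1, s, S2, by simp [e], h1, h2⟩
    · obtain ⟨s, hs, hp⟩ := h
      rcases List.mem_cons.1 hs with rfl | hs
      · exact ⟨[], s, S, rfl, hp, fun t ht hpt => h' ⟨t, ht, hpt⟩⟩
      · exact absurd ⟨s, hs, hp⟩ h'

theorem exists_first {p : ℕ → Prop} (S : List ℕ) (h : ∃ s ∈ S, p s) :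
    ∃ S1 s S2, S = S1 ++ s :: S2 ∧ p s ∧ ∀ t ∈ S1, ¬ p t := by
  obtain ⟨S1, s, S2, e, h1, h2⟩ := exists_last (p := p) S.reverse (by simpa using h)
  refine ⟨S2.reverse, s, S1.reverse, ?_, h1, by simpa using h2⟩
  rw [← List.reverse_reverse S, e]; simp

theorem WeakLip.genLip {u : ℕ → ℚ} {O : List ℕ} (h : WeakLip A B u O)
    (hO : O.Pairwise fun m n => B m ≤ B n) : GenLip A B u O := by
  intro K P x S
  induction hn : S.length using Nat.strong_induction_on generalizing P x S with
  | _ N ih =>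
  intro y Q e h1 h2 h3
  have hO' := hO
  rw [e] at hO'
  simp only [List.pairwise_append, List.pairwise_cons, List.mem_cons, List.mem_append] at hO'
  obtain ⟨_, ⟨hx, _, _, hSy⟩, _⟩ := hO'
  have hxy := hx y (.inr (.inl rfl))
  by_cases hA : A x ≤ A y
  · exact h K P x S y Q e (fun s hs hK => ⟨h1 s hs hK, (h1 s hs hK).trans hA⟩)
      (fun s hs hK => ⟨hA.trans (h2 s hs hK), h2 s hs hK⟩)
  push Not at hA
  by_cases hl : ∃ s ∈ S, K s ∧ A y < A s
  · obtain ⟨S1, s, S2, rfl, ⟨hK, hs⟩, h4⟩ := exists_last (p := fun s => K s ∧ A y < A s) S hl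
    simp only [List.pairwise_append, List.pairwise_cons, List.mem_cons] at h3
    have g1 := ih S1.length (by simp at hn; omega) P x S1 rfl s (S2 ++ y :: Q) (by simp [e])
      (fun t ht => h1 t (by simp [ht])) (fun t ht hKt => h3.2.2 t ht s (.inl rfl) hKt hK) h3.1
    have g2 := ih S2.length (by simp at hn; omega) (P ++ x :: S1) s S2 rfl y Q (by simp [e])
      (fun t ht hKt => (not_lt.1 fun h5 => h4 t ht ⟨hKt, h5⟩).trans hs.le)
      (fun t ht => h2 t (by simp [ht])) h3.2.1.2
    have hsx := h1 s (by simp) hK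
    have hxs := hx s (by simp)
    have hsy := hSy s (by simp) y (.inl rfl)
    rw [sdist_of_ge hxs (by linarith)] at g1
    rw [sdist_of_ge hsy (by linarith)] at g2
    rw [sdist_of_ge hxy (by linarith), refl_append]
    simp only [refl, if_pos hK]
    calc |u x - refl K u S1 (2 * u s - refl K u S2 (u y))|
        = |(u x - refl K u S1 (u s)) +
            (refl K u S1 (u s) - refl K u S1 (2 * u s - refl K u S2 (u y)))| := by congr 1; ring
      _ ≤ |u x - refl K u S1 (u s)| + |u s - (2 * u s - refl K u S2 (u y))| := by
          rw [← abs_refl_sub K u S1 (u s)]; exact abs_add_le _ _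
      _ = |u x - refl K u S1 (u s)| + |u s - refl K u S2 (u y)| := by
          congr 1; rw [← abs_neg]; congr 1; ring
      _ ≤ _ := by linarith
  by_cases hh : ∃ s ∈ S, ¬ K s ∧ A s < A x
  · obtain ⟨S1, s, S2, rfl, ⟨hK, hs⟩, h4⟩ := exists_first (p := fun s => ¬ K s ∧ A s < A x) S hh
    simp only [List.pairwise_append, List.pairwise_cons, List.mem_cons] at h3
    have hsA := h2 s (by simp) hK
    have g1 := ih S1.length (by simp at hn; omega) P x S1 rfl s (S2 ++ y :: Q) (by simp [e])
      (fun t ht => h1 t (by simp [ht]))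
      (fun t ht hKt => hs.le.trans (not_lt.1 fun h5 => h4 t ht ⟨hKt, h5⟩)) h3.1
    have g2 := ih S2.length (by simp at hn; omega) (P ++ x :: S1) s S2 rfl y Q (by simp [e])
      (fun t ht hKt => h3.2.1.1 t ht hK hKt)
      (fun t ht => h2 t (by simp [ht])) h3.2.1.2
    have hxs := hx s (by simp)
    have hsy := hSy s (by simp) y (.inl rfl)
    rw [sdist_of_ge hxs (by linarith)] at g1
    rw [sdist_of_ge hsy (by linarith)] at g2
    rw [sdist_of_ge hxy (by linarith), refl_append]
    simp only [refl, if_neg hK]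
    calc |u x - refl K u S1 (refl K u S2 (u y))|
        = |(u x - refl K u S1 (u s)) +
            (refl K u S1 (u s) - refl K u S1 (refl K u S2 (u y)))| := by congr 1; ring
      _ ≤ |u x - refl K u S1 (u s)| + |u s - refl K u S2 (u y)| := by
          rw [← abs_refl_sub K u S1 (u s)]; exact abs_add_le _ _
      _ ≤ _ := by linarith
  · push Not at hl hh
    exact h K P x S y Q e (fun s hs hK => ⟨h1 s hs hK, hl s hs hK⟩)
      (fun s hs hK => ⟨hh s hs hK, h2 s hs hK⟩)

theorem exists_split_of_mem {O : List ℕ} {m n : ℕ} (hm : m ∈ O)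
    (hn : n ∈ O) (hmn : m ≠ n) :
    (∃ P S Q, O = P ++ m :: (S ++ n :: Q)) ∨ ∃ P S Q, O = P ++ n :: (S ++ m :: Q) := by
  obtain ⟨P, Q, rfl⟩ := List.append_of_mem hm
  rcases List.mem_append.1 hn with h | h
  · obtain ⟨P1, P2, rfl⟩ := List.append_of_mem h
    exact .inr ⟨P1, P2, Q, by simp⟩
  · rcases List.mem_cons.1 h with h | h
    · exact absurd h.symm hmn
    · obtain ⟨Q1, Q2, rfl⟩ := List.append_of_mem h
      exact .inl ⟨P, Q1, Q2, rfl⟩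

end Reflections

/-! ### Union-intersection on sorted orders -/

section Sorted

open scoped Classical

variable {A B : ℕ → ℚ}

theorem GenLip.tie {u : ℕ → ℚ} {O : List ℕ} (h : GenLip A B u O) (hO : O.Pairwise (Rk A B))
    {m n : ℕ} (hm : m ∈ O) (hn : n ∈ O) (hB : B m = B n) : |u m - u n| ≤ |A m - A n| := by
  by_cases hmn : m = n
  · simp [hmn]
  wlog hs : ∃ P S Q, O = P ++ m :: (S ++ n :: Q) generalizing m n
  · have := this hn hm hB.symm (Ne.symm hmn)
      ((exists_split_of_mem hm hn hmn).resolve_left hs)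
    rwa [abs_sub_comm, abs_sub_comm (A m)]
  obtain ⟨P, S, Q, e⟩ := hs
  have hO' := hO
  rw [e] at hO'
  simp only [List.pairwise_append, List.pairwise_cons, List.mem_cons, List.mem_append] at hO'
  obtain ⟨_, ⟨hx, _, _, hSy⟩, _⟩ := hO'
  have := h (fun _ => False) P m S n Q e (by simp) (fun s hs _ => by
      have h1 := (hx s (.inl hs)).le
      rcases hSy s hs n (.inl rfl) with h2 | ⟨_, h2 | ⟨h2, _⟩⟩
      · linarith
      · exact h2.le
      · exact h2.ge) (by simp [List.pairwise_iff_forall_sublist])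
  rw [refl_of_not u (by simp)] at this
  unfold sdist at this
  simpa [hB] using this

/-- The rows of large index whose segment starts at a given place and ends before `A i`. -/
def Low (A B : ℕ → ℚ) (i : ℕ) (β : ℚ) (n : ℕ) : Prop := A n ≤ A i ∧ B n < β

/-- A sorted order with a pair `i, j` to which a union-intersection applies. -/
structure UIConf (A B u : ℕ → ℚ) (P : List ℕ) (i : ℕ) (S : List ℕ) (j : ℕ) (Q : List ℕ)
    (σ : ℚ) : Prop where
  sorted : (P ++ i :: (S ++ j :: Q)).Pairwise (Rk A B)
  gen : GenLip A B u (P ++ i :: (S ++ j :: Q))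
  hA : A i < A j
  hB : B i < B j
  hS : ∀ t ∈ S, A t ≤ A i ∨ A j ≤ A t
  hσ : σ = 1 ∨ σ = -1
  hu : u i - refl (Low A B i (B j)) u S (u j) = σ * (A j - A i + (B j - B i))

/-- The values after the union-intersection. -/
noncomputable def uiVal (A B u : ℕ → ℚ) (P : List ℕ) (i : ℕ) (S : List ℕ) (j : ℕ)
    (σ : ℚ) (n : ℕ) : ℚ :=
  if n = i then refl (fun m => B m = B i ∧ A m < A j) u P (u i + σ * (A j - A i))
  else if n = j then u j + rsg (Low A B i (B j)) S * σ * (A j - A i)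
  else if B i < B n ∧ B n ≤ B j ∧ A j ≤ A n then
    u n + 2 * (rsg (Low A B i (B n)) S * σ * (A j - A i))
  else if B n = B j ∧ A i < A n ∧ A n < A j then
    2 * (u j + rsg (Low A B i (B j)) S * σ * (A j - A i)) - u n
  else u n

/-- The upper ends after the union-intersection. -/
def uiA (A : ℕ → ℚ) (i j n : ℕ) : ℚ := if n = i then A j else if n = j then A i else A n

/-- A bound on the values. -/
def Bdd (A B u : ℕ → ℚ) (κ τ : ℚ) (O : List ℕ) : Prop :=
  ∀ n ∈ O, |u n - κ| ≤ A n + 1 + τ * B n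

theorem refl_eq_affine (K : ℕ → Prop) (u : ℕ → ℚ) (O : List ℕ) (v : ℚ) :
    refl K u O v = refl K u O 0 + rsg K O * v := by
  have := refl_eq_add K u O 0 v
  simpa using this

namespace UIConf

variable {u : ℕ → ℚ} {P : List ℕ} {i : ℕ} {S : List ℕ} {j : ℕ} {Q : List ℕ} {σ : ℚ}

theorem rk_i_S (h : UIConf A B u P i S j Q σ) {t : ℕ} (ht : t ∈ S) : Rk A B i t := by
  have := h.sorted
  simp only [List.pairwise_append, List.pairwise_cons, List.mem_append] at this
  exact this.2.1.1 t (.inl ht)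

theorem rk_S_j (h : UIConf A B u P i S j Q σ) {t : ℕ} (ht : t ∈ S) : Rk A B t j := by
  have := h.sorted
  simp only [List.pairwise_append, List.pairwise_cons, List.mem_append, List.mem_cons] at this
  exact this.2.1.2.2.2 t ht j (.inl rfl)

theorem rk_j_Q (h : UIConf A B u P i S j Q σ) {t : ℕ} (ht : t ∈ Q) : Rk A B j t := by
  have := h.sorted
  simp only [List.pairwise_append, List.pairwise_cons, List.mem_append, List.mem_cons] at this
  exact this.2.1.2.2.1.1 t ht

theorem rk_P_i (h : UIConf A B u P i S j Q σ) {t : ℕ} (ht : t ∈ P) : Rk A B t i := by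
  have := h.sorted
  simp only [List.pairwise_append, List.pairwise_cons, List.mem_append, List.mem_cons] at this
  exact this.2.2 t ht i (.inl rfl)

theorem tie (h : UIConf A B u P i S j Q σ) {m n : ℕ} (hm : m ∈ P ++ i :: (S ++ j :: Q))
    (hn : n ∈ P ++ i :: (S ++ j :: Q)) (hB : B m = B n) : |u m - u n| ≤ |A m - A n| :=
  h.gen.tie h.sorted hm hn hB

theorem bound_i (h : UIConf A B u P i S j Q σ) {κ τ β : ℚ} (hτ : -1 ≤ τ) (hβ : B i < β)
    (hb : Bdd A B u κ τ (P ++ i :: (S ++ j :: Q))) :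
    |u i - refl (Low A B i β) u S κ| ≤ A i - B i + 1 + (1 + τ) * β := by
  by_cases hl : ∃ s ∈ S, Low A B i β s
  · obtain ⟨S1, s, S2, rfl, hK, h4⟩ := exists_last (p := Low A B i β) S hl
    have hs := hb s (by simp)
    have hsort := h.sorted
    simp only [List.pairwise_append, List.pairwise_cons, List.mem_append, List.mem_cons] at hsort
    have hS1 : ∀ t ∈ S1, B t ≤ B s := fun t ht => (hsort.2.1.2.1.2.2 t ht s (.inl rfl)).le
    have g := h.gen (Low A B i β) P i S1 s (S2 ++ j :: Q) (by simp) (fun t _ hK => hK.1)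
      (fun t ht hKt => by
        rcases h.hS t (by simp [ht]) with h1 | h1
        · exact absurd ⟨h1, (hS1 t ht).trans_lt hK.2⟩ hKt
        · have := hK.1; have := h.hA; linarith) (by
        rw [List.pairwise_iff_forall_sublist]
        intro a b hab ha hb
        have ha' := hab.subset (List.mem_cons_self (a := a) (l := [b]))
        by_contra hc
        exact ha ⟨(not_le.1 hc).le.trans hb.1, (hS1 a ha').trans_lt hK.2⟩)
    rw [sdist_of_ge (h.rk_i_S (t := s) (by simp)).le hK.1] at g
    rw [refl_append]
    simp only [refl, if_pos hK]
    rw [refl_of_not u h4]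
    have h5 := abs_refl_sub (Low A B i β) u S1 (u s) (2 * u s - κ)
    have h6 : |u s - (2 * u s - κ)| = |u s - κ| := by rw [← abs_neg]; congr 1; ring
    have h7 := abs_add_le (u i - refl (Low A B i β) u S1 (u s))
      (refl (Low A B i β) u S1 (u s) - refl (Low A B i β) u S1 (2 * u s - κ))
    rw [h5, h6, sub_add_sub_cancel] at h7
    have h8 : (1 + τ) * B s ≤ (1 + τ) * β := mul_le_mul_of_nonneg_left hK.2.le (by linarith)
    linarith
  · push Not at hl
    rw [refl_of_not u hl]
    have := hb i (by simp)
    have h8 : (1 + τ) * B i ≤ (1 + τ) * β := mul_le_mul_of_nonneg_left hβ.le (by linarith)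
    linarith

theorem dist_j (h : UIConf A B u P i S j Q σ) {t : ℕ} (ht : t ∈ P ++ i :: (S ++ j :: Q))
    (h1 : B i < B t) (h2 : B t ≤ B j) (h3 : A j ≤ A t) :
    |refl (Low A B i (B t)) u S (u t) - refl (Low A B i (B j)) u S (u j)| ≤
      A t - A j + (B j - B t) := by
  have key : t ∈ S ∨ (A t = A j ∧ B t = B j) := by
    simp only [List.mem_append, List.mem_cons] at ht
    rcases ht with ht | rfl | ht | rfl | ht
    · have := (h.rk_P_i ht).le; linarith
    · linarith
    · exact .inl ht
    · exact .inr ⟨rfl, rfl⟩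
    · right
      rcases h.rk_j_Q ht with h4 | ⟨h4, h5 | ⟨h5, _⟩⟩
      · linarith
      · linarith
      · exact ⟨h5.symm, h4.symm⟩
  rcases key with hS | ⟨hA, hB⟩
  · obtain ⟨S1, S2, rfl⟩ := List.append_of_mem hS
    have hsort := h.sorted
    simp only [List.pairwise_append, List.pairwise_cons, List.mem_append, List.mem_cons] at hsort
    have hS1 : ∀ s ∈ S1, Rk A B s t := fun s hs => hsort.2.1.2.1.2.2 s hs t (.inl rfl)
    have hS2 : ∀ s ∈ S2, Rk A B t s := fun s hs => hsort.2.1.2.1.2.1.1 s hs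
    have hA := h.hA
    have hnt : ¬ Low A B i (B j) t := fun hK => by have := hK.1; linarith
    have hnt' : ¬ Low A B i (B t) t := fun hK => by have := hK.1; linarith
    have hS2j : ∀ s ∈ S2, Rk A B s j := fun s hs => h.rk_S_j (by simp [hs])
    rw [refl_append, refl_append]
    simp only [refl, if_neg hnt, if_neg hnt']
    rw [refl_of_not (K := Low A B i (B t)) (O := S2) u
      (fun s hs hK => by have := (hS2 s hs).le; have := hK.2; linarith)]
    rw [refl_congr_left (K := Low A B i (B t)) (K' := Low A B i (B j)) (O := S1)
      (fun s hs => ⟨fun hK => ⟨hK.1, hK.2.trans_le h2⟩, fun hK => ⟨hK.1, by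
        rcases hS1 s hs with h4 | ⟨_, h5 | ⟨h5, _⟩⟩
        · exact h4
        · have := hK.1; linarith
        · have := hK.1; linarith⟩⟩)]
    rw [abs_refl_sub]
    have hlow : ∀ s ∈ S2, ¬ Low A B i (B j) s → A j ≤ A s := fun s hs hK => by
      rcases h.hS s (by simp [hs]) with h4 | h4
      · rcases hS2j s hs with h5 | ⟨_, h5 | ⟨h5, _⟩⟩
        · exact absurd ⟨h4, h5⟩ hK
        · exact h5.le
        · exact h5.ge
      · exact h4
    have g := h.gen (Low A B i (B j)) (P ++ i :: S1) t S2 j Q (by simp)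
      (fun s _ hK => by have := hK.1; linarith) hlow (by
        rw [List.pairwise_iff_forall_sublist]
        intro a b hab ha hb
        have ha' := hab.subset (List.mem_cons_self (a := a) (l := [b]))
        have := hlow a ha' ha
        have := hb.1
        linarith)
    rwa [sdist_of_ge h2 h3] at g
  · have h4 := h.tie ht (n := j) (by simp) hB
    rw [hB, abs_refl_sub]
    rw [hA, sub_self, abs_zero] at h4
    rw [hA]; linarith

theorem dist_i (h : UIConf A B u P i S j Q σ) {w : ℕ} (hw : w ∈ S ++ j :: Q)
    (h2 : B w ≤ B j) (h3 : A w ≤ A j) :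
    |u i - refl (Low A B i (B w)) u S (u w)| ≤ |A i - A w| + (B w - B i) := by
  obtain ⟨S', Q', e⟩ := List.append_of_mem hw
  have hsort := h.sorted
  rw [e] at hsort
  simp only [List.pairwise_append, List.pairwise_cons, List.mem_append, List.mem_cons] at hsort
  have hS' : ∀ s ∈ S', Rk A B s w := fun s hs => hsort.2.1.2.2.2 s hs w (.inl rfl)
  have hiw : B i ≤ B w := (hsort.2.1.1 w (.inr (.inl rfl))).le
  have hA := h.hA
  have hmem : ∀ s ∈ S', s ∈ S ∨ A j ≤ A s ∨ (B s = B w ∧ A w ≤ A s) := fun s hs => by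
    have : s ∈ S ++ j :: Q := by rw [e]; simp [hs]
    simp only [List.mem_append, List.mem_cons] at this
    rcases this with h4 | rfl | h4
    · exact .inl h4
    · exact .inr (.inl le_rfl)
    · right; right
      have h5 := (h.rk_j_Q h4).le
      rcases hS' s hs with h6 | ⟨h6, h7 | ⟨h7, _⟩⟩
      · linarith
      · exact ⟨h6, h7.le⟩
      · exact ⟨h6, h7.ge⟩
  have hhigh : ∀ s ∈ S', ¬ Low A B i (B w) s → A w ≤ A s := fun s hs hK => by
    rcases hS' s hs with h6 | ⟨h6, h7 | ⟨h7, _⟩⟩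
    · have h8 : A i < A s := by
        by_contra hc
        exact hK ⟨not_lt.1 hc, h6⟩
      rcases hmem s hs with h9 | h9 | h9
      · rcases h.hS s h9 with h10 | h10 <;> linarith
      · linarith
      · exact h9.2
    · exact h7.le
    · exact h7.ge
  have g := h.gen (Low A B i (B w)) P i S' w Q' (by rw [e])
    (fun s _ hK => hK.1) hhigh (by
      have hp := hsort.2.1.2.1
      refine hp.imp ?_
      intro a b hab ha hb
      by_contra hc
      exact ha ⟨(not_le.1 hc).le.trans hb.1, hab.le.trans_lt hb.2⟩)
  rw [sdist_of_le hiw] at g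
  have hQ' : ∀ s ∈ Q', B w ≤ B s := fun s hs => (hsort.2.1.2.2.1.1 s hs).le
  have e2 : refl (Low A B i (B w)) u (S ++ j :: Q) (u w) =
      refl (Low A B i (B w)) u (S' ++ w :: Q') (u w) := by rw [e]
  rw [refl_append, refl_append, refl_of_not (O := j :: Q) u, refl_of_not (O := w :: Q') u] at e2
  · rwa [e2]
  · intro t ht hK
    rcases List.mem_cons.1 ht with rfl | ht
    · exact absurd hK.2 (lt_irrefl _)
    · have := hQ' t ht; have := hK.2; linarith
  · intro t ht hK
    rcases List.mem_cons.1 ht with rfl | ht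
    · have := hK.1; linarith
    · have := (h.rk_j_Q ht).le; have := hK.2; linarith

theorem dist_tie (h : UIConf A B u P i S j Q σ) {P1 P2 : List ℕ} {x : ℕ}
    (hP : P = P1 ++ x :: P2) (hx : B x = B i) :
    |u x - refl (fun m => B m = B i ∧ A m < A j) u P2 (u i + σ * (A j - A i))| ≤
      |A x - A j| := by
  subst hP
  have hsort := h.sorted
  simp only [List.pairwise_append, List.pairwise_cons, List.mem_append, List.mem_cons] at hsort
  have hA := h.hA
  have hB := h.hB
  have hxP : ∀ s ∈ P2, B s = B i ∧ A s ≤ A x ∧ A i ≤ A s := fun s hs => by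
    have h1 := hsort.1.2.1.1 s hs
    have h2 := hsort.2.2 s (by simp [hs]) i (.inl rfl)
    have h3 := h1.le
    have h4 := h2.le
    have h5 : B s = B i := le_antisymm h4 (hx ▸ h3)
    refine ⟨h5, ?_, ?_⟩
    · rcases h1 with h6 | ⟨_, h7 | ⟨h7, _⟩⟩ <;> linarith
    · rcases h2 with h6 | ⟨_, h7 | ⟨h7, _⟩⟩ <;> linarith
  have hix : A i ≤ A x := by
    rcases hsort.2.2 x (by simp) i (.inl rfl) with h6 | ⟨_, h7 | ⟨h7, _⟩⟩ <;> linarith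
  have hK : ∀ s ∈ P2, (B s = B i ∧ A s < A j ↔ A s < A j) := fun s hs =>
    ⟨fun h => h.2, fun h => ⟨(hxP s hs).1, h⟩⟩
  rw [refl_congr_left hK]
  have hSK : ∀ s ∈ S, (Low A B i (B j) s ↔ A s < A j) := fun s hs => by
    constructor
    · exact fun h => h.1.trans_lt hA
    · intro h1
      refine ⟨(h.hS s hs).resolve_right (not_le.2 h1), ?_⟩
      rcases h.rk_S_j hs with h2 | ⟨_, h3 | ⟨h3, _⟩⟩
      · exact h2
      · linarith
      · linarith
  have hsmall : ∀ s ∈ P2 ++ i :: S, A s < A j → A s ≤ A x := fun s hs h1 => by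
    simp only [List.mem_append, List.mem_cons] at hs
    rcases hs with hs | rfl | hs
    · exact (hxP s hs).2.1
    · exact hix
    · have := (h.hS s hs).resolve_right (not_le.2 h1)
      linarith
  have g1 := h.gen (fun s => A s < A j) P1 x (P2 ++ i :: S) j Q (by simp) hsmall
    (fun s _ h1 => not_lt.1 h1) (by
      rw [List.pairwise_iff_forall_sublist]
      intro a b hab ha hb
      exact hb.le.trans (not_lt.1 ha))
  have g2 := h.gen (fun s => A s < A j) P1 x P2 i (S ++ j :: Q) (by simp)
    (fun s hs => hsmall s (by simp [hs])) (fun s hs _ => (hxP s hs).2.2) (by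
      rw [List.pairwise_iff_forall_sublist]
      intro a b hab ha hb
      exact hb.le.trans (not_lt.1 ha))
  rw [refl_append] at g1
  simp only [refl, if_pos hA] at g1
  rw [← refl_congr_left hSK] at g1
  have hu := h.hu
  have e1 : 2 * u i - refl (Low A B i (B j)) u S (u j) =
      u i + σ * (A j - A i + (B j - B i)) := by linarith
  rw [e1, refl_eq_affine, sdist_of_le (by linarith)] at g1
  rw [refl_eq_affine, sdist_of_ge (by linarith) hix] at g2
  rw [refl_eq_affine]
  rw [hx] at g1 g2
  rcases rsg_eq (fun s => A s < A j) P2 with e | e <;> rcases h.hσ with e' | e' <;>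
    rw [e] at g1 g2 ⊢ <;> rw [e'] at g1 ⊢ <;> rcases le_total (A x) (A j) with h1 | h1
  all_goals
    first
    | rw [abs_of_nonneg (sub_nonneg.2 h1)] at g1 ⊢
    | rw [abs_of_nonpos (sub_nonpos.2 h1)] at g1 ⊢
    rw [abs_le] at g1 g2 ⊢
    constructor <;> linarith

theorem exists_hub (h : UIConf A B u P i S j Q σ) :
    ∃ k ∈ P ++ i :: (S ++ j :: Q), B k = B i ∧ A i ≤ A k ∧ A k < A j ∧
      |uiVal A B u P i S j σ i - u k| ≤ A j - A k ∧
      ∀ x ∈ P ++ i :: (S ++ j :: Q), B x = B i → A x < A j → A x ≤ A k := by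
  have hA := h.hA
  have hB := h.hB
  have hend : ∀ x ∈ i :: (S ++ j :: Q), B x = B i → A x ≤ A i := fun x hx hxi => by
    have hsort := h.sorted
    simp only [List.pairwise_append, List.pairwise_cons, List.mem_append, List.mem_cons] at hsort
    simp only [List.mem_append, List.mem_cons] at hx
    rcases hx with rfl | hx
    · exact le_rfl
    · rcases hsort.2.1.1 x hx with h6 | ⟨_, h7 | ⟨h7, _⟩⟩ <;> linarith
  by_cases hl : ∃ s ∈ P, B s = B i ∧ A s < A j
  · obtain ⟨P1, k, P2, e, hk, h4⟩ := exists_first (p := fun s => B s = B i ∧ A s < A j) P hl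
    have hik : A i ≤ A k := by
      rcases h.rk_P_i (t := k) (by simp [e]) with h6 | ⟨_, h7 | ⟨h7, _⟩⟩ <;> linarith
    refine ⟨k, by simp [e], hk.1, hik, hk.2, ?_, ?_⟩
    · have := h.dist_tie e hk.1
      rw [abs_of_nonpos (sub_nonpos.2 hk.2.le)] at this
      simp only [uiVal, if_true]
      rw [e, refl_append, refl_of_not (O := P1) u h4]
      simp only [refl, if_pos hk]
      rw [abs_le] at this ⊢
      constructor <;> linarith
    · intro x hx hxi hxj
      rcases List.mem_append.1 hx with hx | hx
      · rw [e] at hx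
        rcases List.mem_append.1 hx with hx | hx
        · exact absurd ⟨hxi, hxj⟩ (h4 x hx)
        · rcases List.mem_cons.1 hx with rfl | hx
          · exact le_rfl
          · have hsort := h.sorted
            rw [e] at hsort
            simp only [List.pairwise_append, List.pairwise_cons] at hsort
            rcases hsort.1.2.1.1 x hx with h6 | ⟨_, h7 | ⟨h7, _⟩⟩ <;> linarith
      · exact (hend x hx hxi).trans hik
  · push Not at hl
    refine ⟨i, by simp, rfl, le_rfl, hA, ?_, ?_⟩
    · simp only [uiVal, if_true]
      rw [refl_of_not u (fun s hs hK => absurd hK.2 (not_lt.2 (hl s hs hK.1)))]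
      rcases h.hσ with e | e <;> rw [e, abs_le] <;> constructor <;> linarith
    · intro x hx hxi hxj
      rcases List.mem_append.1 hx with hx | hx
      · exact absurd hxj (not_lt.2 (hl x hx hxi))
      · exact hend x hx hxi

/-- The value at rows with the same start as `j` lying strictly between `i` and `j`. -/
theorem val_between (h : UIConf A B u P i S j Q σ) {n : ℕ}
    (hn : n ∈ P ++ i :: (S ++ j :: Q)) (h1 : B n = B j) (h2 : A i < A n) (h3 : A n < A j) :
    u n = u j + rsg (Low A B i (B j)) S * σ * (A j - A n) := by
  have hB := h.hB
  have hw : n ∈ S ++ j :: Q := by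
    simp only [List.mem_append, List.mem_cons] at hn ⊢
    rcases hn with hn | rfl | hn
    · have := (h.rk_P_i hn).le; linarith
    · linarith
    · exact hn
  have g1 := h.dist_i hw h1.le h3.le
  have g2 := h.tie hn (n := j) (by simp) h1
  have hu := h.hu
  rw [abs_of_nonpos (a := A i - A n) (by linarith)] at g1
  rw [abs_of_nonpos (a := A n - A j) (by linarith)] at g2
  rw [h1] at g1
  rw [refl_eq_affine] at g1 hu
  rcases rsg_eq (Low A B i (B j)) S with e | e <;> rcases h.hσ with e' | e' <;>
    rw [e] at g1 hu ⊢ <;> rw [e'] at hu ⊢ <;> rw [abs_le] at g1 g2 <;> linarith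

theorem bdd_j (h : UIConf A B u P i S j Q σ) {κ τ : ℚ} (hτ : -1 ≤ τ)
    (hb : Bdd A B u κ τ (P ++ i :: (S ++ j :: Q))) :
    |u j + rsg (Low A B i (B j)) S * σ * (A j - A i) - κ| ≤ A i + 1 + τ * B j := by
  have g1 := h.bound_i hτ h.hB hb
  have g2 := hb j (by simp)
  have hu := h.hu
  rw [refl_eq_affine] at g1 hu
  rcases rsg_eq (Low A B i (B j)) S with e | e <;> rcases h.hσ with e' | e' <;>
    rw [e] at g1 hu ⊢ <;> rw [e'] at hu ⊢ <;> rw [abs_le] at g1 g2 ⊢ <;>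
    constructor <;> linarith

theorem bdd (h : UIConf A B u P i S j Q σ) {κ τ : ℚ} (hτ : -1 ≤ τ)
    (hb : Bdd A B u κ τ (P ++ i :: (S ++ j :: Q))) :
    Bdd (uiA A i j) B (uiVal A B u P i S j σ) κ τ (P ++ i :: (S ++ j :: Q)) := by
  intro n hn
  have hA := h.hA
  have hB := h.hB
  by_cases hi : n = i
  · subst hi
    obtain ⟨k, hk, h1, h2, h3, h4, -⟩ := h.exists_hub
    have h5 := hb k hk
    rw [h1] at h5
    simp only [uiA, if_true]
    rw [abs_le] at *
    constructor <;> linarith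
  by_cases hj : n = j
  · subst hj
    simp only [uiA, uiVal, if_true, if_neg hi]
    exact h.bdd_j hτ hb
  simp only [uiA, uiVal, if_neg hi, if_neg hj]
  split_ifs with h1 h2
  · have g1 := h.bound_i hτ h1.1 hb
    have g2 := h.dist_j hn h1.1 h1.2.1 h1.2.2
    have g3 := hb n hn
    have hu := h.hu
    rw [refl_eq_affine] at g1
    rw [refl_eq_affine (Low A B i (B n))] at g2
    rcases rsg_eq (Low A B i (B n)) S with e | e <;> rcases h.hσ with e' | e' <;>
      rw [e] at g1 g2 ⊢ <;> rw [e'] at hu ⊢ <;> rw [abs_le] at g1 g2 g3 ⊢ <;>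
      constructor <;> linarith
  · have g := h.val_between hn h2.1 h2.2.1 h2.2.2
    have g2 := h.bdd_j hτ hb
    rw [g, h2.1]
    rcases rsg_eq (Low A B i (B j)) S with e | e <;> rcases h.hσ with e' | e' <;>
      rw [e, e'] at g2 ⊢ <;> rw [abs_le] at g2 ⊢ <;> constructor <;> linarith
  · exact hb n hn

/-- Comparison of the new value of `j` with the others having the same start. -/
theorem tie_j (h : UIConf A B u P i S j Q σ) {n : ℕ} (hn : n ∈ P ++ i :: (S ++ j :: Q))
    (hBn : B n = B j) (hj : n ≠ j) :
    |uiVal A B u P i S j σ n - uiVal A B u P i S j σ j| ≤ |A n - A i| := by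
  have hA := h.hA
  have hB := h.hB
  have hi : n ≠ i := by rintro rfl; linarith
  have hij : j ≠ i := by rintro rfl; linarith
  have hw : n ∈ S ++ j :: Q := by
    simp only [List.mem_append, List.mem_cons] at hn ⊢
    rcases hn with hn | rfl | hn
    · have := (h.rk_P_i hn).le; linarith
    · linarith
    · exact hn
  have hu := h.hu
  simp only [uiVal, if_neg hi, if_neg hj, if_neg hij, if_true]
  split_ifs with h1 h2
  · have g2 := h.dist_j hn h1.1 h1.2.1 h1.2.2
    rw [hBn, abs_refl_sub] at g2
    rw [hBn, abs_of_nonneg (a := A n - A i) (by linarith)]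
    rcases rsg_eq (Low A B i (B j)) S with e | e <;> rcases h.hσ with e' | e' <;>
      rw [e, e'] <;> rw [abs_le] at g2 ⊢ <;> constructor <;> linarith
  · have g := h.val_between hn h2.1 h2.2.1 h2.2.2
    rw [g, abs_of_nonneg (a := A n - A i) (by linarith)]
    rcases rsg_eq (Low A B i (B j)) S with e | e <;> rcases h.hσ with e' | e' <;>
      rw [e, e'] <;> rw [abs_le] <;> constructor <;> linarith
  · have h3 : A n < A j := by
      by_contra hc
      exact h1 ⟨by linarith, hBn.le, not_lt.1 hc⟩
    have h4 : A n ≤ A i := by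
      by_contra hc
      exact h2 ⟨hBn, not_le.1 hc, h3⟩
    have g1 := h.dist_i hw hBn.le h3.le
    have g2 := h.tie hn (n := j) (by simp) hBn
    rw [abs_of_nonpos (a := A n - A j) (by linarith)] at g2
    rw [abs_of_nonneg (a := A i - A n) (by linarith), hBn] at g1
    rw [abs_of_nonpos (a := A n - A i) (by linarith)]
    rw [refl_eq_affine] at g1 hu
    rcases rsg_eq (Low A B i (B j)) S with e | e <;> rcases h.hσ with e' | e' <;>
      rw [e] at g1 hu ⊢ <;> rw [e'] at hu ⊢ <;> rw [abs_le] at g1 g2 ⊢ <;>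
      constructor <;> linarith

theorem tie_ui_of_le (h : UIConf A B u P i S j Q σ) {m n : ℕ}
    (hm : m ∈ P ++ i :: (S ++ j :: Q)) (hn : n ∈ P ++ i :: (S ++ j :: Q)) (hmn : B m = B n)
    (hi : n ≠ i) (hj : n ≠ j) (hle : m = i ∨ m = j ∨ A m ≤ A n) :
    |uiVal A B u P i S j σ m - uiVal A B u P i S j σ n| ≤ |uiA A i j m - uiA A i j n| := by
  have hA := h.hA
  have hB := h.hB
  have hij : j ≠ i := by rintro rfl; linarith
  by_cases hmi : m = i
  · subst hmi
    have hn1 : ¬ (B m < B n ∧ B n ≤ B j ∧ A j ≤ A n) := fun h1 => by linarith [h1.1]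
    have hn2 : ¬ (B n = B j ∧ A m < A n ∧ A n < A j) := fun h1 => by linarith [h1.1]
    have hval : uiVal A B u P m S j σ n = u n := by
      simp only [uiVal, if_neg hi, if_neg hj, if_neg hn1, if_neg hn2]
    rw [hval]
    simp only [uiA, if_neg hi, if_neg hj, if_true]
    obtain ⟨k, hk, h1, h2, h3, h4, h5⟩ := h.exists_hub
    by_cases hnj : A n < A j
    · have h6 := h5 n hn hmn.symm hnj
      have h7 := h.tie hk hn (h1.trans hmn)
      rw [abs_of_nonneg (a := A k - A n) (by linarith)] at h7
      rw [abs_of_nonneg (a := A j - A n) (by linarith)]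
      rw [abs_le] at h4 h7 ⊢
      constructor <;> linarith
    · have hnP : n ∈ P := by
        rcases List.mem_append.1 hn with h6 | h6
        · exact h6
        · rcases List.mem_cons.1 h6 with h6 | h6
          · exact absurd h6 hi
          · have hsort := h.sorted
            simp only [List.pairwise_append, List.pairwise_cons] at hsort
            rcases hsort.2.1.1 n (by simpa using h6) with h6 | ⟨_, h7 | ⟨h7, _⟩⟩ <;> linarith
      obtain ⟨P1, P2, e⟩ := List.append_of_mem hnP
      have h6 := h.dist_tie e hmn.symm
      have h7 : ∀ s ∈ P1 ++ [n], ¬ (B s = B m ∧ A s < A j) := fun s hs hK => by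
        rcases List.mem_append.1 hs with hs | hs
        · have hsort := h.sorted
          rw [e] at hsort
          simp only [List.pairwise_append, List.pairwise_cons, List.mem_cons] at hsort
          rcases hsort.1.2.2 s hs n (.inl rfl) with h6 | ⟨_, h7 | ⟨h7, _⟩⟩ <;> linarith [hK.1, hK.2]
        · rw [List.mem_singleton.1 hs] at hK
          exact hnj hK.2
      have e' : P = (P1 ++ [n]) ++ P2 := by simp [e]
      simp only [uiVal, if_true]
      rw [e', refl_append, refl_of_not u h7, abs_sub_comm, abs_sub_comm (A j)]
      exact h6
  by_cases hmj : m = j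
  · subst hmj
    have := h.tie_j hn hmn.symm hj
    rw [abs_sub_comm, abs_sub_comm (uiA A i m m)]
    simpa only [uiA, if_neg hi, if_neg hj, if_neg hij, if_true] using this
  have hle : A m ≤ A n := by simpa [hmi, hmj] using hle
  have htie := h.tie hm hn hmn
  rw [abs_of_nonpos (a := A m - A n) (by linarith)] at htie
  have hgoal : |uiA A i j m - uiA A i j n| = A n - A m := by
    simp only [uiA, if_neg hi, if_neg hj, if_neg hmi, if_neg hmj]
    rw [abs_of_nonpos (by linarith)]; ring
  rw [hgoal]
  have hm' := h.tie_j hm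
  have hn' := h.tie_j hn
  by_cases hBj : B n = B j
  · have hm' := h.tie_j hm (hmn.trans hBj) hmj
    have hn' := h.tie_j hn hBj hj
    by_cases h1 : A m ≤ A i
    · by_cases h2 : A i ≤ A n
      · rw [abs_of_nonpos (a := A m - A i) (by linarith)] at hm'
        rw [abs_of_nonneg (a := A n - A i) (by linarith)] at hn'
        rw [abs_le] at hm' hn' ⊢
        constructor <;> linarith
      · have e1 : uiVal A B u P i S j σ m = u m := by
          simp only [uiVal, if_neg hmi, if_neg hmj]
          rw [if_neg (fun h => by linarith [h.2.2]), if_neg (fun h => by linarith [h.2.1])]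
        have e2 : uiVal A B u P i S j σ n = u n := by
          simp only [uiVal, if_neg hi, if_neg hj]
          rw [if_neg (fun h => by linarith [h.2.2]), if_neg (fun h => by linarith [h.2.1])]
        rw [e1, e2]; linarith
    · push Not at h1
      by_cases h2 : A m < A j
      · have e1 : uiVal A B u P i S j σ m =
            2 * (u j + rsg (Low A B i (B j)) S * σ * (A j - A i)) - u m := by
          simp only [uiVal, if_neg hmi, if_neg hmj]
          rw [if_neg (fun h => by linarith [h.2.2]), if_pos ⟨hmn.trans hBj, h1, h2⟩]
        by_cases h3 : A n < A j
        · have e2 : uiVal A B u P i S j σ n =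
            2 * (u j + rsg (Low A B i (B j)) S * σ * (A j - A i)) - u n := by
            simp only [uiVal, if_neg hi, if_neg hj]
            rw [if_neg (fun h => by linarith [h.2.2]), if_pos ⟨hBj, by linarith, h3⟩]
          rw [e1, e2]
          rw [abs_le] at htie ⊢
          constructor <;> linarith
        · have e2 : uiVal A B u P i S j σ n =
            u n + 2 * (rsg (Low A B i (B j)) S * σ * (A j - A i)) := by
            simp only [uiVal, if_neg hi, if_neg hj]
            rw [if_pos ⟨by linarith, hBj.le, not_lt.1 h3⟩, hBj]
          rw [e1, e2]
          have t1 := h.tie hm (n := j) (by simp) (hmn.trans hBj)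
          have t2 := h.tie hn (n := j) (by simp) hBj
          rw [abs_of_nonpos (a := A m - A j) (by linarith)] at t1
          rw [abs_of_nonneg (a := A n - A j) (by linarith)] at t2
          rw [abs_le] at t1 t2 ⊢
          constructor <;> linarith
      · have e1 : uiVal A B u P i S j σ m =
            u m + 2 * (rsg (Low A B i (B j)) S * σ * (A j - A i)) := by
          simp only [uiVal, if_neg hmi, if_neg hmj]
          rw [if_pos ⟨by linarith, (hmn.trans hBj).le, not_lt.1 h2⟩, hmn.trans hBj]
        have e2 : uiVal A B u P i S j σ n =
            u n + 2 * (rsg (Low A B i (B j)) S * σ * (A j - A i)) := by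
          simp only [uiVal, if_neg hi, if_neg hj]
          rw [if_pos ⟨by linarith, hBj.le, by linarith⟩, hBj]
        rw [e1, e2, add_sub_add_right_eq_sub]; linarith
  · have hBm : B m ≠ B j := fun h => hBj (hmn.symm.trans h)
    by_cases h1 : B i < B n ∧ B n ≤ B j ∧ A j ≤ A n
    · have e2 : uiVal A B u P i S j σ n =
            u n + 2 * (rsg (Low A B i (B n)) S * σ * (A j - A i)) := by
        simp only [uiVal, if_neg hi, if_neg hj]
        rw [if_pos h1]
      by_cases h2 : A j ≤ A m
      · have e1 : uiVal A B u P i S j σ m =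
            u m + 2 * (rsg (Low A B i (B n)) S * σ * (A j - A i)) := by
          simp only [uiVal, if_neg hmi, if_neg hmj]
          rw [if_pos ⟨hmn.symm ▸ h1.1, hmn.symm ▸ h1.2.1, h2⟩, hmn]
        rw [e1, e2, add_sub_add_right_eq_sub]; linarith
      · have e1 : uiVal A B u P i S j σ m = u m := by
          simp only [uiVal, if_neg hmi, if_neg hmj]
          rw [if_neg (fun h => h2 h.2.2), if_neg (fun h => hBm h.1)]
        have hw : m ∈ S ++ j :: Q := by
          simp only [List.mem_append, List.mem_cons] at hm ⊢
          rcases hm with hm | hm | hm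
          · have := (h.rk_P_i hm).le; linarith
          · exact absurd hm hmi
          · exact hm
        have hmA : A m ≤ A i := by
          simp only [List.mem_append, List.mem_cons] at hw
          rcases hw with hw | hw | hw
          · exact (h.hS m hw).resolve_right h2
          · exact absurd hw hmj
          · have := (h.rk_j_Q hw).le
            exact absurd (le_antisymm (hmn.le.trans h1.2.1) this) hBm
        have g1 := h.dist_i hw (hmn.le.trans h1.2.1) (by linarith)
        have g2 := h.dist_j hn h1.1 h1.2.1 h1.2.2
        have hu := h.hu
        rw [e1, e2]
        rw [abs_of_nonneg (a := A i - A m) (by linarith), hmn, refl_eq_affine] at g1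
        rw [refl_eq_affine (Low A B i (B n))] at g2
        rcases rsg_eq (Low A B i (B n)) S with e | e <;> rcases h.hσ with e' | e' <;>
          rw [e] at g1 g2 ⊢ <;> rw [e'] at hu ⊢ <;> rw [abs_le] at g1 g2 htie ⊢ <;>
          constructor <;> linarith
    · have e2 : uiVal A B u P i S j σ n = u n := by
        simp only [uiVal, if_neg hi, if_neg hj]
        rw [if_neg h1, if_neg (fun h => hBj h.1)]
      have e1 : uiVal A B u P i S j σ m = u m := by
        simp only [uiVal, if_neg hmi, if_neg hmj]
        rw [if_neg (fun h => h1 ⟨hmn ▸ h.1, hmn ▸ h.2.1, h.2.2.trans hle⟩),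
          if_neg (fun h => hBm h.1)]
      rw [e1, e2]; linarith

theorem tie_ui (h : UIConf A B u P i S j Q σ) {m n : ℕ}
    (hm : m ∈ P ++ i :: (S ++ j :: Q)) (hn : n ∈ P ++ i :: (S ++ j :: Q)) (hmn : B m = B n) :
    |uiVal A B u P i S j σ m - uiVal A B u P i S j σ n| ≤ |uiA A i j m - uiA A i j n| := by
  by_cases e : m = n
  · simp [e]
  have hB := h.hB
  have hswap : ∀ x y : ℚ, ∀ z w : ℚ, |x - y| ≤ |z - w| → |y - x| ≤ |w - z| := by
    intro x y z w h; rwa [abs_sub_comm, abs_sub_comm w]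
  by_cases h1 : m = i ∨ m = j
  · refine h.tie_ui_of_le hm hn hmn ?_ ?_ (by tauto)
    · rintro rfl
      rcases h1 with h1 | rfl
      · exact e h1
      · linarith
    · rintro rfl
      rcases h1 with rfl | h1
      · linarith
      · exact e h1
  by_cases h2 : n = i ∨ n = j
  · exact hswap _ _ _ _ (h.tie_ui_of_le hn hm hmn.symm (by tauto) (by tauto) (by tauto))
  rcases le_total (A m) (A n) with h3 | h3
  · exact h.tie_ui_of_le hm hn hmn (by tauto) (by tauto) (by tauto)
  · exact hswap _ _ _ _ (h.tie_ui_of_le hn hm hmn.symm (by tauto) (by tauto) (by tauto))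

end UIConf

end Sorted

/-! ### The effect of a union-intersection in an arbitrary admissible order -/

section AnyOrder

open scoped Classical

variable {A B : ℕ → ℚ}

theorem labs_append (S T : List (ℕ × ℚ)) : labs (S ++ T) = labs S ++ labs T :=
  List.map_append

theorem unw_withVal (u : ℕ → ℚ) (n : ℕ) (O : List ℕ) (hn : n ∉ O) (T : List (ℕ × ℚ)) :
    unw A B n (withVal u O ++ T) = refl (fun t => Sub A B t n) u O (unw A B n T) := by
  induction O with
  | nil => rfl
  | cons t O ih =>
    simp only [List.mem_cons, not_or] at hn
    have := ih hn.2
    simp only [withVal, List.map_cons, List.cons_append, unw, refl] at this ⊢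
    rw [if_neg (Ne.symm hn.1), this]

theorem unw_append_of_mem (n : ℕ) (S T T' : List (ℕ × ℚ)) (hn : n ∈ labs S) :
    unw A B n (S ++ T) = unw A B n (S ++ T') := by
  induction S with
  | nil => simp at hn
  | cons t S ih =>
    simp only [List.cons_append, unw]
    by_cases h : t.1 = n
    · simp [h]
    · have : n ∈ labs S := by
        simp only [List.map_cons, List.mem_cons] at hn
        exact hn.resolve_left (Ne.symm h)
      simp only [h, if_false, ih this]

theorem Unwinds.prefix {u : ℕ → ℚ} {S T : List (ℕ × ℚ)} (h : Unwinds A B u (S ++ T)) :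
    Unwinds A B u S := by
  refine ⟨?_, fun n hn => ?_⟩
  · have := h.1
    rw [labs_append] at this
    exact (List.nodup_append.1 this).1
  · rw [← h.2 n (by rw [labs_append]; exact List.mem_append_left _ hn),
      unw_append_of_mem n S T [] hn, List.append_nil]

theorem refl_eq_self {K : ℕ → Prop} {u : ℕ → ℚ} {O : List ℕ} {w : ℚ}
    (h : ∀ t ∈ O, K t → u t = w) : refl K u O w = w := by
  induction O with
  | nil => rfl
  | cons t O ih =>
    simp only [List.mem_cons, forall_eq_or_imp] at h
    simp only [refl, ih h.2]
    split_ifs with hk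
    · rw [h.1 hk]; ring
    · rfl

theorem refl_eq_iff {K : ℕ → Prop} {u : ℕ → ℚ} {O : List ℕ} {w v : ℚ}
    (h : ∀ t ∈ O, K t → u t = w) : refl K u O v = w ↔ v = w := by
  have h1 := abs_refl_sub K u O v w
  rw [refl_eq_self h] at h1
  rw [← sub_eq_zero, ← abs_eq_zero, h1, abs_eq_zero, sub_eq_zero]

/-- In a sorted order the unwound values are the values themselves. -/
theorem Unwinds.eq_withVal {u : ℕ → ℚ} {Z : List (ℕ × ℚ)} (h : Unwinds A B u Z)
    (he : EqSeg A B u (labs Z)) (hs : (labs Z).Pairwise (Rk A B)) :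
    Z = withVal u (labs Z) := by
  induction Z using List.reverseRecOn with
  | nil => rfl
  | append_singleton S p ih =>
    have hsub : ∀ t ∈ labs S, t ∈ labs (S ++ [p]) := fun t ht => by
      rw [labs_append]; exact List.mem_append_left _ ht
    have hS := ih h.prefix (fun m hm n hn => he m (hsub m hm) n (hsub n hn))
      (by rw [labs_append] at hs; exact (List.pairwise_append.1 hs).1)
    have hp : p.1 ∉ labs S := by
      have := h.1
      rw [labs_append, List.nodup_append] at this
      intro hc
      exact this.2.2 p.1 hc p.1 (by simp) rfl
    have e := h.2 p.1 (by simp)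
    rw [hS, unw_withVal u p.1 _ hp] at e
    simp only [unw, if_true] at e
    rw [refl_eq_iff] at e
    · conv_lhs => rw [hS]
      simp [withVal, ← e]
    · intro t ht hk
      have hr : Rk A B t p.1 := by
        rw [labs_append] at hs
        exact (List.pairwise_append.1 hs).2.2 t ht p.1 (by simp)
      have ht' := hsub t ht
      refine he t ht' p.1 (by simp) hk ?_
      rcases hr with hr | ⟨hr, hr' | ⟨hr', _⟩⟩
      · exact absurd hk.1 (not_le.2 hr)
      · exact absurd hk.2 (not_le.2 hr')
      · exact ⟨hr.le, hr'.ge⟩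

theorem unwinds_withVal {u : ℕ → ℚ} {O : List ℕ} (hn : O.Nodup) (he : EqSeg A B u O)
    (hs : O.Pairwise (Rk A B)) : Unwinds A B u (withVal u O) := by
  refine ⟨by rwa [labs_withVal], fun n hm => ?_⟩
  rw [labs_withVal] at hm
  obtain ⟨S, T, rfl⟩ := List.append_of_mem hm
  have h1 : withVal u (S ++ n :: T) = withVal u S ++ (n, u n) :: withVal u T := by
    simp [withVal]
  have hnS : n ∉ S := fun hc => (List.nodup_append.1 hn).2.2 n hc n (by simp) rfl
  rw [h1, unw_withVal u n S hnS]
  simp only [unw, if_true]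
  apply refl_eq_self
  intro t ht hk
  have hr : Rk A B t n := (List.pairwise_append.1 hs).2.2 t ht n (by simp)
  refine he t (by simp [ht]) n (by simp) hk ?_
  rcases hr with hr | ⟨hr, hr' | ⟨hr', _⟩⟩
  · exact absurd hk.1 (not_le.2 hr)
  · exact absurd hk.2 (not_le.2 hr')
  · exact ⟨hr.le, hr'.ge⟩

theorem adm_of_sorted {O : List ℕ} (hs : O.Pairwise (Rk A B)) : Adm A B O := by
  refine hs.imp fun {m n} h hc => ?_
  exact absurd h.le (not_le.2 hc.2)

theorem ZStep.congr {A' : ℕ → ℚ} {C : ℕ → ℕ → Prop} {Z Z' : List (ℕ × ℚ)}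
    (h : ∀ n ∈ labs Z, A' n = A n) (hs : ZStep A B C Z Z') : ZStep A' B C Z Z' := by
  cases hs with
  | lo S T p q h1 h2 =>
    have e1 := h p.1 (by simp)
    have e2 := h q.1 (by simp)
    exact .lo S T p q h1 ⟨h2.1, by rw [e1, e2]; exact h2.2⟩
  | hi S T p q h1 h2 h3 =>
    have e1 := h p.1 (by simp)
    have e2 := h q.1 (by simp)
    exact .hi S T p q h1 ⟨h2.1, by rw [e1, e2]; exact h2.2⟩
      (fun hc => h3 ⟨hc.1, by have := hc.2; rwa [e1, e2] at this⟩)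

theorem ZReach.congr {A' : ℕ → ℚ} {C : ℕ → ℕ → Prop} {Z Z' : List (ℕ × ℚ)}
    (h : ∀ n ∈ labs Z, A' n = A n) (hs : ZReach A B C Z Z') : ZReach A' B C Z Z' := by
  induction hs with
  | refl => exact .refl
  | tail h1 h2 ih =>
    exact ih.tail (h2.congr fun n hn => h n ((ZReach.perm h1).mem_iff.2 hn))

theorem refl_filter {K D : ℕ → Prop} [DecidablePred D] (u : ℕ → ℚ) (O : List ℕ) (v : ℚ) :
    refl K u (O.filter fun t => decide (D t)) v = refl (fun t => D t ∧ K t) u O v := by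
  induction O with
  | nil => rfl
  | cons t O ih =>
    by_cases h : D t <;> simp [h, refl, ih]

theorem rsg_filter {K D : ℕ → Prop} [DecidablePred D] (O : List ℕ) :
    rsg K (O.filter fun t => decide (D t)) = rsg (fun t => D t ∧ K t) O := by
  induction O with
  | nil => rfl
  | cons t O ih =>
    by_cases h : D t <;> simp [h, rsg, ih]

theorem rsg_mul (K K' : ℕ → Prop) (O : List ℕ) :
    rsg K O * rsg K' O = rsg (fun t => ¬ (K t ↔ K' t)) O := by
  induction O with
  | nil => simp [rsg]
  | cons t O ih =>
    by_cases h : K t <;> by_cases h' : K' t <;> simp [rsg, h, h', ← ih]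

/-- Reflections in entries equal to the final value are invisible. -/
theorem refl_extra {K K' : ℕ → Prop} {u : ℕ → ℚ} {O : List ℕ} {v w : ℚ}
    (h : ∀ t ∈ O, K t → K' t) (h' : ∀ t ∈ O, K' t → ¬ K t → u t = w)
    (hp : O.Pairwise fun m n => K m → K' n → K n) (hv : refl K u O v = w) :
    refl K' u O v = w := by
  induction O with
  | nil => exact hv
  | cons t O ih =>
    simp only [List.mem_cons, forall_eq_or_imp, List.pairwise_cons] at h h' hp
    by_cases hk : K t
    · rw [← hv]
      simp only [refl, hk, h.1 hk, if_true]
      rw [refl_congr_left (K := K') (K' := K)]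
      exact fun s hs => ⟨hp.1 s hs hk, h.2 s hs⟩
    · simp only [refl, hk, if_false] at hv
      have := ih h.2 h'.2 hp.2 hv
      simp only [refl, this]
      split_ifs with hk'
      · rw [h'.1 hk' hk]; ring
      · rfl

theorem sorted_sublist_eq_filter {O O' : List ℕ} (hs : O.Pairwise (Rk A B)) (hn : O.Nodup)
    (hs' : O'.Pairwise (Rk A B)) (hn' : O'.Nodup) (h : ∀ t ∈ O', t ∈ O) :
    O' = O.filter fun t => decide (t ∈ O') := by
  have h1 : (O.filter fun t => decide (t ∈ O')).Perm O' := by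
    rw [List.perm_ext_iff_of_nodup (hn.filter _) hn']
    intro t
    simp only [List.mem_filter, decide_eq_true_eq]
    exact ⟨fun h => h.2, fun ht => ⟨h t ht, ht⟩⟩
  exact (h1.eq_of_pairwise (fun _ _ _ _ h h' => h.antisymm h') (hs.filter _) hs').symm

end AnyOrder

section UnionIntersection

open scoped Classical

variable {A B : ℕ → ℚ}

/-- An admissible order in which the rows `i` and `j` are neighbours and a
union-intersection is applicable there; the rows in front of them, `R`, are sorted. -/
structure UIList (A B u : ℕ → ℚ) (R : List ℕ) (i : ℕ) (zi : ℚ) (j : ℕ) (zj : ℚ)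
    (T : List (ℕ × ℚ)) (P S Q : List ℕ) (s : ℚ) : Prop where
  sorted : (P ++ i :: (S ++ j :: Q)).Pairwise (Rk A B)
  gen : GenLip A B u (P ++ i :: (S ++ j :: Q))
  hA : A i < A j
  hB : B i < B j
  hs : s = 1 ∨ s = -1
  hz : zi - zj = s * (A j - A i + (B j - B i))
  filt : R = (P ++ i :: (S ++ j :: Q)).filter fun t => decide (t ∈ R)
  unwinds : Unwinds A B u (withVal u R ++ (i, zi) :: (j, zj) :: T)
  perm : (R ++ i :: j :: labs T).Perm (P ++ i :: (S ++ j :: Q))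
  adm : Adm A B (R ++ i :: j :: labs T)

namespace UIList

variable {u : ℕ → ℚ} {R : List ℕ} {i : ℕ} {zi : ℚ} {j : ℕ} {zj : ℚ} {T : List (ℕ × ℚ)}
  {P S Q : List ℕ} {s : ℚ}

theorem nodup (h : UIList A B u R i zi j zj T P S Q s) : (R ++ i :: j :: labs T).Nodup := by
  have := h.unwinds.1
  rwa [labs_append, labs_withVal] at this

theorem nodup_sorted (h : UIList A B u R i zi j zj T P S Q s) :
    (P ++ i :: (S ++ j :: Q)).Nodup := h.perm.nodup_iff.1 h.nodup

theorem i_notMem (h : UIList A B u R i zi j zj T P S Q s) : i ∉ R := fun hc =>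
  (List.nodup_append.1 h.nodup).2.2 i hc i (by simp) rfl

theorem j_notMem (h : UIList A B u R i zi j zj T P S Q s) : j ∉ R := fun hc =>
  (List.nodup_append.1 h.nodup).2.2 j hc j (by simp) rfl

theorem ne (h : UIList A B u R i zi j zj T P S Q s) : i ≠ j := by
  rintro rfl
  exact lt_irrefl _ h.hA

theorem T_ne (h : UIList A B u R i zi j zj T P S Q s) {t : ℕ} (ht : t ∈ labs T) :
    t ≠ i ∧ t ≠ j ∧ t ∉ R := by
  have := List.nodup_append.1 h.nodup
  simp only [List.nodup_cons, List.mem_cons, not_or] at this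
  refine ⟨?_, ?_, ?_⟩
  · rintro rfl; exact this.2.1.1.2 ht
  · rintro rfl; exact this.2.1.2.1 ht
  · intro hc; exact this.2.2 t hc t (by simp [ht]) rfl

theorem A_le_of_mem (h : UIList A B u R i zi j zj T P S Q s) {t : ℕ} (ht : t ∈ R)
    (hb : B i < B t) : A t ≤ A i := by
  have := (List.pairwise_append.1 h.adm).2.2 t ht i (by simp)
  by_contra hc
  exact this ⟨not_le.1 hc, hb⟩

theorem le_A_of_mem (h : UIList A B u R i zi j zj T P S Q s) {t : ℕ} (ht : t ∈ labs T)
    (hb : B t < B j) : A j ≤ A t := by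
  have := (List.pairwise_append.1 h.adm).2.1
  simp only [List.pairwise_cons] at this
  have := this.2.1 t ht
  by_contra hc
  exact this ⟨not_le.1 hc, hb⟩

theorem mem_cases (h : UIList A B u R i zi j zj T P S Q s) {t : ℕ}
    (ht : t ∈ P ++ i :: (S ++ j :: Q)) : t ∈ R ∨ t = i ∨ t = j ∨ t ∈ labs T := by
  have := h.perm.mem_iff.2 ht
  simpa only [List.mem_append, List.mem_cons] using this

theorem ne_of_mem_PSQ (h : UIList A B u R i zi j zj T P S Q s) {t : ℕ}
    (ht : t ∈ P ∨ t ∈ S ∨ t ∈ Q) : t ≠ i ∧ t ≠ j := by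
  have := h.nodup_sorted
  simp only [List.nodup_append, List.nodup_cons, List.mem_append, List.mem_cons] at this
  constructor
  · rintro rfl
    rcases ht with ht | ht | ht
    · exact this.2.2 t ht t (by simp) rfl
    · exact this.2.1.1 (by simp [ht])
    · exact this.2.1.1 (by simp [ht])
  · rintro rfl
    rcases ht with ht | ht | ht
    · exact this.2.2 t ht t (by simp) rfl
    · exact this.2.1.2.2.2 t ht t (by simp) rfl
    · exact this.2.1.2.2.1.1 ht

theorem rk_P (h : UIList A B u R i zi j zj T P S Q s) {t : ℕ} (ht : t ∈ P) : Rk A B t i :=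
  (List.pairwise_append.1 h.sorted).2.2 t ht i (by simp)

theorem rk_S (h : UIList A B u R i zi j zj T P S Q s) {t : ℕ} (ht : t ∈ S) :
    Rk A B i t ∧ Rk A B t j := by
  have h1 := (List.pairwise_append.1 h.sorted).2.1
  rw [List.pairwise_cons] at h1
  exact ⟨h1.1 t (by simp [ht]), (List.pairwise_append.1 h1.2).2.2 t ht j (by simp)⟩

theorem rk_Q (h : UIList A B u R i zi j zj T P S Q s) {t : ℕ} (ht : t ∈ Q) :
    Rk A B j t := by
  have h1 := (List.pairwise_append.1 h.sorted).2.1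
  rw [List.pairwise_cons] at h1
  have h2 := (List.pairwise_append.1 h1.2).2.1
  rw [List.pairwise_cons] at h2
  exact h2.1 t ht

theorem le_of_mem_S (h : UIList A B u R i zi j zj T P S Q s) {t : ℕ} (ht : t ∈ S)
    (hR : t ∈ R) : A t ≤ A i := by
  rcases (h.rk_S ht).1 with hr | ⟨hr, hr' | ⟨hr', _⟩⟩
  · exact h.A_le_of_mem hR hr
  · exact hr'.le
  · exact hr'.ge

theorem ge_of_mem_S (h : UIList A B u R i zi j zj T P S Q s) {t : ℕ} (ht : t ∈ S)
    (hR : t ∉ R) : A j ≤ A t := by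
  obtain ⟨n1, n2⟩ := h.ne_of_mem_PSQ (.inr (.inl ht))
  have hT : t ∈ labs T := by
    rcases h.mem_cases (t := t) (by simp [ht]) with h1 | h1 | h1 | h1
    · exact absurd h1 hR
    · exact absurd h1 n1
    · exact absurd h1 n2
    · exact h1
  rcases (h.rk_S ht).2 with hr | ⟨hr, hr' | ⟨hr', _⟩⟩
  · exact h.le_A_of_mem hT hr
  · exact hr'.le
  · exact hr'.ge

theorem mem_S_iff (h : UIList A B u R i zi j zj T P S Q s) {t : ℕ} (ht : t ∈ S) :
    t ∈ R ↔ A t ≤ A i := by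
  refine ⟨h.le_of_mem_S ht, fun hc => ?_⟩
  by_contra hR
  exact absurd (h.ge_of_mem_S ht hR) (not_le.2 (hc.trans_lt h.hA))

theorem B_lt_of_mem_S (h : UIList A B u R i zi j zj T P S Q s) {t : ℕ} (ht : t ∈ S)
    (hR : t ∈ R) : B t < B j := by
  have h1 := h.le_of_mem_S ht hR
  have := h.hA
  rcases (h.rk_S ht).2 with hr | ⟨hr, hr' | ⟨hr', _⟩⟩
  · exact hr
  · exact absurd h1 (not_le.2 (this.trans hr'))
  · exact absurd h1 (not_le.2 (hr' ▸ this))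

theorem low_iff (h : UIList A B u R i zi j zj T P S Q s) {t : ℕ} (ht : t ∈ S) :
    Low A B i (B j) t ↔ t ∈ R :=
  ⟨fun hc => (h.mem_S_iff ht).2 hc.1, fun hc => ⟨h.le_of_mem_S ht hc, h.B_lt_of_mem_S ht hc⟩⟩

theorem refl_R (h : UIList A B u R i zi j zj T P S Q s) (K : ℕ → Prop) (v : ℚ) :
    refl K u R v = refl (fun t => t ∈ R ∧ K t) u P (refl (fun t => t ∈ R ∧ K t) u S
      (refl (fun t => t ∈ R ∧ K t) u Q v)) := by
  refine ((congrArg (fun X => refl K u X v) h.filt).trans (refl_filter u _ v)).trans ?_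
  rw [refl_append]
  simp only [refl, h.i_notMem, h.j_notMem, false_and, if_false, refl_append]

theorem rsg_R (h : UIList A B u R i zi j zj T P S Q s) (K : ℕ → Prop) :
    rsg K R = rsg (fun t => t ∈ R ∧ K t) P * (rsg (fun t => t ∈ R ∧ K t) S *
      rsg (fun t => t ∈ R ∧ K t) Q) := by
  refine ((congrArg (fun X => rsg K X) h.filt).trans (rsg_filter _)).trans ?_
  rw [rsg_append]
  simp only [rsg, h.i_notMem, h.j_notMem, false_and, if_false, rsg_append]

theorem B_lt_of_mem_Q (h : UIList A B u R i zi j zj T P S Q s) {t : ℕ} (ht : t ∈ Q) :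
    B i < B t := h.hB.trans_le (h.rk_Q ht).le

/-- Rows in `R` containing no row of `P` strictly. -/
theorem refl_R_i (h : UIList A B u R i zi j zj T P S Q s) {α : ℚ} (hα : A i ≤ α) (v : ℚ) :
    refl (fun t => B i ≤ B t ∧ A t ≤ α) u R v =
      refl (fun t => t ∈ R ∧ B t = B i ∧ A t ≤ α) u P
        (refl (· ∈ R) u S (refl (· ∈ R) u Q v)) := by
  rw [h.refl_R]
  rw [refl_congr_left (O := Q) (K' := (· ∈ R)), refl_congr_left (O := S) (K' := (· ∈ R)),
    refl_congr_left (O := P) (K' := fun t => t ∈ R ∧ B t = B i ∧ A t ≤ α)]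
  · intro t ht
    have := (h.rk_P ht).le
    constructor
    · exact fun hc => ⟨hc.1, le_antisymm this hc.2.1, hc.2.2⟩
    · exact fun hc => ⟨hc.1, hc.2.1.ge, hc.2.2⟩
  · exact fun t ht => ⟨fun hc => hc.1,
      fun hc => ⟨hc, (h.rk_S ht).1.le, (h.le_of_mem_S ht hc).trans hα⟩⟩
  · exact fun t ht => ⟨fun hc => hc.1,
      fun hc => ⟨hc, (h.B_lt_of_mem_Q ht).le, (h.A_le_of_mem hc (h.B_lt_of_mem_Q ht)).trans hα⟩⟩

theorem refl_R_j (h : UIList A B u R i zi j zj T P S Q s) {α : ℚ} (hα : A i ≤ α) (v : ℚ) :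
    refl (fun t => B j ≤ B t ∧ A t ≤ α) u R v = refl (· ∈ R) u Q v := by
  have hB := h.hB
  rw [h.refl_R]
  rw [refl_congr_left (O := Q) (K' := (· ∈ R)), refl_of_not (O := S), refl_of_not (O := P)]
  · intro t ht hc
    have := (h.rk_P ht).le
    linarith [hc.2.1]
  · intro t ht hc
    exact absurd hc.2.1 (not_le.2 (h.B_lt_of_mem_S ht hc.1))
  · exact fun t ht => ⟨fun hc => hc.1,
      fun hc => ⟨hc, (h.rk_Q ht).le, (h.A_le_of_mem hc (h.B_lt_of_mem_Q ht)).trans hα⟩⟩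

theorem tie (h : UIList A B u R i zi j zj T P S Q s) {m n : ℕ}
    (hm : m ∈ P ++ i :: (S ++ j :: Q)) (hn : n ∈ P ++ i :: (S ++ j :: Q)) (hB : B m = B n) :
    |u m - u n| ≤ |A m - A n| := h.gen.tie h.sorted hm hn hB

theorem u_i (h : UIList A B u R i zi j zj T P S Q s) :
    u i = refl (· ∈ R) u S (refl (· ∈ R) u Q zi) := by
  have e := h.unwinds.2 i (by simp)
  rw [unw_withVal u i R h.i_notMem] at e
  simp only [LocalArthur.unw, if_true] at e
  have e' := h.refl_R_i le_rfl zi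
  rw [show refl (fun t => B i ≤ B t ∧ A t ≤ A i) u R zi = u i from e] at e'
  refine ((refl_eq_iff ?_).1 e'.symm).symm
  rintro t ht ⟨hR, hb, ha⟩
  have hr : A t = A i := by
    rcases h.rk_P ht with hr | ⟨_, hr | ⟨hr, _⟩⟩
    · exact absurd hb hr.ne
    · exact absurd ha (not_le.2 hr)
    · exact hr
  have := h.tie (m := t) (n := i) (by simp [ht]) (by simp) hb
  rw [hr, sub_self, abs_zero] at this
  exact sub_eq_zero.1 (abs_eq_zero.1 (le_antisymm this (abs_nonneg _)))

theorem u_j (h : UIList A B u R i zi j zj T P S Q s) : u j = refl (· ∈ R) u Q zj := by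
  have e := h.unwinds.2 j (by simp)
  rw [unw_withVal u j R h.j_notMem] at e
  have hn : ¬ Sub A B i j := fun hc => absurd hc.1 (not_le.2 h.hB)
  simp only [LocalArthur.unw, h.ne, if_false, hn, if_true] at e
  rw [← h.refl_R_j h.hA.le zj]
  exact e.symm

theorem rsg_S (h : UIList A B u R i zi j zj T P S Q s) :
    rsg (Low A B i (B j)) S = rsg (· ∈ R) S := rsg_congr fun _ ht => h.low_iff ht

/-- The sign of the union-intersection in the sorted order. -/
noncomputable def sg (R S Q : List ℕ) (s : ℚ) : ℚ := rsg (· ∈ R) S * rsg (· ∈ R) Q * s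

theorem conf (h : UIList A B u R i zi j zj T P S Q s) :
    UIConf A B u P i S j Q (sg R S Q s) where
  sorted := h.sorted
  gen := h.gen
  hA := h.hA
  hB := h.hB
  hS t ht := by
    by_cases hR : t ∈ R
    · exact .inl (h.le_of_mem_S ht hR)
    · exact .inr (h.ge_of_mem_S ht hR)
  hσ := by
    unfold sg
    rcases rsg_eq (· ∈ R) S with h1 | h1 <;> rcases rsg_eq (· ∈ R) Q with h2 | h2 <;>
      rcases h.hs with h3 | h3 <;> simp [h1, h2, h3]
  hu := by
    rw [refl_congr_left (O := S) (K' := (· ∈ R)) (fun t ht => h.low_iff ht), h.u_i, h.u_j,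
      refl_sub, refl_sub, h.hz, sg]
    ring

end UIList
end UnionIntersection

section UnionIntersectionValues

open scoped Classical

variable {A B : ℕ → ℚ}

theorem uiA_left (i j : ℕ) : uiA A i j i = A j := by simp [uiA]

theorem uiA_right {i j : ℕ} (h : i ≠ j) : uiA A i j j = A i := by simp [uiA, h.symm]

theorem uiA_of_ne {i j n : ℕ} (h : n ≠ i) (h' : n ≠ j) : uiA A i j n = A n := by
  simp [uiA, h, h']

theorem unw_congr {A' : ℕ → ℚ} {n : ℕ} (hn : A' n = A n) (Y : List (ℕ × ℚ))
    (h : ∀ t ∈ labs Y, A' t = A t) : unw A' B n Y = unw A B n Y := by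
  induction Y with
  | nil => rfl
  | cons t Y ih =>
    simp only [List.map_cons, List.mem_cons, forall_eq_or_imp] at h
    have e : Sub A' B t.1 n ↔ Sub A B t.1 n := by rw [Sub, Sub, hn, h.1]
    simp only [unw, ih h.2]
    by_cases h1 : t.1 = n
    · rw [if_pos h1, if_pos h1]
    · rw [if_neg h1, if_neg h1]
      by_cases h2 : Sub A B t.1 n
      · rw [if_pos h2, if_pos (e.2 h2)]
      · rw [if_neg h2, if_neg fun hc => h2 (e.1 hc)]

namespace UIList

variable {u : ℕ → ℚ} {R : List ℕ} {i : ℕ} {zi : ℚ} {j : ℕ} {zj : ℚ} {T : List (ℕ × ℚ)}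
  {P S Q : List ℕ} {s : ℚ}

/-- The values of the rows in sorted order after the union-intersection. -/
noncomputable def val (A B u : ℕ → ℚ) (R : List ℕ) (i j : ℕ) (P S Q : List ℕ) (s : ℚ) :
    ℕ → ℚ := uiVal A B u P i S j (sg R S Q s)

theorem R_ne (h : UIList A B u R i zi j zj T P S Q s) {t : ℕ} (ht : t ∈ R) :
    t ≠ i ∧ t ≠ j :=
  ⟨fun hc => h.i_notMem (hc ▸ ht), fun hc => h.j_notMem (hc ▸ ht)⟩

theorem val_R (h : UIList A B u R i zi j zj T P S Q s) {t : ℕ} (ht : t ∈ R) :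
    val A B u R i j P S Q s t = u t := by
  obtain ⟨h1, h2⟩ := h.R_ne ht
  have hA := h.hA
  have hB := h.hB
  have h3 : ¬ (B i < B t ∧ B t ≤ B j ∧ A j ≤ A t) := fun hc => by
    have := h.A_le_of_mem ht hc.1
    linarith [hc.2.2]
  have h4 : ¬ (B t = B j ∧ A i < A t ∧ A t < A j) := fun hc => by
    have := h.A_le_of_mem ht (hc.1 ▸ hB)
    linarith [hc.2.1]
  simp only [val, uiVal, h1, h2, h3, h4, if_false]

theorem unw_R (h : UIList A B u R i zi j zj T P S Q s) {t : ℕ} (ht : t ∈ R)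
    (Y : List (ℕ × ℚ)) : unw (uiA A i j) B t (withVal u R ++ Y) = u t := by
  have e := h.unwinds.2 t (by rw [labs_append, labs_withVal]; exact List.mem_append_left _ ht)
  rw [unw_append_of_mem t (withVal u R) _ [] (by rwa [labs_withVal])] at e
  rw [unw_append_of_mem t (withVal u R) _ [] (by rwa [labs_withVal]), ← e]
  rw [List.append_nil]
  obtain ⟨h1, h2⟩ := h.R_ne ht
  refine unw_congr (uiA_of_ne h1 h2) _ fun n hn => ?_
  rw [labs_withVal] at hn
  obtain ⟨h3, h4⟩ := h.R_ne hn
  exact uiA_of_ne h3 h4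

theorem sub_R (h : UIList A B u R i zi j zj T P S Q s) {n : ℕ} {t : ℕ} (ht : t ∈ R) :
    Sub (uiA A i j) B t n ↔ B n ≤ B t ∧ A t ≤ uiA A i j n := by
  obtain ⟨h1, h2⟩ := h.R_ne ht
  simp only [Sub, uiA_of_ne h1 h2]

theorem unw_X (h : UIList A B u R i zi j zj T P S Q s) {n : ℕ} (hn : n ∉ R)
    (Y : List (ℕ × ℚ)) : unw (uiA A i j) B n (withVal u R ++ Y) =
      refl (fun t => B n ≤ B t ∧ A t ≤ uiA A i j n) u R (unw (uiA A i j) B n Y) := by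
  rw [unw_withVal u n R hn]
  exact refl_congr_left (fun t ht => h.sub_R ht) _

theorem unw_i (h : UIList A B u R i zi j zj T P S Q s) (Y : List (ℕ × ℚ)) :
    unw (uiA A i j) B i (withVal u R ++ (i, zi + s * (A j - A i)) :: Y) =
      val A B u R i j P S Q s i := by
  rw [h.unw_X h.i_notMem]
  simp only [LocalArthur.unw, if_true, uiA_left]
  have e := h.refl_R_i h.hA.le (zi + s * (A j - A i))
  rw [e, refl_eq_add, refl_eq_add, ← h.u_i]
  have e2 : u i + rsg (· ∈ R) S * (rsg (· ∈ R) Q * (s * (A j - A i))) =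
      u i + sg R S Q s * (A j - A i) := by
    unfold sg; ring
  rw [e2]
  refine refl_extra (K := fun m => B m = B i ∧ A m < A j) ?_ ?_ ?_ (by simp [val, uiVal])
  · intro t ht hc
    refine ⟨?_, hc.1, hc.2.le⟩
    obtain ⟨n1, n2⟩ := h.ne_of_mem_PSQ (.inl ht)
    rcases h.mem_cases (t := t) (by simp [ht]) with h1 | h1 | h1 | h1
    · exact h1
    · exact absurd h1 n1
    · exact absurd h1 n2
    · exact absurd (h.le_A_of_mem h1 (hc.1 ▸ h.hB)) (not_le.2 hc.2)
  · rintro t ht ⟨hR, hb, ha⟩ hk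
    have ha' : A t = A j := le_antisymm ha (not_lt.1 fun hc => hk ⟨hb, hc⟩)
    have := h.conf.tie_ui (m := t) (n := i) (by simp [ht]) (by simp) hb
    rw [uiA_left, uiA_of_ne (h.R_ne hR).1 (h.R_ne hR).2, ha', sub_self, abs_zero] at this
    have := sub_eq_zero.1 (abs_eq_zero.1 (le_antisymm this (abs_nonneg _)))
    rw [← h.val_R hR]
    exact this
  · refine (List.pairwise_append.1 h.sorted).1.imp ?_
    rintro m n hr ⟨hb, ha⟩ ⟨_, hb', _⟩
    refine ⟨hb', ?_⟩
    rcases hr with hr | ⟨_, hr | ⟨hr, _⟩⟩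
    · rw [hb, hb'] at hr; exact absurd hr (lt_irrefl _)
    · exact hr.trans ha
    · exact hr ▸ ha

theorem unw_j (h : UIList A B u R i zi j zj T P S Q s) (w : ℚ) (Y : List (ℕ × ℚ)) :
    unw (uiA A i j) B j (withVal u R ++ (i, w) :: (j, zj + s * (A j - A i)) :: Y) =
      val A B u R i j P S Q s j := by
  rw [h.unw_X h.j_notMem]
  have hn : ¬ Sub (uiA A i j) B i j := fun hc => by
    have := hc.1
    exact absurd this (not_le.2 h.hB)
  simp only [LocalArthur.unw, if_true, h.ne, if_false, hn, uiA_right h.ne]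
  rw [h.refl_R_j le_rfl, refl_eq_add, ← h.u_j]
  have := rsg_mul_self (· ∈ R) S
  simp only [val, uiVal, h.ne.symm, if_false, if_true, h.rsg_S, sg]
  linear_combination (-(rsg (· ∈ R) Q) * (s * (A j - A i))) * this

theorem unw_T (h : UIList A B u R i zi j zj T P S Q s) {n : ℕ} (hn : n ∈ labs T)
    : unw (uiA A i j) B n (withVal u R ++ (i, zi + s * (A j - A i)) ::
        (j, zj + s * (A j - A i)) :: T) = val A B u R i j P S Q s n := by
  obtain ⟨hi, hj, hR⟩ := h.T_ne hn
  have hA := h.hA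
  have hB := h.hB
  have e := h.unwinds.2 n (by simp [labs] at hn ⊢; tauto)
  have hT : unw (uiA A i j) B n T = unw A B n T := by
    refine unw_congr (uiA_of_ne hi hj) _ fun t ht => ?_
    obtain ⟨h1, h2, _⟩ := h.T_ne ht
    exact uiA_of_ne h1 h2
  have hmem : n ∈ P ++ i :: (S ++ j :: Q) := h.perm.mem_iff.1 (by simp [labs] at hn ⊢; tauto)
  rw [unw_withVal u n R hR] at e
  rw [h.unw_X hR]
  simp only [LocalArthur.unw, Ne.symm hi, Ne.symm hj, if_false, hT, Sub, uiA_left,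
    uiA_right h.ne, uiA_of_ne hi hj] at e ⊢
  generalize LocalArthur.unw A B n T = r at e
  have hadm : B n < B j → A j ≤ A n := h.le_A_of_mem hn
  by_cases c1 : B n ≤ B i
  · have a1 := hadm (c1.trans_lt hB)
    have c2 : B n ≤ B j := c1.trans hB.le
    have c3 : A i ≤ A n := hA.le.trans a1
    have v : val A B u R i j P S Q s n = u n := by
      have d1 : ¬ (B i < B n ∧ B n ≤ B j ∧ A j ≤ A n) := fun hc => absurd c1 (not_le.2 hc.1)
      have d2 : ¬ (B n = B j ∧ A i < A n ∧ A n < A j) := fun hc => absurd a1 (not_le.2 hc.2.2)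
      simp only [val, uiVal, hi, hj, d1, d2, if_false]
    rw [v, ← e]
    simp only [c1, c2, c3, a1, and_self, if_true]
    congr 1
    ring
  by_cases c2 : B n ≤ B j
  · simp only [c1, c2, false_and, if_false, true_and] at e ⊢
    by_cases c3 : A j ≤ A n
    · have c4 : A i ≤ A n := hA.le.trans c3
      have v : val A B u R i j P S Q s n =
          u n + 2 * (rsg (Low A B i (B n)) S * sg R S Q s * (A j - A i)) := by
        simp only [val, uiVal, hi, hj, not_le.1 c1, c2, c3, and_self, if_false, if_true]
      simp only [c3, c4, if_true] at e ⊢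
      rw [v, ← e, show 2 * (zj + s * (A j - A i)) - r = 2 * zj - r + 2 * s * (A j - A i) by ring,
        refl_eq_add, h.rsg_R]
      have e1 : rsg (fun t => t ∈ R ∧ B n ≤ B t ∧ A t ≤ A n) P = 1 := by
        apply rsg_of_not
        rintro t ht ⟨_, h1, _⟩
        have := (h.rk_P ht).le
        exact c1 (h1.trans this)
      have e2 : rsg (fun t => t ∈ R ∧ B n ≤ B t ∧ A t ≤ A n) Q = rsg (· ∈ R) Q := by
        apply rsg_congr
        intro t ht
        refine ⟨fun hc => hc.1, fun hc => ⟨hc, c2.trans (h.rk_Q ht).le, ?_⟩⟩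
        exact (h.A_le_of_mem hc (h.B_lt_of_mem_Q ht)).trans c4
      have e3 : rsg (fun t => t ∈ R ∧ B n ≤ B t ∧ A t ≤ A n) S =
          rsg (Low A B i (B n)) S * rsg (· ∈ R) S := by
        rw [rsg_mul]
        apply rsg_congr
        intro t ht
        have f1 := h.mem_S_iff ht
        by_cases hc : t ∈ R
        · have f2 := f1.1 hc
          simp only [hc, true_and, iff_true, Low, f2, f2.trans c4, and_true, not_lt]
        · have f2 : ¬ A t ≤ A i := fun hh => hc (f1.2 hh)
          simp [hc, Low, f2]
      rw [e1, e2, e3, sg]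
      ring
    · have c4 : B n = B j := by
        by_contra hc
        exact c3 (hadm (lt_of_le_of_ne c2 hc))
      simp only [c3, if_false] at e ⊢
      have d1 : ¬ (B i < B n ∧ B n ≤ B j ∧ A j ≤ A n) := fun hc => c3 hc.2.2
      by_cases c5 : A i ≤ A n
      · simp only [c5, if_true]
        simp only [c4] at e ⊢
        rw [h.refl_R_j c5] at e ⊢
        have e4 : refl (· ∈ R) u Q (2 * (zj + s * (A j - A i)) - r) =
            2 * val A B u R i j P S Q s j - u n := by
          have f1 := refl_eq_affine (· ∈ R) u Q (2 * (zj + s * (A j - A i)) - r)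
          have f2 := refl_eq_affine (· ∈ R) u Q r
          have f3 := refl_eq_affine (· ∈ R) u Q zj
          have f4 := h.u_j
          have f5 := rsg_mul_self (· ∈ R) S
          have f6 : val A B u R i j P S Q s j =
              u j + rsg (Low A B i (B j)) S * sg R S Q s * (A j - A i) := by
            simp only [val, uiVal, h.ne.symm, if_false, if_true]
          rw [h.rsg_S, sg] at f6
          linear_combination f1 + f2 - e - 2 * f6 - 2 * f4 - 2 * f3 -
            2 * rsg (· ∈ R) Q * (s * (A j - A i)) * f5
        rw [e4]
        rcases c5.lt_or_eq with c6 | c6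
        · have : val A B u R i j P S Q s n = 2 * val A B u R i j P S Q s j - u n := by
            simp only [val, uiVal, hi, hj, c4, c6, not_le.1 c3, and_self, if_false, if_true,
              h.ne.symm]
            simp only [c3, and_false, if_false]
          rw [this]
        · have t1 := h.conf.tie_j hmem c4 hj
          rw [← c6, sub_self, abs_zero] at t1
          have t2 := sub_eq_zero.1 (abs_eq_zero.1 (le_antisymm t1 (abs_nonneg _)))
          have t3 : val A B u R i j P S Q s n = u n := by
            have d2 : ¬ (B n = B j ∧ A i < A n ∧ A n < A j) := fun hc => hc.2.1.ne c6
            simp only [val, uiVal, hi, hj, d1, d2, if_false]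
          have t4 : val A B u R i j P S Q s n = val A B u R i j P S Q s j := t2
          linarith
      · simp only [c5, if_false]
        have t3 : val A B u R i j P S Q s n = u n := by
          have d2 : ¬ (B n = B j ∧ A i < A n ∧ A n < A j) := fun hc => c5 hc.2.1.le
          simp only [val, uiVal, hi, hj, d1, d2, if_false]
        rw [t3, ← e]
  · have t3 : val A B u R i j P S Q s n = u n := by
      have d1 : ¬ (B i < B n ∧ B n ≤ B j ∧ A j ≤ A n) := fun hc => c2 hc.2.1
      have d2 : ¬ (B n = B j ∧ A i < A n ∧ A n < A j) := fun hc => c2 hc.1.le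
      simp only [val, uiVal, hi, hj, d1, d2, if_false]
    simp only [c1, c2, false_and, if_false] at e ⊢
    rw [t3, ← e]

/-- The list of values after the union-intersection. -/
def X (A u : ℕ → ℚ) (R : List ℕ) (i : ℕ) (zi : ℚ) (j : ℕ) (zj : ℚ) (T : List (ℕ × ℚ)) (s : ℚ) :
    List (ℕ × ℚ) :=
  withVal u R ++ (i, zi + s * (A j - A i)) :: (j, zj + s * (A j - A i)) :: T

theorem labs_X (A u : ℕ → ℚ) (R : List ℕ) (i : ℕ) (zi : ℚ) (j : ℕ) (zj : ℚ)
    (T : List (ℕ × ℚ)) (s : ℚ) : labs (X A u R i zi j zj T s) = R ++ i :: j :: labs T := by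
  rw [X, labs_append, labs_withVal]
  rfl

theorem unwinds_X (h : UIList A B u R i zi j zj T P S Q s) :
    Unwinds (uiA A i j) B (val A B u R i j P S Q s) (X A u R i zi j zj T s) := by
  refine ⟨by rw [labs_X]; exact h.nodup, fun n hn => ?_⟩
  rw [labs_X] at hn
  simp only [List.mem_append, List.mem_cons] at hn
  rcases hn with hn | rfl | rfl | hn
  · rw [X, h.unw_R hn, h.val_R hn]
  · exact h.unw_i _
  · exact h.unw_j _ _
  · exact h.unw_T hn

theorem tie_val (h : UIList A B u R i zi j zj T P S Q s) {m n : ℕ}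
    (hm : m ∈ labs (X A u R i zi j zj T s)) (hn : n ∈ labs (X A u R i zi j zj T s))
    (hmn : B m = B n) :
    |val A B u R i j P S Q s m - val A B u R i j P S Q s n| ≤
      |uiA A i j m - uiA A i j n| := by
  rw [labs_X] at hm hn
  exact h.conf.tie_ui (h.perm.mem_iff.1 hm) (h.perm.mem_iff.1 hn) hmn

theorem bdd_val (h : UIList A B u R i zi j zj T P S Q s) {κ τ : ℚ} (hτ : -1 ≤ τ)
    (hb : Bdd A B u κ τ (P ++ i :: (S ++ j :: Q))) :
    Bdd (uiA A i j) B (val A B u R i j P S Q s) κ τ (labs (X A u R i zi j zj T s)) := by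
  intro n hn
  rw [labs_X] at hn
  exact h.conf.bdd hτ hb n (h.perm.mem_iff.1 hn)

end UIList

theorem eqSeg_of_tie {u : ℕ → ℚ} {O : List ℕ}
    (h : ∀ m ∈ O, ∀ n ∈ O, B m = B n → |u m - u n| ≤ |A m - A n|) : EqSeg A B u O := by
  intro m hm n hn h1 h2
  have := h m hm n hn (le_antisymm h2.1 h1.1)
  rw [le_antisymm h1.2 h2.2, sub_self, abs_zero] at this
  exact sub_eq_zero.1 (abs_eq_zero.1 (le_antisymm this (abs_nonneg _)))

theorem refl_bound {K : ℕ → Prop} {u : ℕ → ℚ} {κ τ β c v : ℚ} (O : List ℕ) :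
    ∀ w, refl K u O v = w → O.Pairwise (fun m n => K m → K n → A n ≤ A m) →
      (∀ m ∈ O, ∀ n ∈ O, K m → K n → |u m - u n| ≤ |A m - A n|) →
      (∀ t ∈ O, K t → |u t - κ| ≤ A t + 1 + τ * β) →
      (∀ t ∈ O, K t → |w - u t| ≤ c - A t) → |w - κ| ≤ c + 1 + τ * β →
      |v - κ| ≤ c + 1 + τ * β := by
  induction O with
  | nil => rintro w rfl _ _ _ _ h; exact h
  | cons t O ih =>
    intro w hw hp ht hb hc h
    rw [List.pairwise_cons] at hp
    by_cases hk : K t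
    · simp only [refl, hk, if_true] at hw
      have h1 := hc t (by simp) hk
      have h2 := hb t (by simp) hk
      refine ih (2 * u t - w) (by linarith) hp.2
        (fun m hm n hn => ht m (by simp [hm]) n (by simp [hn]))
        (fun m hm => hb m (by simp [hm])) (fun m hm hk' => ?_) ?_
      · have h3 := hp.1 m hm hk hk'
        have h4 := ht t (by simp) m (by simp [hm]) hk hk'
        rw [abs_of_nonneg (by linarith : 0 ≤ A t - A m)] at h4
        rw [abs_le] at h1 h4 ⊢
        constructor <;> linarith
      · rw [abs_le] at h1 h2 ⊢
        constructor <;> linarith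
    · simp only [refl, hk, if_false] at hw
      exact ih w hw hp.2 (fun m hm n hn => ht m (by simp [hm]) n (by simp [hn]))
        (fun m hm => hb m (by simp [hm])) (fun m hm => hc m (by simp [hm])) h

/-- Bounds on the unwound values pass to the values in any order sorted by `B`. -/
theorem Unwinds.bound {u : ℕ → ℚ} {M : List (ℕ × ℚ)} {κ τ : ℚ} (h : Unwinds A B u M)
    (ht : ∀ m ∈ labs M, ∀ n ∈ labs M, B m = B n → |u m - u n| ≤ |A m - A n|)
    (hb : Bdd A B u κ τ (labs M)) (hs : (labs M).Pairwise fun m n => B m ≤ B n)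
    (p : ℕ × ℚ) (hp : p ∈ M) : |p.2 - κ| ≤ A p.1 + 1 + τ * B p.1 := by
  have he := eqSeg_of_tie ht
  obtain ⟨S, T, rfl⟩ := List.append_of_mem hp
  have hs1 := hs
  rw [labs_append, List.pairwise_append] at hs1
  have hadm : Adm A B (labs S) := hs1.1.imp fun {m n} h1 h2 => absurd h1 (not_le.2 h2.2)
  obtain ⟨S', hS, hS'⟩ := hadm.exists_sort
  have h' := h.reach he (hS.append (p :: T))
  have hperm := hS.perm
  have hmem : ∀ t ∈ labs S', t ∈ labs (S ++ p :: T) := fun t ht => by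
    rw [labs_append]; exact List.mem_append_left _ (hperm.mem_iff.2 ht)
  have hSe := h'.prefix.eq_withVal
    (fun m hm n hn => he m (hmem m hm) n (hmem n hn)) hS'
  have hpS : p.1 ∉ labs S' := fun hc => by
    have := h'.1
    rw [labs_append, List.nodup_append] at this
    exact this.2.2 p.1 hc p.1 (by simp) rfl
  have hpm : p.1 ∈ labs (S ++ p :: T) := by simp
  have e := h'.2 p.1 (by simp)
  rw [hSe, unw_withVal u _ _ hpS] at e
  simp only [unw, if_true] at e
  have hB : ∀ t ∈ labs S', Sub A B t p.1 → B t = B p.1 := fun t ht hk =>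
    le_antisymm (hs1.2.2 t (hperm.mem_iff.2 ht) p.1 (by simp)) hk.1
  refine refl_bound (A := A) (labs S') _ e ?_ ?_ ?_ ?_ (hb _ hpm)
  · refine (List.Pairwise.and_mem.1 hS').imp ?_
    rintro m n ⟨hm, hn, hr⟩ k1 k2
    rcases hr with hr | ⟨_, hr | ⟨hr, _⟩⟩
    · rw [hB m hm k1, hB n hn k2] at hr; exact absurd hr (lt_irrefl _)
    · exact hr.le
    · exact hr.ge
  · intro m hm n hn k1 k2
    exact ht m (hmem m hm) n (hmem n hn) ((hB m hm k1).trans (hB n hn k2).symm)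
  · intro t hm hk
    rw [← hB t hm hk]
    exact hb t (hmem t hm)
  · intro t hm hk
    have := ht p.1 hpm t (hmem t hm) (hB t hm hk).symm
    rwa [abs_of_nonneg (by linarith [hk.2] : 0 ≤ A p.1 - A t)] at this

/-- The values in an order sorted by `B` after a union-intersection are bounded. -/
theorem ui_bound {u : ℕ → ℚ} {O : List ℕ} {P T M : List (ℕ × ℚ)} {i j : ℕ}
    {zi zj s κ τ : ℚ} (hO : O.Nodup) (hOs : O.Pairwise (Rk A B)) (hg : GenLip A B u O)
    (hr : ZReach A B AnyC (withVal u O) (P ++ (i, zi) :: (j, zj) :: T)) (hA : A i < A j)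
    (hB : B i < B j) (hs : s = 1 ∨ s = -1) (hz : zi - zj = s * (A j - A i + (B j - B i)))
    (hτ : -1 ≤ τ) (hb : Bdd A B u κ τ O)
    (hM : ZReach (uiA A i j) B AnyC
      (P ++ (i, zi + s * (A j - A i)) :: (j, zj + s * (A j - A i)) :: T) M)
    (hMs : (labs M).Pairwise fun m n => B m ≤ B n) :
    ∀ p ∈ M, |p.2 - κ| ≤ uiA A i j p.1 + 1 + τ * B p.1 := by
  have he : EqSeg A B u O := eqSeg_of_tie fun m hm n hn hmn => hg.tie hOs hm hn hmn
  have hE := unwinds_withVal hO he hOs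
  have heE : EqSeg A B u (labs (withVal u O)) := by rwa [labs_withVal]
  have hL := hE.reach heE hr
  have heL := heE.perm (ZReach.perm hr)
  have hLadm := ZReach.adm hr (by rw [labs_withVal]; exact adm_of_sorted hOs)
  have hPadm : Adm A B (labs P) := by
    rw [labs_append] at hLadm
    exact (List.pairwise_append.1 hLadm).1
  obtain ⟨P', hP, hP's⟩ := hPadm.exists_sort
  have hsub : ∀ t ∈ labs P, t ∈ labs (P ++ (i, zi) :: (j, zj) :: T) := fun t ht => by
    rw [labs_append]; exact List.mem_append_left _ ht
  have heP : EqSeg A B u (labs P) := fun m hm n hn => heL m (hsub m hm) n (hsub n hn)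
  have hPrev := hL.prefix.reach_symm heP hP (fun _ _ h => h)
  have hL' := hL.reach heL (hP.append ((i, zi) :: (j, zj) :: T))
  have hL'adm := (hP.append ((i, zi) :: (j, zj) :: T)).adm hLadm
  have hPe := hL'.prefix.eq_withVal (heP.perm hP.perm) hP's
  have hnd := hL'.1
  have hperm : (labs (P' ++ (i, zi) :: (j, zj) :: T)).Perm O := by
    have h1 := (ZReach.perm hr).trans (hP.append ((i, zi) :: (j, zj) :: T)).perm
    rw [labs_withVal] at h1
    exact h1.symm
  rw [labs_append] at hnd hperm hL'adm
  have hij : i ≠ j := by rintro rfl; exact lt_irrefl _ hA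
  obtain ⟨P0, S0, Q0, hO0⟩ : ∃ P0 S0 Q0, O = P0 ++ i :: (S0 ++ j :: Q0) := by
    rcases exists_split_of_mem (O := O) (m := i) (n := j) (hperm.mem_iff.1 (by simp))
      (hperm.mem_iff.1 (by simp)) hij with hc | ⟨P0, S0, Q0, rfl⟩
    · exact hc
    · have h1 := (List.pairwise_append.1 hOs).2.1
      rw [List.pairwise_cons] at h1
      exact absurd (h1.1 i (by simp)).le (not_le.2 hB)
  subst hO0
  have hUI : UIList A B u (labs P') i zi j zj T P0 S0 Q0 s :=
    { sorted := hOs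
      gen := hg
      hA := hA
      hB := hB
      hs := hs
      hz := hz
      filt := sorted_sublist_eq_filter hOs hO hP's (List.nodup_append.1 hnd).1
        (fun t ht => hperm.mem_iff.1 (List.mem_append_left _ ht))
      unwinds := by rw [← hPe]; exact hL'
      perm := hperm
      adm := hL'adm }
  have hX := hUI.unwinds_X
  have hreach : ZReach (uiA A i j) B AnyC (UIList.X A u (labs P') i zi j zj T s) M := by
    refine Relation.ReflTransGen.trans ?_ hM
    rw [UIList.X, ← hPe]
    refine ZReach.append _ (hPrev.congr fun n hn => ?_)
    obtain ⟨h1, h2⟩ := hUI.R_ne hn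
    exact uiA_of_ne h1 h2
  have heX := eqSeg_of_tie fun m hm n hn hmn => hUI.tie_val hm hn hmn
  have hpM := hreach.perm
  exact (hX.reach heX hreach).bound
    (fun m hm n hn hmn => hUI.tie_val (hpM.mem_iff.2 hm) (hpM.mem_iff.2 hn) hmn)
    (fun n hn => hUI.bdd_val hτ hb n (hpM.mem_iff.2 hn)) hMs

end UnionIntersectionValues

section DeletedRow

open scoped Classical

variable {A B : ℕ → ℚ}

/-- Negation of all values. -/
def negZ (Z : List (ℕ × ℚ)) : List (ℕ × ℚ) := Z.map fun p => (p.1, -p.2)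

@[simp] theorem labs_negZ (Z : List (ℕ × ℚ)) : labs (negZ Z) = labs Z := by
  simp [negZ, labs, Function.comp_def]

theorem ZStep.neg {C : ℕ → ℕ → Prop} {Z Z' : List (ℕ × ℚ)} (h : ZStep A B C Z Z') :
    ZStep A B C (negZ Z) (negZ Z') := by
  cases h with
  | lo S T p q h1 h2 =>
    have := ZStep.lo (A := A) (B := B) (negZ S) (negZ T) (p.1, -p.2) (q.1, -q.2) h1 h2
    convert this using 1 <;> simp [negZ]
    ring
  | hi S T p q h1 h2 h3 =>
    have := ZStep.hi (A := A) (B := B) (negZ S) (negZ T) (p.1, -p.2) (q.1, -q.2) h1 h2 h3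
    convert this using 1 <;> simp [negZ]
    ring

/-- An exchange in the list without the empty row `j` comes from exchanges in the list
with the empty row. -/
theorem ZStep.lift_empty {j : ℕ} (hj : A j = B j - 1) {P Q Z : List (ℕ × ℚ)}
    (hadm : Adm A B (labs (P ++ (j, 0) :: negZ Q)))
    (hne : ∀ n ∈ labs (P ++ Q), B n ≤ A n) (h : ZStep A B AnyC (P ++ Q) Z) :
    ∃ P' Q', Z = P' ++ Q' ∧
      ZReach A B AnyC (P ++ (j, 0) :: negZ Q) (P' ++ (j, 0) :: negZ Q') := by
  have key : ∀ (S : List (ℕ × ℚ)) (p q : ℕ × ℚ) (T : List (ℕ × ℚ)), P ++ Q = S ++ p :: q :: T →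
      (∃ X, S = P ++ X ∧ Q = X ++ p :: q :: T) ∨ (∃ Y, P = S ++ p :: q :: Y ∧ T = Y ++ Q) ∨
        (P = S ++ [p] ∧ Q = q :: T) := by
    intro S p q T e
    rcases List.append_eq_append_iff.1 e with ⟨X, h1, h2⟩ | ⟨Y, h1, h2⟩
    · exact .inl ⟨X, h1, h2⟩
    · rcases Y with - | ⟨y, Y⟩
      · exact .inl ⟨[], by simpa using h1.symm, by simpa using h2.symm⟩
      · simp only [List.cons_append, List.cons.injEq] at h2
        obtain ⟨rfl, h2⟩ := h2
        rcases Y with - | ⟨y, Y⟩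
        · exact .inr (.inr ⟨h1, by simpa using h2.symm⟩)
        · simp only [List.cons_append, List.cons.injEq] at h2
          obtain ⟨rfl, h2⟩ := h2
          exact .inr (.inl ⟨Y, h1, h2⟩)
  have straddle : ∀ (S : List (ℕ × ℚ)) (p q : ℕ × ℚ) (T : List (ℕ × ℚ)), P = S ++ [p] →
      Q = q :: T → B p.1 ≤ B j ∧ (B q.1 < B j → A j ≤ A q.1) ∧ B p.1 ≤ A p.1 ∧
        B q.1 ≤ A q.1 := by
    rintro S p q T rfl rfl
    have hp := hne p.1 (by simp)
    have hq := hne q.1 (by simp)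
    rw [labs_append, labs_append] at hadm
    obtain ⟨-, h2, h3⟩ := List.pairwise_append.1 hadm
    have h4 := h3 p.1 (by simp) j (by simp)
    have h5 := (List.pairwise_cons.1 h2).1 q.1 (by simp [negZ])
    refine ⟨?_, ?_, hp, hq⟩
    · by_contra hc
      exact h4 ⟨by linarith [not_le.1 hc], not_le.1 hc⟩
    · intro hc
      by_contra hc'
      exact h5 ⟨not_le.1 hc', hc⟩
  generalize hZ : P ++ Q = Z0 at h
  cases h with
  | lo S T p q _ h1 =>
    rcases key S p q T hZ with ⟨X, rfl, rfl⟩ | ⟨Y, rfl, rfl⟩ | ⟨hP, hQ⟩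
    · refine ⟨P, X ++ (q.1, 2 * p.2 - q.2) :: p :: T, by simp, .single ?_⟩
      have := (ZStep.lo (A := A) (B := B) (C := AnyC) X T p q trivial h1).neg.context
        (P ++ [(j, 0)]) []
      simpa using this
    · refine ⟨S ++ (q.1, 2 * p.2 - q.2) :: p :: Y, Q, by simp, .single ?_⟩
      have := ZStep.lo (A := A) (B := B) (C := AnyC) S (Y ++ (j, 0) :: negZ Q) p q trivial h1
      simpa using this
    · obtain ⟨g1, g2, g3, g4⟩ := straddle S p q T hP hQ
      subst hP hQ
      refine ⟨S ++ [(q.1, 2 * p.2 - q.2), p], T, by simp, ?_⟩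
      have hs : Sub A B j q.1 := by
        refine ⟨h1.1.trans g1, ?_⟩
        rcases (h1.1.trans g1).lt_or_eq with hc | hc
        · exact g2 hc
        · linarith
      have s1 := ZStep.lo (A := A) (B := B) (C := AnyC) (S ++ [p]) (negZ T) (j, 0)
        (q.1, -q.2) trivial hs
      have s2 := ZStep.lo (A := A) (B := B) (C := AnyC) S ((j, 0) :: negZ T) p q trivial h1
      refine Relation.ReflTransGen.tail (.single (b := S ++ p :: q :: (j, 0) :: negZ T) ?_) ?_
      · simpa [negZ] using s1
      · simpa using s2
  | hi S T p q _ h1 h2 =>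
    rcases key S p q T hZ with ⟨X, rfl, rfl⟩ | ⟨Y, rfl, rfl⟩ | ⟨hP, hQ⟩
    · refine ⟨P, X ++ q :: (p.1, 2 * q.2 - p.2) :: T, by simp, .single ?_⟩
      have := (ZStep.hi (A := A) (B := B) (C := AnyC) X T p q trivial h1 h2).neg.context
        (P ++ [(j, 0)]) []
      simpa using this
    · refine ⟨S ++ q :: (p.1, 2 * q.2 - p.2) :: Y, Q, by simp, .single ?_⟩
      have := ZStep.hi (A := A) (B := B) (C := AnyC) S (Y ++ (j, 0) :: negZ Q) p q trivial h1 h2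
      simpa using this
    · obtain ⟨g1, g2, g3, g4⟩ := straddle S p q T hP hQ
      subst hP hQ
      refine ⟨S, q :: (p.1, 2 * q.2 - p.2) :: T, by simp, ?_⟩
      have hs : Sub A B j p.1 := by
        refine ⟨g1, ?_⟩
        have := h1.2
        rcases lt_or_ge (B q.1) (B j) with hc | hc
        · linarith [g2 hc]
        · linarith
      have hs' : ¬ Sub A B p.1 j := fun hc => by
        have := hc.1
        have := hc.2
        linarith
      have s1 := ZStep.hi (A := A) (B := B) (C := AnyC) S ((q.1, -q.2) :: negZ T) p (j, 0)
        trivial hs hs'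
      have s2 := (ZStep.hi (A := A) (B := B) (C := AnyC) [] T p q trivial h1 h2).neg.context
        (S ++ [(j, 0)]) []
      refine Relation.ReflTransGen.tail
        (.single (b := S ++ (j, 0) :: (p.1, -p.2) :: (q.1, -q.2) :: negZ T) ?_) ?_
      · simpa [negZ] using s1
      · simpa [negZ] using s2

theorem ZReach.lift_empty {j : ℕ} (hj : A j = B j - 1) {P Q Z : List (ℕ × ℚ)}
    (hadm : Adm A B (labs (P ++ (j, 0) :: negZ Q)))
    (hne : ∀ n ∈ labs (P ++ Q), B n ≤ A n) (h : ZReach A B AnyC (P ++ Q) Z) :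
    ∃ P' Q', Z = P' ++ Q' ∧
      ZReach A B AnyC (P ++ (j, 0) :: negZ Q) (P' ++ (j, 0) :: negZ Q') := by
  induction h with
  | refl => exact ⟨P, Q, rfl, .refl⟩
  | tail h1 h2 ih =>
    obtain ⟨P1, Q1, rfl, h3⟩ := ih
    obtain ⟨P2, Q2, rfl, h4⟩ := h2.lift_empty hj (h3.adm hadm)
      (fun n hn => hne n ((ZReach.perm h1).mem_iff.2 hn))
    exact ⟨P2, Q2, rfl, h3.trans h4⟩

theorem exists_move_empty {j : ℕ} (Q : List (ℕ × ℚ))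
    (hs : (labs Q).Pairwise fun m n => B m ≤ B n) (hadm : Adm A B (j :: labs Q)) :
    ∃ Q₁ Q₂, Q = Q₁ ++ Q₂ ∧ (∀ p ∈ Q₁, B p.1 < B j) ∧ (∀ p ∈ Q₂, B j ≤ B p.1) ∧
      ZReach A B AnyC ((j, 0) :: negZ Q) (Q₁ ++ (j, 0) :: negZ Q₂) := by
  induction Q with
  | nil => exact ⟨[], [], rfl, by simp, by simp, .refl⟩
  | cons q Q ih =>
    simp only [List.map_cons, List.pairwise_cons] at hs
    unfold Adm at hadm ih
    simp only [List.map_cons, List.pairwise_cons, List.mem_cons, forall_eq_or_imp] at hadm ih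
    obtain ⟨⟨g1, g2⟩, -, g4⟩ := hadm
    by_cases hc : B q.1 < B j
    · obtain ⟨Q1, Q2, rfl, h1, h2, h3⟩ := ih hs.2 ⟨g2, g4⟩
      refine ⟨q :: Q1, Q2, rfl, List.forall_mem_cons.2 ⟨hc, h1⟩, h2, ?_⟩
      have := ZStep.lo (A := A) (B := B) (C := AnyC) [] (negZ (Q1 ++ Q2)) (j, 0) (q.1, -q.2)
        trivial ⟨hc.le, not_lt.1 fun h => g1 ⟨h, hc⟩⟩
      refine Relation.ReflTransGen.head this ?_
      have h4 := h3.cons q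
      unfold ZReach at h4
      simpa using h4
    · refine ⟨[], q :: Q, rfl, by simp, ?_, .refl⟩
      simp only [List.mem_cons, forall_eq_or_imp]
      refine ⟨not_lt.1 hc, fun p hp => (not_lt.1 hc).trans ?_⟩
      exact hs.1 p.1 (List.mem_map_of_mem hp)

theorem Adm.ui {P T : List ℕ} {i j : ℕ} (hnd : (P ++ i :: j :: T).Nodup)
    (h : Adm A B (P ++ i :: j :: T)) (hA : A i < A j) (hB : B i < B j) :
    Adm (uiA A i j) B (P ++ i :: j :: T) := by
  have hij : i ≠ j := by rintro rfl; exact lt_irrefl _ hA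
  have hP : ∀ n ∈ P, uiA A i j n = A n := fun n hn => by
    have h3 := (List.nodup_append.1 hnd).2.2 n hn
    exact uiA_of_ne (h3 i (by simp)) (h3 j (by simp))
  have hT : ∀ n ∈ T, uiA A i j n = A n := fun n hn => by
    have h3 := (List.nodup_append.1 hnd).2.1
    simp only [List.nodup_cons, List.mem_cons, not_or] at h3
    refine uiA_of_ne ?_ ?_ <;> rintro rfl
    · exact h3.1.2 hn
    · exact h3.2.1 hn
  unfold Adm at *
  simp only [List.pairwise_append, List.pairwise_cons, List.mem_cons, forall_eq_or_imp] at h ⊢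
  obtain ⟨h1, ⟨⟨h2, h3⟩, h4, h5⟩, h6⟩ := h
  refine ⟨?_, ⟨⟨?_, ?_⟩, ?_, ?_⟩, ?_⟩
  · exact (List.Pairwise.and_mem.1 h1).imp fun {m n} hmn => by
      rw [hP m hmn.1, hP n hmn.2.1]; exact hmn.2.2
  · exact fun hc => absurd hc.2 (not_lt.2 hB.le)
  · intro n hn hc
    rw [hT n hn, uiA_left] at hc
    exact h4 n hn ⟨hc.1, hc.2.trans hB⟩
  · intro n hn hc
    rw [hT n hn, uiA_right hij] at hc
    exact h4 n hn ⟨hc.1.trans hA, hc.2⟩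
  · exact (List.Pairwise.and_mem.1 h5).imp fun {m n} hmn => by
      rw [hT m hmn.1, hT n hmn.2.1]; exact hmn.2.2
  · intro n hn
    obtain ⟨h7, h8, h9⟩ := h6 n hn
    rw [hP n hn, uiA_left, uiA_right hij]
    refine ⟨fun hc => h7 ⟨hA.trans hc.1, hc.2⟩, fun hc => h7 ⟨hc.1, hB.trans hc.2⟩, ?_⟩
    intro m hm
    rw [hT m hm]
    exact h9 m hm

/-- The bound after a union-intersection of which the second row is empty and deleted. -/
theorem ui_bound_empty {u : ℕ → ℚ} {O : List ℕ} {P T M : List (ℕ × ℚ)} {i j : ℕ}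
    {zi zj s κ τ : ℚ} (hO : O.Nodup) (hOs : O.Pairwise (Rk A B)) (hg : GenLip A B u O)
    (hr : ZReach A B AnyC (withVal u O) (P ++ (i, zi) :: (j, zj) :: T)) (hA : A i < A j)
    (hB : B i < B j) (hs : s = 1 ∨ s = -1) (hz : zi - zj = s * (A j - A i + (B j - B i)))
    (hτ : -1 ≤ τ) (hb : Bdd A B u κ τ O) (hne : ∀ n ∈ O, B n ≤ A n)
    (hj : A i = B j - 1) (hzj : zj + s * (A j - A i) = 0)
    (hM : ZReach (uiA A i j) B AnyC (P ++ (i, zi + s * (A j - A i)) :: negZ T) M)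
    (hMs : (labs M).Pairwise fun m n => B m ≤ B n) :
    ∀ p ∈ M, |p.2 - κ| ≤ uiA A i j p.1 + 1 + τ * B p.1 ∨
      (B j ≤ B p.1 ∧ |-p.2 - κ| ≤ uiA A i j p.1 + 1 + τ * B p.1) := by
  have hij : i ≠ j := by rintro rfl; exact lt_irrefl _ hA
  have hnegneg : ∀ Z, negZ (negZ Z) = Z := fun Z => by simp [negZ, Function.comp_def]
  have hperm := ZReach.perm hr
  rw [labs_withVal] at hperm
  have hnd := hperm.nodup_iff.1 hO
  have hadm := ZReach.adm hr (by rw [labs_withVal]; exact adm_of_sorted hOs)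
  rw [labs_append] at hnd hadm
  have hadm' := hadm.ui hnd hA hB
  have hadm2 : Adm (uiA A i j) B
      (labs ((P ++ [(i, zi + s * (A j - A i))]) ++ (j, 0) :: negZ (negZ T))) := by
    rw [hnegneg]
    simpa [labs] using hadm'
  have hjn : ∀ n ∈ labs P ++ i :: labs T, n ≠ j := by
    intro n hn hc
    subst hc
    simp only [List.map_cons, List.nodup_append, List.nodup_cons, List.mem_cons, not_or] at hnd
    simp only [List.mem_append, List.mem_cons] at hn
    rcases hn with hn | hn | hn
    · exact hnd.2.2 n hn n (by simp) rfl
    · exact hij hn.symm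
    · exact hnd.2.1.2.1 hn
  have hne' : ∀ n ∈ labs ((P ++ [(i, zi + s * (A j - A i))]) ++ negZ T),
      B n ≤ uiA A i j n := by
    intro n hn
    have hn1 : n ∈ labs P ++ i :: labs T := by
      rw [labs_append, labs_append, labs_negZ] at hn
      simpa using hn
    have h1 := hjn n hn1
    have h2 : B n ≤ A n := hne n (hperm.mem_iff.2 (by
      rw [labs_append]
      simp only [List.mem_append, List.mem_cons, List.map_cons] at hn1 ⊢
      tauto))
    by_cases h3 : n = i
    · subst h3
      rw [uiA_left]
      exact h2.trans hA.le
    · rwa [uiA_of_ne h3 h1]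
  obtain ⟨P1, Q1, rfl, h1⟩ := ZReach.lift_empty (by rw [uiA_right hij, hj]) hadm2 hne'
    (by simpa using hM)
  rw [hnegneg] at h1 hadm2
  rw [labs_append, List.pairwise_append] at hMs
  have hadm3 := h1.adm hadm2
  rw [labs_append] at hadm3
  have hadm4 := List.pairwise_append.1 hadm3
  obtain ⟨Q2, Q3, rfl, h2, h3, h4⟩ := exists_move_empty (A := uiA A i j) (j := j) Q1 hMs.2.1
    (by simpa only [Adm, List.map_cons, labs_negZ] using hadm4.2.1)
  have hreach : ZReach (uiA A i j) B AnyC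
      (P ++ (i, zi + s * (A j - A i)) :: (j, zj + s * (A j - A i)) :: T)
      (P1 ++ (Q2 ++ (j, 0) :: negZ Q3)) := by
    rw [hzj]
    have h5 := h4.context P1 []
    unfold ZReach at h1 h5 ⊢
    refine Relation.ReflTransGen.trans (by simpa using h1) (by simpa using h5)
  have hPj : ∀ n ∈ labs P1, B n ≤ B j := by
    intro n hn
    have h5 := hadm4.2.2 n hn j (by simp)
    have h6 : B n ≤ uiA A i j n := by
      refine hne' n ?_
      rw [List.append_assoc]
      refine hM.perm.mem_iff.2 ?_
      rw [labs_append]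
      exact List.mem_append_left _ hn
    by_contra hc
    rw [uiA_right hij, hj] at h5
    exact h5 ⟨by linarith [not_le.1 hc], not_le.1 hc⟩
  have hMs2 := hMs.2.1
  rw [labs_append, List.pairwise_append] at hMs2
  have hsorted : (labs (P1 ++ (Q2 ++ (j, 0) :: negZ Q3))).Pairwise fun m n => B m ≤ B n := by
    rw [labs_append, labs_append]
    simp only [List.map_cons, labs_negZ, List.pairwise_append, List.pairwise_cons]
    have h3' : ∀ n ∈ labs Q3, B j ≤ B n := by
      intro n hn
      obtain ⟨p, hp, rfl⟩ := List.mem_map.1 hn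
      exact h3 p hp
    refine ⟨hMs.1, ⟨hMs2.1, ⟨h3', hMs2.2.1⟩, ?_⟩, ?_⟩
    · intro n hn m hm
      obtain ⟨p, hp, rfl⟩ := List.mem_map.1 hn
      rcases List.mem_cons.1 hm with rfl | hm
      · exact (h2 p hp).le
      · exact hMs2.2.2 _ hn m hm
    · intro n hn m hm
      simp only [List.mem_append, List.mem_cons] at hm
      rcases hm with hm | rfl | hm
      · exact hMs.2.2 n hn m (by rw [labs_append]; exact List.mem_append_left _ hm)
      · exact hPj n hn
      · exact hMs.2.2 n hn m (by rw [labs_append]; exact List.mem_append_right _ hm)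
  have hfin := ui_bound hO hOs hg hr hA hB hs hz hτ hb hreach hsorted
  intro p hp
  simp only [List.mem_append] at hp
  rcases hp with hp | hp | hp
  · exact .inl (hfin p (by simp [hp]))
  · exact .inl (hfin p (by simp [hp]))
  · refine .inr ⟨h3 p hp, ?_⟩
    exact hfin (p.1, -p.2) (by
      simp only [List.mem_append, List.mem_cons, negZ, List.mem_map]
      exact .inr (.inr (.inr ⟨p, hp, rfl⟩)))

end DeletedRow

section Cores

open scoped Classical

variable {A B : ℕ → ℚ}

/-- In every reordering the values are bounded by the lengths of the segments. -/
theorem GenLip.bound_reach {u : ℕ → ℚ} {O : List ℕ} {Z : List (ℕ × ℚ)} (hg : GenLip A B u O)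
    (hO : O.Nodup) (hOs : O.Pairwise (Rk A B)) (hb : Bdd A B u 0 (-1) O)
    (hr : ZReach A B AnyC (withVal u O) Z) : ∀ p ∈ Z, |p.2| ≤ A p.1 - B p.1 + 1 := by
  intro p hp
  have he : EqSeg A B u O := eqSeg_of_tie fun m hm n hn hmn => hg.tie hOs hm hn hmn
  have heE : EqSeg A B u (labs (withVal u O)) := by rwa [labs_withVal]
  have h := (unwinds_withVal hO he hOs).reach heE hr
  have heZ := heE.perm (ZReach.perm hr)
  have hadmZ := ZReach.adm hr (by rw [labs_withVal]; exact adm_of_sorted hOs)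
  have hpZ := ZReach.perm hr
  rw [labs_withVal] at hpZ
  obtain ⟨S, T, rfl⟩ := List.append_of_mem hp
  rw [labs_append] at hadmZ
  have hadmS := List.pairwise_append.1 hadmZ
  obtain ⟨S', hS, hS'⟩ := Adm.exists_sort (Z := S) hadmS.1
  have h' := h.reach heZ (hS.append (p :: T))
  have hperm := hS.perm
  have hmem : ∀ t ∈ labs S', t ∈ labs (S ++ p :: T) := fun t ht => by
    rw [labs_append]; exact List.mem_append_left _ (hperm.mem_iff.2 ht)
  have hSe := h'.prefix.eq_withVal
    (fun m hm n hn => heZ m (hmem m hm) n (hmem n hn)) hS'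
  have hnd := h'.1
  rw [labs_append, List.nodup_append] at hnd
  have hpS : p.1 ∉ labs S' := fun hc => hnd.2.2 p.1 hc p.1 (by simp) rfl
  have e := h'.2 p.1 (by simp)
  rw [hSe, unw_withVal u _ _ hpS] at e
  simp only [unw, if_true] at e
  have hmem' : ∀ t ∈ labs S', t ∈ O := fun t ht => hpZ.mem_iff.2 (hmem t ht)
  rw [sorted_sublist_eq_filter hOs hO hS' hnd.1 hmem', refl_filter] at e
  set K : ℕ → Prop := fun t => t ∈ labs S' ∧ Sub A B t p.1 with hK
  have hpO : p.1 ∈ O := hpZ.mem_iff.2 (by simp)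
  obtain ⟨P0, Q0, rfl⟩ := List.append_of_mem hpO
  have hs0 := List.pairwise_append.1 hOs
  have hs1 := List.pairwise_cons.1 hs0.2.1
  have hpK : ¬ K p.1 := fun hc => hpS hc.1
  rw [refl_append, refl_eq_iff] at e
  swap
  · intro t ht hk
    have hr := hs0.2.2 t ht p.1 (by simp)
    refine he t (by simp [ht]) p.1 (by simp) hk.2 ⟨hr.le, ?_⟩
    rcases hr with hr | ⟨_, hr | ⟨hr, _⟩⟩
    · exact absurd hk.2.1 (not_le.2 hr)
    · exact hr.le
    · exact hr.ge
  simp only [refl, hpK, if_false] at e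
  have hbp := hb p.1 hpO
  by_cases hex : ∃ s ∈ Q0, K s
  · obtain ⟨S1, y, S2, rfl, hy, hS2⟩ := exists_last (p := K) Q0 hex
    rw [refl_append] at e
    simp only [refl, hy, if_true] at e
    rw [refl_of_not u hS2] at e
    have hcmp : ∀ t ∈ S1, ¬ K t → ∀ s, K s → Rk A B t s → A s ≤ A t := by
      intro t ht hk s hs hts
      have hsS := hs.1
      by_cases htS : t ∈ labs S'
      · have h1 : ¬ A t ≤ A p.1 := fun hc => hk ⟨htS, (hs1.1 t (by simp [ht])).le, hc⟩
        exact hs.2.2.trans (not_le.1 h1).le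
      · rcases hts with h1 | ⟨h1, h2 | ⟨h2, _⟩⟩
        · have htp : t ≠ p.1 := by
            rintro rfl
            have := (List.nodup_append.1 hO).2.1
            simp only [List.nodup_cons, List.mem_append] at this
            exact this.1 (.inl ht)
          have htZ : t ∈ labs S ++ labs (p :: T) := by
            have := hpZ.mem_iff.1 (show t ∈ P0 ++ p.1 :: (S1 ++ y :: S2) by simp [ht])
            rwa [labs_append] at this
          have htT : t ∈ labs (p :: T) := by
            rcases List.mem_append.1 htZ with h3 | h3
            · exact absurd (hperm.mem_iff.1 h3) htS
            · exact h3
          have := hadmS.2.2 s (hperm.mem_iff.2 hsS) t htT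
          by_contra hc
          exact this ⟨not_le.1 hc, h1⟩
        · exact h2.le
        · exact h2.ge
    have hs2 := List.pairwise_append.1 hs1.2
    have key := hg K P0 p.1 S1 y S2 rfl (fun s _ hk => hk.2.2)
      (fun s hs hk => hcmp s hs hk y hy (hs2.2.2 s hs y (by simp)))
      ((List.Pairwise.and_mem.1 hs2.1).imp fun {m n} hmn hk hk' =>
        hcmp m hmn.1 hk n hk' hmn.2.2)
    rw [← e, abs_refl_sub, sdist_comm, sdist] at key
    have hby := hb y (by simp)
    have h1 := hy.2.1
    have h2 := hy.2.2
    rw [abs_of_nonpos (by linarith : A y - A p.1 ≤ 0),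
      abs_of_nonneg (by linarith : 0 ≤ B y - B p.1)] at key
    rw [abs_le] at key hby ⊢
    constructor <;> linarith
  · rw [refl_of_not u (fun s hs hk => hex ⟨s, hs, hk⟩)] at e
    rw [e]
    rw [sub_zero] at hbp
    linarith

/-- Reachability from a sorted list satisfying the generalized Lipschitz conditions and
inheriting all bounds. -/
def Core (A B : ℕ → ℚ) (Z : List (ℕ × ℚ)) : Prop :=
  ∃ u O, O.Nodup ∧ O.Pairwise (Rk A B) ∧ GenLip A B u O ∧
    ZReach A B AnyC (withVal u O) Z ∧
    ∀ κ τ, (∀ p ∈ Z, |p.2 - κ| ≤ A p.1 + 1 + τ * B p.1) → Bdd A B u κ τ O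

theorem exists_withVal {Z : List (ℕ × ℚ)} (h : (labs Z).Nodup) :
    ∃ u, Z = withVal u (labs Z) := by
  induction Z with
  | nil => exact ⟨fun _ => 0, rfl⟩
  | cons p Z ih =>
    simp only [List.map_cons, List.nodup_cons] at h
    obtain ⟨u, hu⟩ := ih h.2
    refine ⟨fun n => if n = p.1 then p.2 else u n, ?_⟩
    simp only [withVal, List.map_cons, if_true, List.cons.injEq, true_and]
    conv_lhs => rw [hu]
    rw [withVal]
    refine List.map_congr_left fun n hn => ?_
    rw [if_neg]
    rintro rfl
    exact h.1 hn

theorem LipAll.bdd_tie {Z Z' : List (ℕ × ℚ)} (h : LipAll A B Z)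
    (hr : ZReach A B (fun m n => B m = B n) Z Z') {κ τ : ℚ}
    (hb : ∀ p ∈ Z, |p.2 - κ| ≤ A p.1 + 1 + τ * B p.1) :
    ∀ p ∈ Z', |p.2 - κ| ≤ A p.1 + 1 + τ * B p.1 := by
  induction hr with
  | refl => exact hb
  | tail h1 h2 ih =>
    have h3 := h _ (ZReach.mono (fun _ _ _ => trivial) h1)
    cases h2 with
    | lo S T p q hC hs =>
      have h4 := h3 S p q T rfl
      have hp := ih p (by simp)
      have hq := ih q (by simp)
      intro x hx
      simp only [List.mem_append, List.mem_cons] at hx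
      rcases hx with hx | rfl | hx | hx
      · exact ih x (by simp [hx])
      · rw [sdist, hC, sub_self, abs_zero, abs_of_nonpos (sub_nonpos.2 hs.2)] at h4
        rw [hC] at hp
        rw [abs_le] at h4 hp ⊢
        simp only
        constructor <;> linarith
      · exact ih x (by simp [hx])
      · exact ih x (by simp [hx])
    | hi S T p q hC hs _ =>
      have h4 := h3 S p q T rfl
      have hp := ih p (by simp)
      have hq := ih q (by simp)
      intro x hx
      simp only [List.mem_append, List.mem_cons] at hx
      rcases hx with hx | hx | rfl | hx
      · exact ih x (by simp [hx])
      · exact ih x (by simp [hx])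
      · rw [sdist, hC, sub_self, abs_zero, abs_of_nonneg (sub_nonneg.2 hs.2)] at h4
        rw [← hC] at hq
        rw [abs_le] at h4 hq ⊢
        simp only
        constructor <;> linarith
      · exact ih x (by simp [hx])

theorem sub_or_sub_of_tie (m n : ℕ) (h : B m = B n) : Sub A B m n ∨ Sub A B n m := by
  rcases le_total (A m) (A n) with h' | h'
  · exact .inl ⟨h.ge, h'⟩
  · exact .inr ⟨h.le, h'⟩

theorem LipAll.core {Z : List (ℕ × ℚ)} (h : LipAll A B Z) (hn : (labs Z).Nodup)
    (hs : (labs Z).Pairwise fun m n => B m ≤ B n) : Core A B Z := by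
  obtain ⟨Z', h1, h2⟩ := exists_sort (A := A) (B := B) (C := fun m n => B m = B n)
    (r := Rk A B) Rk.total Rk.trans sub_or_sub_of_tie Z
    (hs.imp fun {m n} hmn hr => by
      by_contra hc
      exact hr (.inl (lt_of_le_of_ne hmn hc)))
  have hn' := h1.perm.nodup_iff.1 hn
  obtain ⟨u, hu⟩ := exists_withVal hn'
  have hany := ZReach.mono (C' := AnyC) (fun _ _ _ => trivial) h1
  have h3 := h.reach hany
  have hback := h.reach_symm hany (fun _ _ h => h)
  refine ⟨u, labs Z', hn', h2, ?_, ?_, ?_⟩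
  · rw [hu] at h3
    exact h3.genLip (h2.imp Rk.le)
  · rwa [← hu]
  · intro κ τ hb n hm
    have := h.bdd_tie h1 hb
    rw [hu] at this
    exact this (n, u n) (List.mem_map_of_mem (f := fun n => (n, u n)) hm)

/-- The dual of a list of values. -/
def dualZ (κ : ℚ) (Z : List (ℕ × ℚ)) : List (ℕ × ℚ) :=
  (Z.map fun p => (p.1, κ - p.2)).reverse

theorem dualZ_withVal (κ : ℚ) (u : ℕ → ℚ) (O : List ℕ) :
    dualZ κ (withVal u O) = withVal (fun n => κ - u n) O.reverse := by
  simp [dualZ, withVal, Function.comp_def]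

theorem ZStep.dual {Z Z' : List (ℕ × ℚ)} (hs : ZStep A B (fun m n => B m = B n) Z Z')
    (h : Lip A B Z) (κ : ℚ) : ZStep A (fun n => - B n) AnyC (dualZ κ Z) (dualZ κ Z') := by
  cases hs with
  | lo S T p q hC h1 =>
    have hs' : Sub A (fun n => - B n) p.1 q.1 := ⟨by simp [hC], h1.2⟩
    by_cases h2 : Sub A (fun n => - B n) q.1 p.1
    · have e := h.adjacent_eq S p q T rfl h1 ⟨hC.le, h2.2⟩
      have := ZStep.lo (C := AnyC) (dualZ κ T) (dualZ κ S) (q.1, κ - q.2) (p.1, κ - p.2)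
        trivial h2
      convert this using 1
      · simp [dualZ]
      · simp [dualZ, e, two_mul]
    · have := ZStep.hi (C := AnyC) (dualZ κ T) (dualZ κ S) (q.1, κ - q.2) (p.1, κ - p.2)
        trivial hs' h2
      convert this using 1
      · simp [dualZ]
      · simp [dualZ]
        ring
  | hi S T p q hC h1 h2 =>
    have hs' : Sub A (fun n => - B n) q.1 p.1 := ⟨by simp [hC], h1.2⟩
    have := ZStep.lo (C := AnyC) (dualZ κ T) (dualZ κ S) (q.1, κ - q.2) (p.1, κ - p.2)
      trivial hs'
    convert this using 1
    · simp [dualZ]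
    · simp [dualZ]
      ring

theorem LipAll.reach_dual {Z Z' : List (ℕ × ℚ)} (h : LipAll A B Z)
    (hr : ZReach A B (fun m n => B m = B n) Z Z') (κ : ℚ) :
    ZReach A (fun n => - B n) AnyC (dualZ κ Z) (dualZ κ Z') := by
  induction hr with
  | refl => exact .refl
  | tail g1 g2 ih =>
    exact Relation.ReflTransGen.tail ih
      (g2.dual (h _ (ZReach.mono (fun _ _ _ => trivial) g1)) κ)

theorem LipAll.core_dual {Z : List (ℕ × ℚ)} (h : LipAll A B Z) (hn : (labs Z).Nodup)
    (hs : (labs Z).Pairwise fun m n => B m ≤ B n) (κ₀ : ℚ) :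
    Core A (fun n => - B n) (dualZ κ₀ Z) := by
  obtain ⟨Z', h1, h2⟩ := exists_sort (A := A) (B := B) (C := fun m n => B m = B n)
    (r := fun m n => Rk A (fun n => - B n) n m) (fun m n => Rk.total n m)
    (fun m n k h h' => Rk.trans k n m h' h) sub_or_sub_of_tie Z
    (hs.imp fun {m n} hmn hr => by
      by_contra hc
      exact hr (.inl (neg_lt_neg (lt_of_le_of_ne hmn hc))))
  have hn' := h1.perm.nodup_iff.1 hn
  obtain ⟨u, hu⟩ := exists_withVal hn'
  have hany := ZReach.mono (C' := AnyC) (fun _ _ _ => trivial) h1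
  have h3 := h.reach hany
  have hback := h.reach_symm h1 (fun _ _ h => h.symm)
  have hsrt := List.pairwise_reverse.2 h2
  refine ⟨fun n => κ₀ - u n, (labs Z').reverse, List.nodup_reverse.2 hn', hsrt, ?_, ?_, ?_⟩
  · have h4 := h3
    rw [hu] at h4
    have h5 := (h4.genLip (h2.imp fun hr => neg_le_neg_iff.1 hr.le)).weak.dual κ₀
    exact h5.genLip (hsrt.imp fun hr => hr.le)
  · rw [← dualZ_withVal, ← hu]
    exact h3.reach_dual hback κ₀
  · intro κ τ hb n hm
    have := h.bdd_tie h1 (κ := κ₀ - κ) (τ := -τ) (fun p hp => by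
      have := hb (p.1, κ₀ - p.2) (List.mem_reverse.2
        (List.mem_map_of_mem (f := fun p : ℕ × ℚ => (p.1, κ₀ - p.2)) hp))
      simp only at this
      rw [abs_sub_comm, show κ₀ - κ - p.2 = κ₀ - p.2 - κ by ring]
      linarith)
    rw [hu] at this
    have := this (n, u n)
      (List.mem_map_of_mem (f := fun n => (n, u n)) (List.mem_reverse.1 hm))
    simp only at this ⊢
    rw [show κ₀ - u n - κ = -(u n - (κ₀ - κ)) by ring, abs_neg]
    linarith

end Cores

section RowLayer

/-- The sign `(-1)^n`. -/
def sg (n : ℤ) : ℤ := if n % 2 = 0 then 1 else -1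

theorem m1pow_intCast (n : ℤ) : m1pow (n : ℚ) = sg n := by
  simp [m1pow, sg]

theorem m1pow_of_eq {x : ℚ} {n : ℤ} (h : x = n) : m1pow x = sg n := by
  rw [h, m1pow_intCast]

theorem sg_eq_or (n : ℤ) : sg n = 1 ∨ sg n = -1 := by
  unfold sg; split_ifs <;> simp

theorem m1pow_eq_or (x : ℚ) : m1pow x = 1 ∨ m1pow x = -1 := by
  unfold m1pow; split_ifs <;> simp

theorem sg_add (m n : ℤ) : sg (m + n) = sg m * sg n := by
  unfold sg; split_ifs <;> omega

theorem sg_mul_self (n : ℤ) : sg n * sg n = 1 := by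
  rcases sg_eq_or n with h | h <;> simp [h]

theorem sg_add_one (n : ℤ) : sg (n + 1) = - sg n := by
  unfold sg; split_ifs <;> omega

/-- The sign attached to a signed length. -/
def lenSign (y : ℤ) : ℤ := if y % 4 = 0 ∨ y % 4 = 1 then 1 else -1

/-- The signed length `η (b - 2 * l)` of a row. -/
def Row.len (r : Row) : ℤ := r.eta * ⌊r.b - 2 * r.l⌋

/-- A row over the lattice `c + ℤ` satisfying all conditions except `0 ≤ l`. -/
structure Row.GoodAt (c : ℚ) (r : Row) (m n k : ℤ) : Prop where
  hA : r.A = c + m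
  hB : r.B = c + n
  hl : r.l = k
  eta : r.eta = 1 ∨ r.eta = -1
  le : n ≤ m
  pos : 0 ≤ r.A + r.B
  two_l : 2 * k ≤ m - n + 1

/-- The existential form of `Row.GoodAt`. -/
def Row.Good (c : ℚ) (r : Row) : Prop := ∃ m n k, r.GoodAt c m n k

variable {c : ℚ} {r s : Row}

namespace Row.GoodAt

variable {m n k : ℤ}

theorem b_eq (h : r.GoodAt c m n k) : r.b = ((m - n + 1 : ℤ) : ℚ) := by
  rw [Row.b, h.hA, h.hB]; push_cast; ring

theorem sub_eq (h : r.GoodAt c m n k) : r.A - r.B = ((m - n : ℤ) : ℚ) := by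
  rw [h.hA, h.hB]; push_cast; ring

theorem len_eq (h : r.GoodAt c m n k) : r.len = r.eta * (m - n + 1 - 2 * k) := by
  rw [Row.len, h.b_eq, h.hl]
  congr 1
  rw [Int.floor_eq_iff]
  push_cast
  constructor <;> linarith

theorem m1pow_eq (h : r.GoodAt c m n k) : m1pow (r.A - r.B) = sg (m - n) :=
  m1pow_of_eq h.sub_eq

theorem rowSign_eq (h : r.GoodAt c m n k) : rowSign r = lenSign r.len := by
  have h1 : ⌊r.b / 2⌋ = (m - n + 1) / 2 := by
    rw [h.b_eq]
    have := Rat.floor_intCast_div_natCast (m - n + 1) 2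
    push_cast at this ⊢
    exact this
  have h2 : ⌊r.l⌋ = k := by rw [h.hl]; simp
  have h3 : ⌊r.b⌋ = m - n + 1 := by rw [h.b_eq]; exact Int.floor_intCast _
  rw [rowSign, h1, h2, h3, h.len_eq]
  have h4 := h.le
  rcases h.eta with e | e <;> rw [e]
  · rw [one_pow]
    unfold lenSign
    split_ifs <;> omega
  · obtain ⟨t, ht⟩ : ∃ t : ℕ, m - n + 1 = t := ⟨(m - n + 1).toNat, by omega⟩
    rw [ht, Int.toNat_natCast]
    rcases Nat.even_or_odd t with h5 | h5
    · rw [h5.neg_one_pow]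
      obtain ⟨w, rfl⟩ := h5
      unfold lenSign
      split_ifs <;> omega
    · rw [h5.neg_one_pow]
      obtain ⟨w, rfl⟩ := h5
      unfold lenSign
      split_ifs <;> omega

end Row.GoodAt

theorem rexPair_seg : (rexPair r s).1.A = s.A ∧ (rexPair r s).1.B = s.B ∧
    (rexPair r s).2.A = r.A ∧ (rexPair r s).2.B = r.B := by
  unfold rexPair
  split_ifs <;> simp

theorem reflect_row {m n k d μ ε : ℤ} (h : r.GoodAt c m n k) (hd : 0 ≤ d)
    (hμ : μ = 1 ∨ μ = -1) (hε : ε = 1 ∨ ε = -1) {q : Row}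
    (hq : q = if ε = 1 then
        if r.b - 2 * r.l < 2 * (d : ℚ) then ⟨r.A, r.B, r.b - (r.l + d), μ * r.eta⟩
        else ⟨r.A, r.B, r.l + d, -μ * r.eta⟩
      else ⟨r.A, r.B, r.l - d, -μ * r.eta⟩) :
    q.Good c ∧ q.len = μ * r.eta * (2 * ε * d - (m - n + 1 - 2 * k)) := by
  have key : ∀ (k₁ η₁ : ℤ), (η₁ = 1 ∨ η₁ = -1) → 2 * k₁ ≤ m - n + 1 →
      (⟨r.A, r.B, k₁, η₁⟩ : Row).GoodAt c m n k₁ := fun k₁ η₁ h1 h2 =>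
    ⟨h.hA, h.hB, rfl, h1, h.le, h.pos, h2⟩
  have h1 : μ * r.eta = 1 ∨ μ * r.eta = -1 := by
    rcases hμ with e | e <;> rcases h.eta with e' | e' <;> simp [e, e']
  have h2 : -μ * r.eta = 1 ∨ -μ * r.eta = -1 := by
    rcases hμ with e | e <;> rcases h.eta with e' | e' <;> simp [e, e']
  have hc : r.b - 2 * r.l < 2 * (d : ℚ) ↔ (m - n + 1) - 2 * k < 2 * d := by
    rw [h.b_eq, h.hl]; norm_cast
  have ht := h.two_l
  have c1 : r.b - (r.l + d) = ((m - n + 1 - (k + d) : ℤ) : ℚ) := by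
    rw [h.b_eq, h.hl]; push_cast; ring
  have c2 : r.l + d = ((k + d : ℤ) : ℚ) := by rw [h.hl]; push_cast; ring
  have c3 : r.l - d = ((k - d : ℤ) : ℚ) := by rw [h.hl]; push_cast; ring
  rw [if_congr hc rfl rfl, c1, c2, c3] at hq
  rcases hε with rfl | rfl
  · rw [if_pos rfl] at hq
    split_ifs at hq with h3
    · have g := key (m - n + 1 - (k + d)) _ h1 (by omega)
      rw [hq]
      exact ⟨⟨_, _, _, g⟩, by rw [g.len_eq]; ring⟩
    · have g := key (k + d) _ h2 (by omega)
      rw [hq]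
      exact ⟨⟨_, _, _, g⟩, by rw [g.len_eq]; ring⟩
  · rw [if_neg (by decide)] at hq
    have g := key (k - d) _ h2 (by omega)
    rw [hq]
    exact ⟨⟨_, _, _, g⟩, by rw [g.len_eq]; ring⟩

theorem Row.GoodAt.scale {m n k μ : ℤ} (h : r.GoodAt c m n k) (hμ : μ = 1 ∨ μ = -1) :
    (⟨r.A, r.B, r.l, μ * r.eta⟩ : Row).Good c ∧
      (⟨r.A, r.B, r.l, μ * r.eta⟩ : Row).len = μ * r.len := by
  refine ⟨⟨m, n, k, h.hA, h.hB, h.hl, ?_, h.le, h.pos, h.two_l⟩, ?_⟩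
  · rcases hμ with e | e <;> rcases h.eta with e' | e' <;> simp [e, e']
  · simp [Row.len, Row.b, mul_assoc]

theorem mul_mul_sign {x y z : ℤ} (hx : x = 1 ∨ x = -1) (hy : y = 1 ∨ y = -1)
    (hz : z = 1 ∨ z = -1) : x * y * z = 1 ∨ x * y * z = -1 := by
  rcases hx with rfl | rfl <;> rcases hy with rfl | rfl <;> rcases hz with rfl | rfl <;> simp

theorem Row.GoodAt.len_sub {m n k : ℤ} (h : r.GoodAt c m n k) :
    r.b - 2 * r.l = ((m - n + 1 - 2 * k : ℤ) : ℚ) := by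
  rw [h.b_eq, h.hl]; push_cast; ring

theorem Row.GoodAt.m1pow_succ {m n k : ℤ} (h : r.GoodAt c m n k) :
    m1pow (r.A - r.B + 1) = - sg (m - n) := by
  rw [m1pow_of_eq (n := m - n + 1) (by rw [h.sub_eq]; push_cast; ring), sg_add_one]

theorem rexPair_lo (hr : r.Good c) (hs : s.Good c) (h : r.subseg s) :
    (rexPair r s).1.Good c ∧ (rexPair r s).2.Good c ∧
    (rexPair r s).1.len = 2 * r.len - m1pow (r.A - r.B) * s.len ∧
    (rexPair r s).2.len = m1pow (s.A - s.B) * r.len := by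
  obtain ⟨m, n, k, hr⟩ := hr
  obtain ⟨m', n', k', hs⟩ := hs
  have h1 := reflect_row hs (d := m - n + 1 - 2 * k) (by linarith [hr.two_l])
    (sg_eq_or (m - n)) (mul_mul_sign (sg_eq_or (m - n)) hr.eta hs.eta) (q := (rexPair r s).1) (by
      unfold rexPair
      rw [if_pos h, hr.m1pow_eq, hr.m1pow_succ, hr.len_sub])
  have h2 := hr.scale (sg_eq_or (m' - n'))
  have e : (rexPair r s).2 = ⟨r.A, r.B, r.l, sg (m' - n') * r.eta⟩ := by
    unfold rexPair
    rw [if_pos h, hs.m1pow_eq]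
  rw [e, hr.m1pow_eq, hs.m1pow_eq]
  refine ⟨h1.1, h2.1, ?_, h2.2⟩
  rw [h1.2, hr.len_eq, hs.len_eq]
  rcases sg_eq_or (m - n) with e | e <;> rcases hs.eta with e' | e' <;> rw [e, e'] <;> ring

theorem rexPair_hi (hr : r.Good c) (hs : s.Good c) (h : ¬ r.subseg s) :
    (rexPair r s).1.Good c ∧ (rexPair r s).2.Good c ∧
    (rexPair r s).1.len = m1pow (r.A - r.B) * s.len ∧
    (rexPair r s).2.len = m1pow (s.A - s.B) * (2 * (m1pow (r.A - r.B) * s.len) - r.len) := by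
  obtain ⟨m, n, k, hr⟩ := hr
  obtain ⟨m', n', k', hs⟩ := hs
  have h1 := reflect_row hr (d := m' - n' + 1 - 2 * k') (by linarith [hs.two_l])
    (sg_eq_or (m' - n')) (mul_mul_sign (sg_eq_or (m - n)) hr.eta hs.eta)
    (q := (rexPair r s).2) (by
      unfold rexPair
      rw [if_neg h, hr.m1pow_eq, hs.m1pow_eq, hs.m1pow_succ, hs.len_sub])
  have h2 := hs.scale (sg_eq_or (m - n))
  have e : (rexPair r s).1 = ⟨s.A, s.B, s.l, sg (m - n) * s.eta⟩ := by
    unfold rexPair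
    rw [if_neg h, hr.m1pow_eq]
  rw [e, hr.m1pow_eq, hs.m1pow_eq]
  refine ⟨h2.1, h1.1, h2.2, ?_⟩
  rw [h1.2, hr.len_eq, hs.len_eq]
  rcases hr.eta with e | e <;> rw [e] <;> ring

theorem Row.Good.rowSign_eq (h : r.Good c) : rowSign r = lenSign r.len := by
  obtain ⟨m, n, k, h⟩ := h
  exact h.rowSign_eq

theorem Row.Good.m1pow_eq (h : r.Good c) : m1pow (r.A - r.B) = - sg r.len := by
  obtain ⟨m, n, k, h⟩ := h
  rw [h.m1pow_eq, h.len_eq]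
  rcases h.eta with e | e <;> rw [e] <;> unfold sg <;> split_ifs <;> omega

theorem lenSign_exchange (x y : ℤ) :
    lenSign (2 * x - -sg x * y) * lenSign (-sg y * x) = lenSign x * lenSign y := by
  unfold lenSign sg
  split_ifs <;> omega

theorem lenSign_exchange' (x y : ℤ) :
    lenSign (-sg x * y) * lenSign (-sg y * (2 * (-sg x * y) - x)) = lenSign x * lenSign y := by
  unfold lenSign sg
  split_ifs <;> omega

theorem rexPair_rowSign (hr : r.Good c) (hs : s.Good c) :
    rowSign (rexPair r s).1 * rowSign (rexPair r s).2 = rowSign r * rowSign s := by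
  by_cases h : r.subseg s
  · obtain ⟨g1, g2, l1, l2⟩ := rexPair_lo hr hs h
    rw [g1.rowSign_eq, g2.rowSign_eq, hr.rowSign_eq, hs.rowSign_eq, l1, l2, hr.m1pow_eq,
      hs.m1pow_eq, lenSign_exchange]
  · obtain ⟨g1, g2, l1, l2⟩ := rexPair_hi hr hs h
    rw [g1.rowSign_eq, g2.rowSign_eq, hr.rowSign_eq, hs.rowSign_eq, l1, l2, hr.m1pow_eq,
      hs.m1pow_eq, lenSign_exchange']

end RowLayer

section LabeledRows

variable {A B : ℕ → ℚ} {c : ℚ}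

/-- The segments of `L` are given by `A` and `B`. -/
def Fits (A B : ℕ → ℚ) (L : List LRow) : Prop := ∀ p ∈ L, p.2.A = A p.1 ∧ p.2.B = B p.1

/-- All rows are good. -/
def AllGood (c : ℚ) (L : List LRow) : Prop := ∀ p ∈ L, p.2.Good c

/-- The product of the signs `(-1)^{A - B}`. -/
def parity (L : List LRow) : ℤ := (L.map fun p => m1pow (p.2.A - p.2.B)).prod

/-- The signed lengths of the rows, normalized by the signs of the preceding rows. -/
def toZ : ℤ → List LRow → List (ℕ × ℚ)
  | _, [] => []
  | g, p :: L => (p.1, ((g * p.2.len : ℤ) : ℚ)) :: toZ (g * m1pow (p.2.A - p.2.B)) L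

theorem m1pow_mul_self (x : ℚ) : m1pow x * m1pow x = 1 := by
  rcases m1pow_eq_or x with h | h <;> simp [h]

theorem parity_cons (p : LRow) (L : List LRow) :
    parity (p :: L) = m1pow (p.2.A - p.2.B) * parity L := by simp [parity]

theorem toZ_append (g : ℤ) (S T : List LRow) :
    toZ g (S ++ T) = toZ g S ++ toZ (g * parity S) T := by
  induction S generalizing g with
  | nil => simp [toZ, parity]
  | cons p S ih => simp [toZ, ih, parity_cons, mul_assoc]

theorem toZ_neg (g : ℤ) (L : List LRow) : toZ (-g) L = negZ (toZ g L) := by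
  induction L generalizing g with
  | nil => rfl
  | cons p L ih =>
    have : toZ (-g) (p :: L) = (p.1, ((-g * p.2.len : ℤ) : ℚ)) ::
      toZ (-(g * m1pow (p.2.A - p.2.B))) L := by rw [toZ, neg_mul g (m1pow _)]
    rw [this, ih]
    simp [toZ, negZ]

@[simp] theorem labs_toZ (g : ℤ) (L : List LRow) : labs (toZ g L) = L.map Prod.fst := by
  induction L generalizing g with
  | nil => rfl
  | cons p L ih => simpa [toZ] using ih _

theorem toZ_eq_append {g : ℤ} {L : List LRow} {X Y : List (ℕ × ℚ)} (h : toZ g L = X ++ Y) :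
    ∃ S T, L = S ++ T ∧ toZ g S = X ∧ toZ (g * parity S) T = Y := by
  induction X generalizing g L with
  | nil => exact ⟨[], L, rfl, rfl, by simpa [parity] using h⟩
  | cons x X ih =>
    cases L with
    | nil => simp [toZ] at h
    | cons p L =>
      simp only [toZ, List.cons_append, List.cons.injEq] at h
      obtain ⟨S, T, rfl, h1, h2⟩ := ih h.2
      refine ⟨p :: S, T, rfl, ?_, ?_⟩
      · rw [toZ, h.1, h1]
      · rw [parity_cons, ← mul_assoc]; exact h2

theorem toZ_eq_cons {g : ℤ} {L : List LRow} {x : ℕ × ℚ} {Y : List (ℕ × ℚ)}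
    (h : toZ g L = x :: Y) : ∃ n r T, L = (n, r) :: T ∧ x = (n, ((g * r.len : ℤ) : ℚ)) ∧
      toZ (g * m1pow (r.A - r.B)) T = Y := by
  cases L with
  | nil => simp [toZ] at h
  | cons p L =>
    simp only [toZ, List.cons.injEq] at h
    exact ⟨p.1, p.2, L, rfl, h.1.symm, h.2⟩

theorem eq_append_of_getElem? {α : Type*} {L : List α} {k : ℕ} {x y : α} (h : L[k]? = some x)
    (h' : L[k + 1]? = some y) : L = L.take k ++ x :: y :: L.drop (k + 2) := by
  obtain ⟨h1, rfl⟩ := List.getElem?_eq_some_iff.1 h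
  obtain ⟨h2, rfl⟩ := List.getElem?_eq_some_iff.1 h'
  rw [List.getElem_cons_drop, List.getElem_cons_drop, List.take_append_drop]

theorem rexL_append (S T : List LRow) (m n : ℕ) (r s : Row) (h : r.subseg s ∨ s.subseg r) :
    rexL S.length (S ++ (m, r) :: (n, s) :: T) =
      S ++ (n, (rexPair r s).1) :: (m, (rexPair r s).2) :: T := by
  have h1 : (S ++ (m, r) :: (n, s) :: T)[S.length]? = some (m, r) := by simp
  have h2 : (S ++ (m, r) :: (n, s) :: T)[S.length + 1]? = some (n, s) := by simp
  unfold rexL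
  rw [h1, h2]
  simp [h, List.drop_append]

theorem rexL_cases (k : ℕ) (L : List LRow) : rexL k L = L ∨
    ∃ S T m n r s, (r.subseg s ∨ s.subseg r) ∧ L = S ++ (m, r) :: (n, s) :: T ∧
      rexL k L = S ++ (n, (rexPair r s).1) :: (m, (rexPair r s).2) :: T := by
  unfold rexL
  split
  · rename_i a r c s h1 h2
    split_ifs with h
    · exact .inr ⟨_, _, _, _, _, _, h, eq_append_of_getElem? h1 h2, rfl⟩
    · exact .inl rfl
  · exact .inl rfl

theorem Fits.append {S T : List LRow} : Fits A B (S ++ T) ↔ Fits A B S ∧ Fits A B T :=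
  List.forall_mem_append

theorem Fits.cons {p : LRow} {T : List LRow} :
    Fits A B (p :: T) ↔ (p.2.A = A p.1 ∧ p.2.B = B p.1) ∧ Fits A B T := by
  simp only [Fits, List.mem_cons, forall_eq_or_imp]

theorem AllGood.append {S T : List LRow} :
    AllGood c (S ++ T) ↔ AllGood c S ∧ AllGood c T := by
  simp only [AllGood, List.mem_append, or_imp, forall_and]

theorem AllGood.cons {p : LRow} {T : List LRow} :
    AllGood c (p :: T) ↔ p.2.Good c ∧ AllGood c T := by
  simp only [AllGood, List.mem_cons, forall_eq_or_imp]

theorem subseg_iff_of_fits {m n : ℕ} {r s : Row} (hr : r.A = A m ∧ r.B = B m)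
    (hs : s.A = A n ∧ s.B = B n) : r.subseg s ↔ Sub A B m n := by
  rw [Row.subseg, Sub, hr.1, hr.2, hs.1, hs.2]

theorem toZ_rex_lo {g : ℤ} {S T : List LRow} {m n : ℕ} {r s : Row} (hr : r.Good c)
    (hs : s.Good c) (h : r.subseg s) :
    toZ g (S ++ (n, (rexPair r s).1) :: (m, (rexPair r s).2) :: T) =
      toZ g S ++ (n, 2 * ((g * parity S * r.len : ℤ) : ℚ) -
        ((g * parity S * m1pow (r.A - r.B) * s.len : ℤ) : ℚ)) ::
        (m, ((g * parity S * r.len : ℤ) : ℚ)) ::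
        toZ (g * parity S * m1pow (r.A - r.B) * m1pow (s.A - s.B)) T := by
  obtain ⟨a1, a2, a3, a4⟩ := rexPair_seg (r := r) (s := s)
  obtain ⟨-, -, l1, l2⟩ := rexPair_lo hr hs h
  simp only [toZ_append, toZ, a1, a2, a3, a4, l1, l2]
  generalize g * parity S = g'
  have hm := m1pow_mul_self (s.A - s.B)
  congr 2
  · congr 1; push_cast; ring
  · congr 2
    · congr 1; linear_combination (g' * r.len) * hm
    · ring

theorem toZ_rex_hi {g : ℤ} {S T : List LRow} {m n : ℕ} {r s : Row} (hr : r.Good c)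
    (hs : s.Good c) (h : ¬ r.subseg s) :
    toZ g (S ++ (n, (rexPair r s).1) :: (m, (rexPair r s).2) :: T) =
      toZ g S ++ (n, ((g * parity S * m1pow (r.A - r.B) * s.len : ℤ) : ℚ)) ::
        (m, 2 * ((g * parity S * m1pow (r.A - r.B) * s.len : ℤ) : ℚ) -
          ((g * parity S * r.len : ℤ) : ℚ)) ::
        toZ (g * parity S * m1pow (r.A - r.B) * m1pow (s.A - s.B)) T := by
  obtain ⟨a1, a2, a3, a4⟩ := rexPair_seg (r := r) (s := s)
  obtain ⟨-, -, l1, l2⟩ := rexPair_hi hr hs h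
  simp only [toZ_append, toZ, a1, a2, a3, a4, l1, l2]
  generalize g * parity S = g'
  have hm := m1pow_mul_self (s.A - s.B)
  congr 2
  · congr 2; ring
  · congr 2
    · have : g' * m1pow (s.A - s.B) * (m1pow (s.A - s.B) *
          (2 * (m1pow (r.A - r.B) * s.len) - r.len)) =
          2 * (g' * m1pow (r.A - r.B) * s.len) - g' * r.len := by
        linear_combination (g' * (2 * (m1pow (r.A - r.B) * s.len) - r.len)) * hm
      rw [this]; push_cast; ring
    · ring

/-- A row exchange of labeled rows is an exchange of their signed lengths. -/
theorem rexPair_zstep {g : ℤ} {S T : List LRow} {m n : ℕ} {r s : Row}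
    (hf : Fits A B (S ++ (m, r) :: (n, s) :: T)) (hg : AllGood c (S ++ (m, r) :: (n, s) :: T))
    (h : r.subseg s ∨ s.subseg r) :
    Fits A B (S ++ (n, (rexPair r s).1) :: (m, (rexPair r s).2) :: T) ∧
    AllGood c (S ++ (n, (rexPair r s).1) :: (m, (rexPair r s).2) :: T) ∧
    ZStep A B AnyC (toZ g (S ++ (m, r) :: (n, s) :: T))
      (toZ g (S ++ (n, (rexPair r s).1) :: (m, (rexPair r s).2) :: T)) ∧
    signProd (rows (S ++ (n, (rexPair r s).1) :: (m, (rexPair r s).2) :: T)) =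
      signProd (rows (S ++ (m, r) :: (n, s) :: T)) := by
  simp only [Fits.append, Fits.cons, AllGood.append, AllGood.cons] at hf hg ⊢
  obtain ⟨hfS, hfr, hfs, hfT⟩ := hf
  obtain ⟨hgS, hgr, hgs, hgT⟩ := hg
  obtain ⟨a1, a2, a3, a4⟩ := rexPair_seg (r := r) (s := s)
  have hsub := subseg_iff_of_fits hfr hfs
  have hsub' := subseg_iff_of_fits hfs hfr
  have hsign := rexPair_rowSign hgr hgs
  refine ⟨?_, ?_, ?_, ?_⟩
  · rw [a1, a2, a3, a4]
    exact ⟨hfS, hfs, hfr, hfT⟩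
  · by_cases hc : r.subseg s
    · obtain ⟨g1, g2, -, -⟩ := rexPair_lo hgr hgs hc
      exact ⟨hgS, g1, g2, hgT⟩
    · obtain ⟨g1, g2, -, -⟩ := rexPair_hi hgr hgs hc
      exact ⟨hgS, g1, g2, hgT⟩
  · by_cases hc : r.subseg s
    · rw [toZ_rex_lo hgr hgs hc, toZ_append, toZ, toZ]
      exact .lo _ _ (m, _) (n, _) trivial (hsub.1 hc)
    · rw [toZ_rex_hi hgr hgs hc, toZ_append, toZ, toZ]
      exact .hi _ _ (m, _) (n, _) trivial (hsub'.1 (h.resolve_left hc))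
        (fun hh => hc (hsub.2 hh))
  · simp only [signProd, rows, List.map_append, List.map_cons, List.prod_append, List.prod_cons]
    linear_combination ((S.map Prod.snd).map rowSign).prod * ((T.map Prod.snd).map rowSign).prod *
      hsign

/-- The effect of an admissible reordering. -/
theorem ReorderL.spec {L L' : List LRow} (h : ReorderL L L') (hf : Fits A B L)
    (hg : AllGood c L) (g : ℤ) : Fits A B L' ∧ AllGood c L' ∧
      ZReach A B AnyC (toZ g L) (toZ g L') ∧ signProd (rows L') = signProd (rows L) := by
  induction h with
  | refl => exact ⟨hf, hg, .refl, rfl⟩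
  | tail _ h ih =>
    obtain ⟨k, rfl⟩ := h
    obtain ⟨i1, i2, i3, i4⟩ := ih
    rename_i X _
    rcases rexL_cases k X with e | ⟨S, T, m, n, r, s, h1, rfl, e⟩
    · rw [e]; exact ⟨i1, i2, i3, i4⟩
    · rw [e]
      obtain ⟨j1, j2, j3, j4⟩ := rexPair_zstep (g := g) i1 i2 h1
      exact ⟨j1, j2, i3.tail j3, j4.trans i4⟩

theorem ZStep.lift_rows {g : ℤ} {L : List LRow} {Z Z' : List (ℕ × ℚ)} (hf : Fits A B L)
    (hg : AllGood c L) (hZ : toZ g L = Z) (h : ZStep A B AnyC Z Z') :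
    ∃ k, toZ g (rexL k L) = Z' := by
  cases h with
  | lo S T p q _ hs =>
    obtain ⟨S, T, rfl, rfl, hT⟩ := toZ_eq_append hZ
    obtain ⟨m, r, T, rfl, rfl, hT'⟩ := toZ_eq_cons hT
    obtain ⟨n, s, T, rfl, rfl, rfl⟩ := toZ_eq_cons hT'
    simp only [Fits.append, Fits.cons, AllGood.append, AllGood.cons] at hf hg
    have hc := (subseg_iff_of_fits hf.2.1 hf.2.2.1).2 hs
    refine ⟨S.length, ?_⟩
    rw [rexL_append _ _ _ _ _ _ (.inl hc), toZ_rex_lo hg.2.1 hg.2.2.1 hc]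
  | hi S T p q _ hs hs' =>
    obtain ⟨S, T, rfl, rfl, hT⟩ := toZ_eq_append hZ
    obtain ⟨m, r, T, rfl, rfl, hT'⟩ := toZ_eq_cons hT
    obtain ⟨n, s, T, rfl, rfl, rfl⟩ := toZ_eq_cons hT'
    simp only [Fits.append, Fits.cons, AllGood.append, AllGood.cons] at hf hg
    have hc := (subseg_iff_of_fits hf.2.2.1 hf.2.1).2 hs
    have hc' := fun h => hs' ((subseg_iff_of_fits hf.2.1 hf.2.2.1).1 h)
    refine ⟨S.length, ?_⟩
    rw [rexL_append _ _ _ _ _ _ (.inr hc), toZ_rex_hi hg.2.1 hg.2.2.1 hc']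

theorem ZReach.lift_rows {g : ℤ} {L : List LRow} {Z : List (ℕ × ℚ)} (hf : Fits A B L)
    (hg : AllGood c L) (h : ZReach A B AnyC (toZ g L) Z) :
    ∃ L', ReorderL L L' ∧ toZ g L' = Z := by
  induction h with
  | refl => exact ⟨L, .refl, rfl⟩
  | tail _ h ih =>
    obtain ⟨L', h1, h2⟩ := ih
    obtain ⟨hf', hg', -, -⟩ := h1.spec hf hg g
    obtain ⟨k, hk⟩ := h.lift_rows hf' hg' h2
    exact ⟨_, h1.tail ⟨k, rfl⟩, hk⟩

theorem rexPair_sh (d : ℤ) (r s : Row) :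
    rexPair (r.sh d) (s.sh d) = ((rexPair r s).1.sh d, (rexPair r s).2.sh d) := by
  have h : (r.sh d).subseg (s.sh d) ↔ r.subseg s := by simp [Row.subseg, Row.sh]
  unfold rexPair
  rw [if_congr h rfl rfl]
  have b1 : (r.sh d).b = r.b := by simp [Row.b, Row.sh]
  have b2 : (s.sh d).b = s.b := by simp [Row.b, Row.sh]
  rw [b1, b2]
  simp only [Row.sh, add_sub_add_right_eq_sub]
  split_ifs <;> rfl

theorem rows_rexL_sh (d : ℤ) (k : ℕ) (L : List LRow) :
    shAll d (rows (rexL k L)) = rex k (shAll d (rows L)) := by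
  have h1 : ∀ i : ℕ, (shAll d (rows L))[i]? = (L[i]?).map fun p => p.2.sh d := by
    intro i; simp [shAll, rows, Function.comp_def]
  unfold rexL rex
  rw [h1 k, h1 (k + 1)]
  rcases e1 : L[k]? with _ | ⟨a, r⟩ <;> rcases e2 : L[k + 1]? with _ | ⟨b, s⟩ <;>
    simp only [Option.map_none, Option.map_some]
  have h : ((r.sh d).subseg (s.sh d) ∨ (s.sh d).subseg (r.sh d)) ↔
    (r.subseg s ∨ s.subseg r) := by simp [Row.subseg, Row.sh]
  rw [if_congr h rfl rfl, rexPair_sh]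
  split_ifs
  · simp [shAll, rows]
  · rfl

theorem ReorderL.reorder_sh (d : ℤ) {L L' : List LRow} (h : ReorderL L L') :
    Reorder (shAll d (rows L)) (shAll d (rows L')) := by
  induction h with
  | refl => exact .refl
  | tail _ h ih =>
    obtain ⟨k, rfl⟩ := h
    exact ih.tail ⟨k, rows_rexL_sh d k _⟩

/-- Xu's conditions amount to a Lipschitz condition. -/
theorem abs_len_sub_le {r s : Row} (hr : r.Good c) (hs : s.Good c) (d : ℤ)
    (h : XuPair (r.sh d) (s.sh d)) (ho : ¬ (s.A < r.A ∧ s.B < r.B)) :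
    |((r.len - m1pow (r.A - r.B) * s.len : ℤ) : ℚ)| ≤ |r.A - s.A| + |r.B - s.B| := by
  obtain ⟨m, n, k, hr⟩ := hr
  obtain ⟨m', n', k', hs⟩ := hs
  obtain ⟨h1, h2, h3⟩ := h
  simp only [Row.subseg, Row.sh, add_sub_add_right_eq_sub, add_le_add_iff_right, Row.b] at h1 h2 h3
  rw [hr.m1pow_eq] at *
  rw [hr.len_eq, hs.len_eq]
  rw [hr.hA, hr.hB, hs.hA, hs.hB, hr.hl, hs.hl] at *
  have e1 : (c + m - (c + m') : ℚ) = ((m - m' : ℤ) : ℚ) := by push_cast; ring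
  have e2 : (c + n - (c + n') : ℚ) = ((n - n' : ℤ) : ℚ) := by push_cast; ring
  rw [e1, e2]
  simp only [add_le_add_iff_left, add_lt_add_iff_left, Int.cast_le, Int.cast_lt] at h1 h2 h3 ho
  have q1 : (c + n + d + k ≤ c + n' + d + k' : Prop) ↔ n + k ≤ n' + k' := by
    rw [← Int.cast_le (R := ℚ)]; push_cast; constructor <;> intro <;> linarith
  have q2 : (c + m + d - k ≤ c + m' + d - k' : Prop) ↔ m - k ≤ m' - k' := by
    rw [← Int.cast_le (R := ℚ)]; push_cast; constructor <;> intro <;> linarith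
  have q3 : (c + m + d - k < c + n' + d + k' : Prop) ↔ m - k < n' + k' := by
    rw [← Int.cast_lt (R := ℚ)]; push_cast; constructor <;> intro <;> linarith
  have q4 : (((k' : ℚ) - k ≤ c + m' - (c + n') - (c + m - (c + n))) : Prop) ↔
      k' - k ≤ (m' - n') - (m - n) := by
    rw [← Int.cast_le (R := ℚ)]; push_cast; constructor <;> intro <;> linarith
  have q5 : (((k : ℚ) - k' ≤ c + m - (c + n) - (c + m' - (c + n'))) : Prop) ↔
      k - k' ≤ (m - n) - (m' - n') := by
    rw [← Int.cast_le (R := ℚ)]; push_cast; constructor <;> intro <;> linarith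
  have q6 : ((c + m - (c + n) + 1 ≤ (k : ℚ) + k') : Prop) ↔ m - n + 1 ≤ k + k' := by
    rw [← Int.cast_le (R := ℚ)]; push_cast; constructor <;> intro <;> linarith
  have q7 : ((c + m' - (c + n') + 1 ≤ (k : ℚ) + k') : Prop) ↔ m' - n' + 1 ≤ k + k' := by
    rw [← Int.cast_le (R := ℚ)]; push_cast; constructor <;> intro <;> linarith
  have q8 : ((0 ≤ (k : ℚ) - k') : Prop) ↔ 0 ≤ k - k' := by
    rw [← Int.cast_le (R := ℚ)]; push_cast; rfl
  have q9 : ((0 ≤ (k' : ℚ) - k) : Prop) ↔ 0 ≤ k' - k := by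
    rw [← Int.cast_le (R := ℚ)]; push_cast; rfl
  rw [q1, q2, q3] at h1
  rw [q4, q6, q9] at h2
  rw [q5, q7, q8] at h3
  norm_cast
  have t := hr.two_l
  have t' := hs.two_l
  clear q1 q2 q3 q4 q5 q6 q7 q8 q9 e1 e2
  rcases sg_eq_or (m - n) with e | e <;> rcases hr.eta with e' | e' <;>
    rcases hs.eta with e'' | e'' <;> rw [e, e', e''] at h1 h2 h3 <;> rw [e, e', e''] <;>
    norm_num at h1 h2 h3 ⊢ <;> simp only [abs_eq_max_neg] <;> omega

end LabeledRows

section Setup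

variable {A B : ℕ → ℚ} {c : ℚ}

theorem isInt_iff {x : ℚ} : IsInt x ↔ ∃ n : ℤ, x = n := by
  constructor
  · intro h
    exact ⟨x.num, ((Rat.den_eq_one_iff x).1 h).symm⟩
  · rintro ⟨n, rfl⟩
    exact Rat.den_intCast n

theorem Row.Good.abs_len {r : Row} (h : r.Good c) : |(r.len : ℚ)| = r.b - 2 * r.l := by
  obtain ⟨m, n, k, h⟩ := h
  rw [h.len_eq, h.len_sub]
  have := h.two_l
  norm_cast
  rw [abs_mul]
  rcases h.eta with e | e <;> rw [e] <;> norm_num <;> omega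

theorem mul_sign {x y : ℤ} (hx : x = 1 ∨ x = -1) (hy : y = 1 ∨ y = -1) :
    x * y = 1 ∨ x * y = -1 := by
  rcases hx with rfl | rfl <;> rcases hy with rfl | rfl <;> simp

theorem parity_eq_or (L : List LRow) : parity L = 1 ∨ parity L = -1 := by
  induction L with
  | nil => simp [parity]
  | cons p L ih => rw [parity_cons]; exact mul_sign (m1pow_eq_or _) ih

theorem exists_mem_toZ {g : ℤ} (hg : g = 1 ∨ g = -1) {L : List LRow} {p : LRow} (h : p ∈ L) :
    ∃ e : ℤ, (e = 1 ∨ e = -1) ∧ (p.1, ((e * p.2.len : ℤ) : ℚ)) ∈ toZ g L := by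
  obtain ⟨S, T, rfl⟩ := List.append_of_mem h
  exact ⟨g * parity S, mul_sign hg (parity_eq_or S), by rw [toZ_append, toZ]; simp⟩

theorem abs_sign_mul {e : ℤ} (he : e = 1 ∨ e = -1) (x : ℤ) :
    |((e * x : ℤ) : ℚ)| = |(x : ℚ)| := by
  rcases he with rfl | rfl <;> simp

theorem exists_of_mem_toZ {g : ℤ} {L : List LRow} {x : ℕ × ℚ}
    (h : x ∈ toZ g L) : ∃ S T n r, L = S ++ (n, r) :: T ∧
      x = (n, ((g * parity S * r.len : ℤ) : ℚ)) := by
  obtain ⟨X, Y, e⟩ := List.append_of_mem h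
  obtain ⟨S, T, rfl, -, h2⟩ := toZ_eq_append e
  obtain ⟨n, r, T, rfl, rfl, -⟩ := toZ_eq_cons h2
  exact ⟨S, T, n, r, rfl, rfl⟩

theorem IsEMS.allGood {L : List LRow} (h : IsEMS (rows L)) :
    ∃ c : ℚ, (c = 0 ∨ c = 1 / 2) ∧ AllGood c L := by
  obtain ⟨⟨h1, h2, h3, -⟩, h4⟩ := h
  cases L with
  | nil => exact ⟨0, .inl rfl, by simp [AllGood]⟩
  | cons p L =>
    have hp : p.2 ∈ rows (p :: L) := by simp [rows]
    obtain ⟨t, ht⟩ := isInt_iff.1 (h1 _ hp).1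
    obtain ⟨c, w, hc, hw⟩ : ∃ (c : ℚ) (w : ℤ), (c = 0 ∨ c = 1 / 2) ∧ p.2.A = c + w := by
      rcases Int.even_or_odd' t with ⟨w, rfl | rfl⟩
      · exact ⟨0, w, .inl rfl, by push_cast at ht; linarith⟩
      · exact ⟨1 / 2, w, .inr rfl, by push_cast at ht; linarith⟩
    refine ⟨c, hc, fun q hq => ?_⟩
    have hq' : q.2 ∈ rows (p :: L) := List.mem_map.2 ⟨q, hq, rfl⟩
    obtain ⟨-, -, ⟨v, hv⟩, hl, he⟩ := h1 _ hq'
    obtain ⟨x, hx⟩ := isInt_iff.1 (h3 _ hq' _ hp)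
    obtain ⟨k, hk⟩ := isInt_iff.1 hl
    refine ⟨w + x, w + x - v, k, ⟨?_, ?_, hk, he, by omega, h2 _ hq', ?_⟩⟩
    · push_cast; linarith
    · push_cast; linarith
    · have := (h4 _ hq').2
      rw [Row.b, hv, hk] at this
      have : (2 * k : ℚ) ≤ v + 1 := by linarith
      have : 2 * k ≤ (v : ℤ) + 1 := by exact_mod_cast this
      omega

theorem exists_fits {L : List LRow} (h : (L.map Prod.fst).Nodup) : ∃ A B, Fits A B L := by
  induction L with
  | nil => exact ⟨fun _ => 0, fun _ => 0, by simp [Fits]⟩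
  | cons p L ih =>
    simp only [List.map_cons, List.nodup_cons] at h
    obtain ⟨A, B, hAB⟩ := ih h.2
    refine ⟨Function.update A p.1 p.2.A, Function.update B p.1 p.2.B, ?_⟩
    intro q hq
    rcases List.mem_cons.1 hq with rfl | hq
    · simp
    · have : q.1 ≠ p.1 := fun e => h.1 (e ▸ List.mem_map.2 ⟨q, hq, rfl⟩)
      simpa [this] using hAB q hq

theorem Fits.pairwise_iff {L : List LRow} (h : Fits A B L) {P : ℚ → ℚ → ℚ → ℚ → Prop} :
    (rows L).Pairwise (fun r s => P r.A r.B s.A s.B) ↔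
      (L.map Prod.fst).Pairwise fun m n => P (A m) (B m) (A n) (B n) := by
  rw [rows, List.pairwise_map, List.pairwise_map]
  constructor <;> intro h' <;> refine h'.imp_of_mem fun {p q} hp hq hpq => ?_
  · obtain ⟨e1, e2⟩ := h p hp
    obtain ⟨e3, e4⟩ := h q hq
    rwa [e1, e2, e3, e4] at hpq
  · obtain ⟨e1, e2⟩ := h p hp
    obtain ⟨e3, e4⟩ := h q hq
    rwa [e1, e2, e3, e4]

/-- A criterion for being an extended multi-segment datum. -/
theorem isEMS_of_bound (hc : c = 0 ∨ c = 1 / 2) {g : ℤ} (hg : g = 1 ∨ g = -1) {M : List LRow}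
    (hf : Fits A B M) (hgood : AllGood c M) (ha : Adm A B (M.map Prod.fst))
    (hb : ∀ p ∈ toZ g M, |p.2| ≤ A p.1 - B p.1 + 1) : IsEMS (rows M) := by
  have key : ∀ r ∈ rows M, ∃ n, (n, r) ∈ M := fun r hr => by
    obtain ⟨p, hp, rfl⟩ := List.mem_map.1 hr
    exact ⟨p.1, hp⟩
  refine ⟨⟨?_, ?_, ?_, ?_⟩, ?_⟩
  · intro r hr
    obtain ⟨i, hi⟩ := key r hr
    obtain ⟨m, n, k, h⟩ := hgood _ hi
    dsimp only at h
    obtain ⟨t, ht⟩ : ∃ t : ℤ, 2 * c = t := by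
      rcases hc with rfl | rfl
      · exact ⟨0, by norm_num⟩
      · exact ⟨1, by norm_num⟩
    refine ⟨isInt_iff.2 ⟨t + 2 * m, ?_⟩, isInt_iff.2 ⟨t + 2 * n, ?_⟩, ⟨(m - n).toNat, ?_⟩,
      isInt_iff.2 ⟨k, h.hl⟩, h.eta⟩
    · rw [h.hA]; push_cast; linarith
    · rw [h.hB]; push_cast; linarith
    · rw [h.sub_eq]
      have : ((m - n).toNat : ℤ) = m - n := Int.toNat_of_nonneg (by linarith [h.le])
      exact_mod_cast this.symm
  · intro r hr
    obtain ⟨i, hi⟩ := key r hr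
    obtain ⟨m, n, k, h⟩ := hgood _ hi
    exact h.pos
  · intro r hr s hs
    obtain ⟨i, hi⟩ := key r hr
    obtain ⟨m, n, k, h⟩ := hgood _ hi
    obtain ⟨j, hj⟩ := key s hs
    obtain ⟨m', n', k', h'⟩ := hgood _ hj
    refine isInt_iff.2 ⟨m - m', ?_⟩
    have e1 := h.hA
    have e2 := h'.hA
    dsimp only at e1 e2
    rw [e1, e2]; push_cast; ring
  · exact (hf.pairwise_iff (P := fun a b a' b' => ¬ (a' < a ∧ b' < b))).2 ha
  · intro r hr
    obtain ⟨i, hi⟩ := key r hr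
    obtain ⟨e, he, hm⟩ := exists_mem_toZ hg hi
    have h1 := hb _ hm
    have h2 := hf _ hi
    dsimp only at h1 h2
    have h4 := (hgood _ hi).abs_len
    dsimp only at h4
    rw [abs_sign_mul he, h4, ← h2.1, ← h2.2, Row.b] at h1
    have h3 := (abs_nonneg _).trans_eq h4
    constructor <;> linarith

/-- The bound on signed lengths expressing `0 ≤ l`. -/
theorem IsEMS.bound {L : List LRow} (h : IsEMS (rows L)) (hf : Fits A B L) (hgood : AllGood c L)
    {g : ℤ} (hg : g = 1 ∨ g = -1) : ∀ p ∈ toZ g L, |p.2| ≤ A p.1 - B p.1 + 1 := by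
  intro p hp
  obtain ⟨S, T, n, r, rfl, rfl⟩ := exists_of_mem_toZ hp
  have hm : (n, r) ∈ S ++ (n, r) :: T := by simp
  have h1 := hf _ hm
  have h2 := (hgood _ hm).abs_len
  have h3 := (h.2 r (List.mem_map.2 ⟨_, hm, rfl⟩)).1
  dsimp only at *
  rw [abs_sign_mul (mul_sign hg (parity_eq_or S)), h2, ← h1.1, ← h1.2, Row.b]
  linarith

/-- Non-vanishing in terms of signed lengths. -/
theorem NonVanishing.lipAll {L : List LRow} (h : NonVanishing (rows L)) (hf : Fits A B L)
    (hgood : AllGood c L) {g : ℤ} (hg : g = 1 ∨ g = -1) (ha : Adm A B (L.map Prod.fst)) :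
    LipAll A B (toZ g L) := by
  intro Z hZ S p q T e
  obtain ⟨L', h1, rfl⟩ := hZ.lift_rows hf hgood
  obtain ⟨hf', hgood', h2, -⟩ := h1.spec hf hgood g
  have ha' := h2.adm (by rwa [labs_toZ])
  obtain ⟨d, hd⟩ : ∃ d : ℕ, ∀ r ∈ rows L, 0 ≤ r.B + (d : ℚ) := by
    generalize rows L = E
    induction E with
    | nil => exact ⟨0, by simp⟩
    | cons r E ih =>
      obtain ⟨d, hd⟩ := ih
      obtain ⟨d', hd'⟩ := exists_nat_ge (-r.B)
      refine ⟨d + d', ?_⟩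
      intro s hs
      push_cast
      rcases List.mem_cons.1 hs with rfl | hs
      · have : (0 : ℚ) ≤ d := by positivity
        linarith
      · have : (0 : ℚ) ≤ d' := by positivity
        linarith [hd s hs]
  have hX := h.2 d hd _ (h1.reorder_sh d)
  obtain ⟨S, T, rfl, rfl, hT⟩ := toZ_eq_append e
  obtain ⟨m, r, T, rfl, rfl, hT'⟩ := toZ_eq_cons hT
  obtain ⟨n, s, T, rfl, rfl, rfl⟩ := toZ_eq_cons hT'
  have hX' : XuPair (r.sh d) (s.sh d) := by
    have : shAll d (rows (S ++ (m, r) :: (n, s) :: T)) =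
      shAll d (rows S) ++ r.sh d :: s.sh d :: shAll d (rows T) := by simp [shAll, rows]
    rw [this] at hX
    exact (List.isChain_cons_cons.1 (List.isChain_append.1 hX).2.1).1
  simp only [Fits.append, Fits.cons, AllGood.append, AllGood.cons] at hf' hgood'
  rw [labs_toZ] at ha'
  simp only [Adm, List.map_append, List.map_cons, List.pairwise_append, List.pairwise_cons] at ha'
  have ho : ¬ (s.A < r.A ∧ s.B < r.B) := by
    rw [hf'.2.1.1, hf'.2.1.2, hf'.2.2.1.1, hf'.2.2.1.2]
    exact ha'.2.1.1 _ (by simp)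
  have := abs_len_sub_le hgood'.2.1 hgood'.2.2.1 d hX' ho
  rw [← abs_sign_mul (mul_sign hg (parity_eq_or S))] at this
  rw [sdist, ← hf'.2.1.1, ← hf'.2.1.2, ← hf'.2.2.1.1, ← hf'.2.2.1.2]
  refine le_trans (le_of_eq ?_) this
  congr 1
  push_cast
  ring

end Setup

section Duality

variable {A B : ℕ → ℚ} {c : ℚ}

theorem m1pow_add {x y : ℚ} (hx : IsInt x) (hy : IsInt y) : m1pow (x + y) = m1pow x * m1pow y := by
  obtain ⟨m, rfl⟩ := isInt_iff.1 hx
  obtain ⟨n, rfl⟩ := isInt_iff.1 hy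
  rw [m1pow_intCast, m1pow_intCast, m1pow_of_eq (n := m + n) (by push_cast; ring), sg_add]

theorem IsInt.add {x y : ℚ} (hx : IsInt x) (hy : IsInt y) : IsInt (x + y) := by
  obtain ⟨m, rfl⟩ := isInt_iff.1 hx
  obtain ⟨n, rfl⟩ := isInt_iff.1 hy
  exact isInt_iff.2 ⟨m + n, by push_cast; ring⟩

theorem IsInt.mul {x y : ℚ} (hx : IsInt x) (hy : IsInt y) : IsInt (x * y) := by
  obtain ⟨m, rfl⟩ := isInt_iff.1 hx
  obtain ⟨n, rfl⟩ := isInt_iff.1 hy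
  exact isInt_iff.2 ⟨m * n, by push_cast; ring⟩

theorem isInt_zero : IsInt 0 := isInt_iff.2 ⟨0, by simp⟩

theorem isInt_one : IsInt 1 := isInt_iff.2 ⟨1, by simp⟩

theorem m1pow_zero : m1pow 0 = 1 := by simp [m1pow]

theorem m1pow_one : m1pow 1 = -1 := by simp [m1pow]

/-- The total of the `a` of the rows. -/
def sumA (L : List LRow) : ℚ := ((rows L).map Row.a).sum

/-- The total of the `b` of the rows. -/
def sumB (L : List LRow) : ℚ := ((rows L).map Row.b).sum

theorem sumA_cons (p : LRow) (L : List LRow) : sumA (p :: L) = p.2.a + sumA L := by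
  simp [sumA, rows]

theorem sumB_cons (p : LRow) (L : List LRow) : sumB (p :: L) = p.2.b + sumB L := by
  simp [sumB, rows]

theorem sumA_append (S T : List LRow) : sumA (S ++ T) = sumA S + sumA T := by
  simp [sumA, rows]

theorem sumB_append (S T : List LRow) : sumB (S ++ T) = sumB S + sumB T := by
  simp [sumB, rows]

theorem Row.Good.isInt_b {r : Row} (h : r.Good c) : IsInt r.b := by
  obtain ⟨m, n, k, h⟩ := h
  exact isInt_iff.2 ⟨_, h.b_eq⟩

theorem Row.GoodAt.a_eq {r : Row} {m n k t : ℤ} (h : r.GoodAt c m n k) (ht : 2 * c = t) :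
    r.a = ((m + n + t + 1 : ℤ) : ℚ) := by
  rw [Row.a, h.hA, h.hB]; push_cast; linarith

theorem exists_two_mul_eq (hc : c = 0 ∨ c = 1 / 2) : ∃ t : ℤ, 2 * c = t ∧ (t = 0 ∨ t = 1) := by
  rcases hc with rfl | rfl
  · exact ⟨0, by norm_num, .inl rfl⟩
  · exact ⟨1, by norm_num, .inr rfl⟩

theorem Row.Good.isInt_a (hc : c = 0 ∨ c = 1 / 2) {r : Row} (h : r.Good c) : IsInt r.a := by
  obtain ⟨m, n, k, h⟩ := h
  obtain ⟨t, ht, -⟩ := exists_two_mul_eq hc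
  exact isInt_iff.2 ⟨_, h.a_eq ht⟩

theorem AllGood.isInt_sumB {L : List LRow} (h : AllGood c L) : IsInt (sumB L) := by
  induction L with
  | nil => simpa [sumB, rows] using isInt_zero
  | cons p L ih =>
    rw [AllGood.cons] at h
    rw [sumB_cons]
    exact h.1.isInt_b.add (ih h.2)

theorem AllGood.isInt_sumA (hc : c = 0 ∨ c = 1 / 2) {L : List LRow} (h : AllGood c L) :
    IsInt (sumA L) := by
  induction L with
  | nil => simpa [sumA, rows] using isInt_zero
  | cons p L ih =>
    rw [AllGood.cons] at h
    rw [sumA_cons]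
    exact (h.1.isInt_a hc).add (ih h.2)

/-- The dual of a row, in terms of the sums over the preceding and following rows. -/
def dualOf (α β : ℚ) (r : Row) : Row :=
  let η₀ : ℤ := if ¬ IsInt r.B ∧ r.l = r.b / 2 then - m1pow α else r.eta
  if IsInt r.B then
    ⟨r.A, -r.B, r.l + r.B, m1pow (α + β) * η₀⟩
  else
    ⟨r.A, -r.B, r.l + r.B + ((m1pow α * η₀ : ℤ) : ℚ) / 2, - (m1pow (α + β) * η₀)⟩

/-- The rowwise dual with initial sums `α`, `β`. -/
def dmap : ℚ → ℚ → List LRow → List LRow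
  | _, _, [] => []
  | α, β, p :: T => (p.1, dualOf α (sumB T + β) p.2) :: dmap (α + p.2.a) β T

theorem dmap_append (α β : ℚ) (S T : List LRow) :
    dmap α β (S ++ T) = dmap α (sumB T + β) S ++ dmap (α + sumA S) β T := by
  induction S generalizing α with
  | nil => simp [dmap, sumA, rows]
  | cons p S ih =>
    simp only [List.cons_append, dmap, ih, sumB_append, sumA_cons, add_assoc]

@[simp] theorem map_fst_dmap (α β : ℚ) (L : List LRow) :
    (dmap α β L).map Prod.fst = L.map Prod.fst := by
  induction L generalizing α with
  | nil => rfl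
  | cons p L ih => simp [dmap, ih]

theorem length_dmap (α β : ℚ) (L : List LRow) : (dmap α β L).length = L.length := by
  have := congrArg List.length (map_fst_dmap α β L)
  rwa [List.length_map, List.length_map] at this

theorem mapIdx_dualRow (S T : List LRow) :
    (T.mapIdx fun i p => (p.1, dualRow (rows (S ++ T)) (i + S.length) p.2)) =
      dmap (sumA S) 0 T := by
  induction T generalizing S with
  | nil => rfl
  | cons p T ih =>
    rw [List.mapIdx_cons, dmap]
    congr 1
    · have h1 : alphaAt (rows (S ++ p :: T)) (0 + S.length) = sumA S := by
        simp [alphaAt, rows, sumA]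
      have h2 : betaAt (rows (S ++ p :: T)) (0 + S.length) = sumB T + 0 := by
        simp only [betaAt, rows, sumB, List.map_append, List.map_cons, List.drop_append]
        rw [List.drop_eq_nil_of_le (by simp)]
        simp
      rw [← h1, ← h2]
      rfl
    · have := ih (S ++ [p])
      rw [sumA_append, sumA_cons] at this
      simp only [List.append_assoc, List.cons_append, List.nil_append, List.length_append,
        List.length_cons, List.length_nil] at this
      have e : sumA ([] : List LRow) = 0 := rfl
      rw [e, add_zero] at this
      rw [← this]
      congr 1
      funext i q
      rw [add_assoc, add_comm 1]

theorem dualL_eq (L : List LRow) : dualL L = (dmap 0 0 L).reverse := by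
  have := mapIdx_dualRow [] L
  rw [dualL]
  congr 1

@[simp] theorem dualOf_A (α β : ℚ) (r : Row) : (dualOf α β r).A = r.A := by
  unfold dualOf; dsimp only; split_ifs <;> rfl

@[simp] theorem dualOf_B (α β : ℚ) (r : Row) : (dualOf α β r).B = -r.B := by
  unfold dualOf; dsimp only; split_ifs <;> rfl

theorem dualOf_int {r : Row} (h : r.Good 0) (α β : ℚ) :
    (dualOf α β r).Good 0 ∧ (dualOf α β r).len = m1pow (α + β) * r.len := by
  obtain ⟨m, n, k, h⟩ := h
  have hi : IsInt r.B := isInt_iff.2 ⟨n, by rw [h.hB]; ring⟩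
  have e : dualOf α β r = ⟨r.A, -r.B, r.l + r.B, m1pow (α + β) * r.eta⟩ := by
    unfold dualOf; simp [hi]
  have hp := h.pos
  rw [h.hA, h.hB] at hp
  have hp' : 0 ≤ m + n := by
    have : (0 : ℚ) ≤ ((m + n : ℤ) : ℚ) := by push_cast; linarith
    exact_mod_cast this
  have g : (dualOf α β r).GoodAt 0 m (-n) (k + n) := by
    rw [e]
    refine ⟨h.hA, ?_, ?_, mul_sign (m1pow_eq_or _) h.eta, by omega, ?_, ?_⟩
    · rw [h.hB]; push_cast; ring
    · rw [h.hB, h.hl]; push_cast; ring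
    · have h1 := h.le
      have : (n : ℚ) ≤ m := by exact_mod_cast h1
      rw [h.hA, h.hB]; linarith
    · linarith [h.two_l]
  refine ⟨⟨_, _, _, g⟩, ?_⟩
  rw [g.len_eq, h.len_eq, e]
  ring

theorem not_isInt_half (n : ℤ) : ¬ IsInt ((1 / 2 : ℚ) + n) := by
  rw [isInt_iff]
  rintro ⟨w, hw⟩
  have : ((1 + 2 * n : ℤ) : ℚ) = ((2 * w : ℤ) : ℚ) := by push_cast; linarith
  have : 1 + 2 * n = 2 * w := by exact_mod_cast this
  omega

theorem dualOf_half {r : Row} (h : r.Good (1 / 2)) {α β : ℚ} (hα : IsInt α) (hβ : IsInt β) :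
    (dualOf α β r).Good (1 / 2) ∧ (dualOf α β r).len = m1pow β * (1 - m1pow α * r.len) := by
  obtain ⟨m, n, k, h⟩ := h
  have hi : ¬ IsInt r.B := by rw [h.hB]; exact not_isInt_half n
  obtain ⟨η₀, hη, h0, h1, h2⟩ : ∃ η₀ : ℤ, (η₀ = 1 ∨ η₀ = -1) ∧
      dualOf α β r = ⟨r.A, -r.B, r.l + r.B + ((m1pow α * η₀ : ℤ) : ℚ) / 2,
        - (m1pow (α + β) * η₀)⟩ ∧ η₀ * (m - n + 1 - 2 * k) = r.len ∧
      (2 * k = m - n + 1 → m1pow α * η₀ = -1) := by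
    have hk : r.l = r.b / 2 ↔ 2 * k = m - n + 1 := by
      rw [h.b_eq, h.hl]
      constructor
      · intro e
        have : ((2 * k : ℤ) : ℚ) = ((m - n + 1 : ℤ) : ℚ) := by push_cast at e ⊢; linarith
        exact_mod_cast this
      · intro e
        rw [← e]; push_cast; ring
    refine ⟨if ¬ IsInt r.B ∧ r.l = r.b / 2 then - m1pow α else r.eta, ?_, ?_, ?_, ?_⟩
    · split_ifs
      · rcases m1pow_eq_or α with e | e <;> simp [e]
      · exact h.eta
    · unfold dualOf
      rw [if_neg hi]
    · rw [h.len_eq]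
      split_ifs with hh
      · rw [hk] at hh
        rw [hh.2]; ring
      · rfl
    · intro hh
      rw [if_pos ⟨hi, hk.2 hh⟩]
      linarith [m1pow_mul_self α]
  have hp := h.pos
  rw [h.hA, h.hB] at hp
  have hp' : 0 ≤ m + n + 1 := by
    have : (0 : ℚ) ≤ ((m + n + 1 : ℤ) : ℚ) := by push_cast; linarith
    exact_mod_cast this
  have ht := h.two_l
  obtain ⟨v, hv, hv', hv''⟩ : ∃ v : ℤ, m1pow α * η₀ = 2 * v - 1 ∧ (v = 0 ∨ v = 1) ∧
      m1pow (α + β) * η₀ = m1pow β * (2 * v - 1) := by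
    have hm := m1pow_add hα hβ
    rcases mul_sign (m1pow_eq_or α) hη with e | e
    · exact ⟨1, by simp [e], .inr rfl, by rw [hm]; linear_combination m1pow β * e⟩
    · exact ⟨0, by simp [e], .inl rfl, by rw [hm]; linear_combination m1pow β * e⟩
  have g : (dualOf α β r).GoodAt (1 / 2) m (-n - 1) (k + n + v) := by
    rw [h0]
    refine ⟨h.hA, ?_, ?_, ?_, by omega, ?_, ?_⟩
    · rw [h.hB]; push_cast; ring
    · rw [h.hB, h.hl, hv]; push_cast; ring
    · rcases mul_sign (m1pow_eq_or (α + β)) hη with e | e <;> simp [e]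
    · have h1 := h.le
      have : (n : ℚ) ≤ m := by exact_mod_cast h1
      rw [h.hA, h.hB]; linarith
    · rcases hv' with rfl | rfl
      · linarith
      · have : 2 * k ≠ m - n + 1 := fun hh => by have := h2 hh; omega
        omega
  refine ⟨⟨_, _, _, g⟩, ?_⟩
  rw [g.len_eq, ← h1, h0]
  dsimp only
  have e1 : m1pow α * (η₀ * (m - n + 1 - 2 * k)) = (2 * v - 1) * (m - n + 1 - 2 * k) := by
    rw [← hv]; ring
  rw [e1, hv'']
  have : (2 * v - 1) * (2 * v - 1) = 1 := by rcases hv' with rfl | rfl <;> norm_num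
  linear_combination (m1pow β) * this

theorem dualOf_good (hc : c = 0 ∨ c = 1 / 2) {r : Row} (h : r.Good c) {α β : ℚ} (hα : IsInt α)
    (hβ : IsInt β) : (dualOf α β r).Good c := by
  rcases hc with rfl | rfl
  · exact (dualOf_int h α β).1
  · exact (dualOf_half h hα hβ).1

theorem dmap_good (hc : c = 0 ∨ c = 1 / 2) {L : List LRow} (h : AllGood c L) {α β : ℚ}
    (hα : IsInt α) (hβ : IsInt β) : AllGood c (dmap α β L) := by
  induction L generalizing α with
  | nil => simp [dmap, AllGood]
  | cons p L ih =>
    rw [AllGood.cons] at h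
    rw [dmap, AllGood.cons]
    exact ⟨dualOf_good hc h.1 hα (h.2.isInt_sumB.add hβ), ih h.2 (hα.add (h.1.isInt_a hc))⟩

theorem dmap_fits {L : List LRow} (h : Fits A B L) (α β : ℚ) :
    Fits A (fun n => - B n) (dmap α β L) := by
  induction L generalizing α with
  | nil => simp [dmap, Fits]
  | cons p L ih =>
    rw [Fits.cons] at h
    rw [dmap, Fits.cons]
    exact ⟨by simp [h.1.1, h.1.2], ih h.2 _⟩

theorem AllGood.reverse {L : List LRow} : AllGood c L.reverse ↔ AllGood c L := by
  simp [AllGood]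

theorem Fits.reverse {L : List LRow} : Fits A B L.reverse ↔ Fits A B L := by
  simp [Fits]

theorem parity_reverse (L : List LRow) : parity L.reverse = parity L := by
  rw [parity, List.map_reverse, List.prod_reverse, parity]

theorem m1pow_half {r : Row} (h : r.Good (1 / 2)) : m1pow r.a = m1pow (r.A - r.B) ∧
    m1pow r.b = m1pow (r.A + r.B) := by
  obtain ⟨m, n, k, h⟩ := h
  have e1 := h.a_eq (t := 1) (by norm_num)
  rw [m1pow_of_eq e1, m1pow_of_eq h.sub_eq, m1pow_of_eq h.b_eq,
    m1pow_of_eq (n := m + n + 1) (by rw [h.hA, h.hB]; push_cast; ring)]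
  unfold sg
  constructor <;> split_ifs <;> omega

theorem m1pow_int {r : Row} (h : r.Good 0) : m1pow r.a = - m1pow (r.A - r.B) ∧
    m1pow r.b = - m1pow (r.A + r.B) ∧ m1pow r.a = m1pow r.b := by
  obtain ⟨m, n, k, h⟩ := h
  have e1 := h.a_eq (t := 0) (by norm_num)
  rw [m1pow_of_eq e1, m1pow_of_eq h.sub_eq, m1pow_of_eq h.b_eq,
    m1pow_of_eq (n := m + n) (by rw [h.hA, h.hB]; push_cast; ring)]
  unfold sg
  refine ⟨?_, ?_, ?_⟩ <;> split_ifs <;> omega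

theorem parity_half {L : List LRow} (h : AllGood (1 / 2) L) : parity L = m1pow (sumA L) := by
  induction L with
  | nil => simp [parity, sumA, rows, m1pow_zero]
  | cons p L ih =>
    rw [AllGood.cons] at h
    rw [parity_cons, sumA_cons, m1pow_add (h.1.isInt_a (.inr rfl)) (h.2.isInt_sumA (.inr rfl)),
      ih h.2, (m1pow_half h.1).1]

theorem parity_dmap_half {L : List LRow} (h : AllGood (1 / 2) L) (α β : ℚ) :
    parity (dmap α β L) = m1pow (sumB L) := by
  induction L generalizing α with
  | nil => simp [dmap, parity, sumB, rows, m1pow_zero]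
  | cons p L ih =>
    rw [AllGood.cons] at h
    rw [dmap, parity_cons, sumB_cons, m1pow_add h.1.isInt_b h.2.isInt_sumB, ih h.2,
      (m1pow_half h.1).2]
    simp

theorem parity_dmap_int {L : List LRow} (h : AllGood 0 L) (α β : ℚ) :
    parity (dmap α β L) = (-1) ^ L.length * m1pow (sumB L) := by
  induction L generalizing α with
  | nil => simp [dmap, parity, sumB, rows, m1pow_zero]
  | cons p L ih =>
    rw [AllGood.cons] at h
    rw [dmap, parity_cons, sumB_cons, m1pow_add h.1.isInt_b h.2.isInt_sumB, ih h.2,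
      (m1pow_int h.1).2.1]
    simp
    ring

theorem dualZ_cons (κ : ℚ) (p : ℕ × ℚ) (Z : List (ℕ × ℚ)) :
    dualZ κ (p :: Z) = dualZ κ Z ++ [(p.1, κ - p.2)] := by simp [dualZ]

theorem toZ_dmap_half {L : List LRow} (h : AllGood (1 / 2) L) {α β : ℚ} (hα : IsInt α)
    (hβ : IsInt β) : toZ (m1pow β) (dmap α β L).reverse = dualZ 1 (toZ (m1pow α) L) := by
  induction L generalizing α with
  | nil => rfl
  | cons p L ih =>
    rw [AllGood.cons] at h
    have e := ih h.2 (hα.add (h.1.isInt_a (.inr rfl)))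
    rw [dmap, List.reverse_cons, toZ_append, e, toZ, toZ, toZ, dualZ_cons, parity_reverse,
      parity_dmap_half h.2, m1pow_add hα (h.1.isInt_a (.inr rfl)), (m1pow_half h.1).1,
      (dualOf_half h.1 hα (h.2.isInt_sumB.add hβ)).2, m1pow_add h.2.isInt_sumB hβ]
    congr 3
    have e1 := m1pow_mul_self β
    have e2 := m1pow_mul_self (sumB L)
    have : m1pow β * m1pow (sumB L) * (m1pow (sumB L) * m1pow β * (1 - m1pow α * p.2.len)) =
        1 - m1pow α * p.2.len := by
      linear_combination (1 - m1pow α * p.2.len) * (m1pow β * m1pow β * e2 + e1)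
    rw [this]
    push_cast
    ring

theorem toZ_dmap_int {L : List LRow} (h : AllGood 0 L) {α β : ℚ} (hα : IsInt α)
    (hβ : IsInt β) (g : ℤ) : toZ (g * (-1) ^ L.length * m1pow (α + β)) (dmap α β L).reverse =
      dualZ 0 (toZ g L) := by
  induction L generalizing α g with
  | nil => rfl
  | cons p L ih =>
    rw [AllGood.cons] at h
    have ia := h.1.isInt_a (.inl rfl)
    have e := ih h.2 (hα.add ia) (g * m1pow (p.2.A - p.2.B))
    have s1 := m1pow_mul_self (p.2.A - p.2.B)
    have e0 : g * m1pow (p.2.A - p.2.B) * (-1) ^ L.length * m1pow (α + p.2.a + β) =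
        g * (-1) ^ (p :: L).length * m1pow (α + β) := by
      rw [m1pow_add (hα.add ia) hβ, m1pow_add hα ia, m1pow_add hα hβ, (m1pow_int h.1).1,
        List.length_cons, pow_succ]
      linear_combination (- g * (-1) ^ L.length * m1pow α * m1pow β) * s1
    rw [e0] at e
    rw [dmap, List.reverse_cons, toZ_append, e, toZ, toZ, toZ, dualZ_cons, parity_reverse,
      parity_dmap_int h.2, (dualOf_int h.1 _ _).2,
      m1pow_add hα (h.2.isInt_sumB.add hβ), m1pow_add hα hβ, m1pow_add h.2.isInt_sumB hβ]
    congr 3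
    have e1 := m1pow_mul_self β
    have e2 := m1pow_mul_self (sumB L)
    have e3 := m1pow_mul_self α
    have e4 : ((-1 : ℤ) ^ L.length) * (-1) ^ L.length = 1 := by
      rw [← mul_pow]; simp
    rw [List.length_cons, pow_succ, zero_sub, ← Int.cast_neg]
    congr 1
    linear_combination (-g * p.2.len) * (m1pow α * m1pow α * (m1pow β * m1pow β) *
      (m1pow (sumB L) * m1pow (sumB L)) * e4 + m1pow α * m1pow α * (m1pow β * m1pow β) * e2 +
      m1pow α * m1pow α * e1 + e3)

theorem signProd_cons (p : LRow) (L : List LRow) :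
    signProd (rows (p :: L)) = rowSign p.2 * signProd (rows L) := by simp [signProd, rows]

theorem signProd_append (S T : List LRow) :
    signProd (rows (S ++ T)) = signProd (rows S) * signProd (rows T) := by simp [signProd, rows]

theorem signProd_reverse (L : List LRow) : signProd (rows L.reverse) = signProd (rows L) := by
  simp only [signProd, rows, List.map_reverse, List.prod_reverse]

theorem lenSign_mul_self (y : ℤ) : lenSign y * lenSign y = 1 := by
  unfold lenSign; split_ifs <;> rfl

theorem lenSign_sg_mul (x y : ℤ) : lenSign (sg x * y) * lenSign y = sg (x * y) := by
  have h : sg (x * y) = if x % 2 = 0 ∨ y % 2 = 0 then 1 else -1 := by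
    unfold sg
    congr 1
    simp only [← Int.dvd_iff_emod_eq_zero, Int.prime_two.dvd_mul]
  rw [h]
  unfold lenSign sg
  split_ifs <;> omega

theorem lenSign_one_sub (y : ℤ) : lenSign (1 - y) = lenSign y := by
  unfold lenSign; split_ifs <;> omega

theorem sg_mul_congr {x y z : ℤ} (h : sg y = sg z) : sg (x * y) = sg (x * z) := by
  have h' : y % 2 = 0 ↔ z % 2 = 0 := by
    unfold sg at h; split_ifs at h <;> simp_all
  unfold sg
  congr 1
  simp only [← Int.dvd_iff_emod_eq_zero, Int.prime_two.dvd_mul] at h' ⊢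
  rw [h']

theorem rowSign_dualOf (hc : c = 0 ∨ c = 1 / 2) {r : Row} (h : r.Good c) {α β : ℚ} (hα : IsInt α)
    (hβ : IsInt β) : rowSign (dualOf α β r) * rowSign r = m1pow (α * r.b + β * r.a) := by
  rw [(dualOf_good hc h hα hβ).rowSign_eq, h.rowSign_eq,
    m1pow_add (hα.mul h.isInt_b) (hβ.mul (h.isInt_a hc))]
  have hm := h.m1pow_eq
  obtain ⟨x, rfl⟩ := isInt_iff.1 hα
  obtain ⟨y, rfl⟩ := isInt_iff.1 hβ
  obtain ⟨b, hb⟩ := isInt_iff.1 h.isInt_b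
  obtain ⟨a, ha⟩ := isInt_iff.1 (h.isInt_a hc)
  have hbl : sg b = sg r.len := by
    have : m1pow r.b = - m1pow (r.A - r.B) := by
      rw [Row.b, m1pow_add _ isInt_one, m1pow_one, mul_neg_one]
      obtain ⟨m, n, k, h⟩ := h
      exact isInt_iff.2 ⟨_, h.sub_eq⟩
    rw [hm, neg_neg, hb, m1pow_intCast] at this
    exact this
  rw [hb, ha, m1pow_of_eq (n := x * b) (by push_cast; ring),
    m1pow_of_eq (n := y * a) (by push_cast; ring), sg_mul_congr hbl]
  rcases hc with rfl | rfl
  · rw [(dualOf_int h _ _).2, m1pow_of_eq (n := x + y) (by push_cast; ring), lenSign_sg_mul]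
    have hal : sg a = sg r.len := by
      have := (m1pow_int h).2.2
      rw [hb, ha, m1pow_intCast, m1pow_intCast] at this
      rw [this, hbl]
    rw [sg_mul_congr hal, add_mul, sg_add]
  · have hal : sg a = sg (1 - sg x * r.len) := by
      have := (m1pow_half h).1
      rw [ha, m1pow_intCast, hm] at this
      rw [this]
      unfold sg
      split_ifs <;> omega
    rw [(dualOf_half h hα hβ).2, m1pow_intCast, m1pow_intCast, sg_mul_congr hal,
      ← lenSign_sg_mul y, ← lenSign_sg_mul x, lenSign_one_sub]
    linear_combination (-lenSign (sg y * (1 - sg x * r.len)) * lenSign r.len) *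
      lenSign_mul_self (sg x * r.len)

theorem rowSign_mul_self {r : Row} (h : r.Good c) : rowSign r * rowSign r = 1 := by
  rw [h.rowSign_eq, lenSign_mul_self]

theorem signProd_mul_self {L : List LRow} (h : AllGood c L) :
    signProd (rows L) * signProd (rows L) = 1 := by
  induction L with
  | nil => rfl
  | cons p L ih =>
    rw [AllGood.cons] at h
    rw [signProd_cons]
    linear_combination signProd (rows L) * signProd (rows L) * rowSign_mul_self h.1 + ih h.2

theorem signProd_dmap (hc : c = 0 ∨ c = 1 / 2) {L : List LRow} (h : AllGood c L) {α β : ℚ}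
    (hα : IsInt α) (hβ : IsInt β) : signProd (rows (dmap α β L)) * signProd (rows L) =
      m1pow (α * sumB L + β * sumA L) := by
  induction L generalizing α with
  | nil => simp [dmap, signProd, rows, sumA, sumB, m1pow_zero]
  | cons p L ih =>
    rw [AllGood.cons] at h
    have ia := h.1.isInt_a hc
    have ib := h.1.isInt_b
    have jb := h.2.isInt_sumB
    have ja := h.2.isInt_sumA hc
    have e1 := rowSign_dualOf hc h.1 hα (jb.add hβ)
    have e2 := ih h.2 (hα.add ia)
    rw [dmap, signProd_cons, signProd_cons, sumA_cons, sumB_cons]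
    have e3 : α * (p.2.b + sumB L) + β * (p.2.a + sumA L) =
        (α * p.2.b + β * p.2.a) + (α * sumB L + β * sumA L) := by ring
    have e4 : α * p.2.b + (sumB L + β) * p.2.a = (α * p.2.b + β * p.2.a) + sumB L * p.2.a := by
      ring
    have e5 : (α + p.2.a) * sumB L + β * sumA L =
        (α * sumB L + β * sumA L) + sumB L * p.2.a := by ring
    have i1 := (hα.mul ib).add (hβ.mul ia)
    have i2 := (hα.mul jb).add (hβ.mul ja)
    rw [e4, m1pow_add i1 (jb.mul ia)] at e1
    rw [e5, m1pow_add i2 (jb.mul ia)] at e2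
    rw [e3, m1pow_add i1 i2]
    dsimp only at e1 ⊢
    linear_combination signProd (rows (dmap (α + p.2.a) β L)) * signProd (rows L) * e1 +
      (m1pow (α * p.2.b + β * p.2.a) * m1pow (sumB L * p.2.a)) * e2 +
      m1pow (α * p.2.b + β * p.2.a) * m1pow (α * sumB L + β * sumA L) *
        m1pow_mul_self (sumB L * p.2.a)

theorem signProd_dualL (hc : c = 0 ∨ c = 1 / 2) {L : List LRow} (h : AllGood c L) :
    signProd (rows (dualL L)) = signProd (rows L) := by
  have := signProd_dmap hc h isInt_zero isInt_zero
  rw [zero_mul, zero_mul, add_zero, m1pow_zero] at this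
  rw [dualL_eq, signProd_reverse]
  linear_combination signProd (rows L) * this -
    signProd (rows (dmap 0 0 L)) * signProd_mul_self h

theorem dualL_fits {L : List LRow} (h : Fits A B L) : Fits A (fun n => - B n) (dualL L) := by
  rw [dualL_eq, Fits.reverse]
  exact dmap_fits h 0 0

theorem dualL_good (hc : c = 0 ∨ c = 1 / 2) {L : List LRow} (h : AllGood c L) :
    AllGood c (dualL L) := by
  rw [dualL_eq, AllGood.reverse]
  exact dmap_good hc h isInt_zero isInt_zero

theorem map_fst_dualL (L : List LRow) : (dualL L).map Prod.fst = (L.map Prod.fst).reverse := by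
  rw [dualL_eq, List.map_reverse, map_fst_dmap]

/-- The initial signs for which the dual acts on signed lengths by a reflection. -/
def InitSign (c : ℚ) (g : ℤ) : Prop := g = 1 ∨ (g = -1 ∧ c = 0)

theorem InitSign.eq_or {g : ℤ} (h : InitSign c g) : g = 1 ∨ g = -1 := h.imp id And.left

theorem toZ_dualL (hc : c = 0 ∨ c = 1 / 2) {L : List LRow} (h : AllGood c L) {g : ℤ}
    (hg : InitSign c g) :
    ∃ g', InitSign c g' ∧ toZ g' (dualL L) = dualZ (2 * c) (toZ g L) := by
  rw [dualL_eq]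
  rcases hc with rfl | rfl
  · have := toZ_dmap_int h isInt_zero isInt_zero g
    rw [mul_zero, ← this]
    refine ⟨_, ?_, rfl⟩
    have h1 := mul_mul_sign hg.eq_or (neg_one_pow_eq_or ℤ L.length) (m1pow_eq_or (0 + 0))
    exact h1.imp id fun e => ⟨e, rfl⟩
  · have := toZ_dmap_half h isInt_zero isInt_zero
    rw [m1pow_zero] at this
    rcases hg with rfl | ⟨-, e⟩
    · exact ⟨1, .inl rfl, by rw [this]; norm_num⟩
    · norm_num at e

end Duality

section UnionIntersection

variable {A B : ℕ → ℚ} {c : ℚ}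

/-- The effect of a union-intersection of two rows on signed lengths. -/
theorem uiPair_spec {r s : Row} (hr : r.Good c) (hs : s.Good c) (hlr : 0 ≤ r.l) (hls : 0 ≤ s.l)
    (h : uiApplicablePair r s) : ∃ σ D E : ℤ, (σ = 1 ∨ σ = -1) ∧ s.A - r.A = D ∧ s.B - r.B = E ∧
      r.len - m1pow (r.A - r.B) * s.len = σ * (D + E) ∧
      ((uiPair r s).1.Good c ∧ (uiPair r s).1.A = s.A ∧ (uiPair r s).1.B = r.B ∧
        (uiPair r s).1.len = r.len + σ * D) ∧
      (¬ uiT3 r s → (uiPair r s).2.Good c ∧ (uiPair r s).2.A = r.A ∧ (uiPair r s).2.B = s.B ∧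
        m1pow ((uiPair r s).1.A - (uiPair r s).1.B) * (uiPair r s).2.len =
          m1pow (r.A - r.B) * s.len + σ * D) ∧
      (uiT3 r s → r.A = s.B - 1 ∧ m1pow (r.A - r.B) * s.len + σ * D = 0 ∧
        m1pow ((uiPair r s).1.A - (uiPair r s).1.B) = - (m1pow (r.A - r.B) * m1pow (s.A - s.B))) := by
  obtain ⟨m, n, k, hr⟩ := hr
  obtain ⟨m', n', k', hs⟩ := hs
  obtain ⟨hA, hB, hcase⟩ := h
  have hA' : m < m' := by
    rw [hr.hA, hs.hA] at hA
    have : (m : ℚ) < m' := by linarith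
    exact_mod_cast this
  have hB' : n < n' := by
    rw [hr.hB, hs.hB] at hB
    have : (n : ℚ) < n' := by linarith
    exact_mod_cast this
  have hk : 0 ≤ k := by rw [hr.hl] at hlr; exact_mod_cast hlr
  have hk' : 0 ≤ k' := by rw [hs.hl] at hls; exact_mod_cast hls
  have hD : s.A - r.A = ((m' - m : ℤ) : ℚ) := by rw [hr.hA, hs.hA]; push_cast; ring
  have hE : s.B - r.B = ((n' - n : ℤ) : ℚ) := by rw [hr.hB, hs.hB]; push_cast; ring
  have q1 : s.A - s.l = r.A - r.l ↔ m' - k' = m - k := by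
    rw [hr.hA, hs.hA, hr.hl, hs.hl]
    constructor
    · intro e
      have : ((m' - k' : ℤ) : ℚ) = ((m - k : ℤ) : ℚ) := by push_cast; linarith
      exact_mod_cast this
    · intro e
      have : ((m' - k' : ℤ) : ℚ) = ((m - k : ℤ) : ℚ) := by exact_mod_cast e
      push_cast at this; linarith
  have q2 : s.B + s.l = r.B + r.l ↔ n' + k' = n + k := by
    rw [hr.hB, hs.hB, hr.hl, hs.hl]
    constructor
    · intro e
      have : ((n' + k' : ℤ) : ℚ) = ((n + k : ℤ) : ℚ) := by push_cast; linarith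
      exact_mod_cast this
    · intro e
      have : ((n' + k' : ℤ) : ℚ) = ((n + k : ℤ) : ℚ) := by exact_mod_cast e
      push_cast at this; linarith
  have q3 : s.B + s.l = r.A - r.l + 1 ↔ n' + k' = m - k + 1 := by
    rw [hr.hA, hs.hB, hr.hl, hs.hl]
    constructor
    · intro e
      have : ((n' + k' : ℤ) : ℚ) = ((m - k + 1 : ℤ) : ℚ) := by push_cast; linarith
      exact_mod_cast this
    · intro e
      have : ((n' + k' : ℤ) : ℚ) = ((m - k + 1 : ℤ) : ℚ) := by exact_mod_cast e
      push_cast at this; linarith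
  have q4 : s.A - r.A ≤ r.b - 2 * r.l ↔ m' - m ≤ m - n + 1 - 2 * k := by
    rw [hD, hr.len_sub]; exact Int.cast_le
  have q5 : s.l ≤ r.l ↔ k' ≤ k := by rw [hr.hl, hs.hl]; exact Int.cast_le
  have ht := hr.two_l
  have ht' := hs.two_l
  have hle := hr.le
  have hle' := hs.le
  have hpos := hr.pos
  have hu1 : ∀ {k₁ η₁ : ℤ}, (η₁ = 1 ∨ η₁ = -1) → 2 * k₁ ≤ m' - n + 1 →
      (⟨s.A, r.B, k₁, η₁⟩ : Row).GoodAt c m' n k₁ := fun h1 h2 =>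
    ⟨hs.hA, hr.hB, rfl, h1, by omega, by dsimp only; linarith, h2⟩
  have hu2 : ∀ {k₁ η₁ : ℤ}, (η₁ = 1 ∨ η₁ = -1) → n' ≤ m → 2 * k₁ ≤ m - n' + 1 →
      (⟨r.A, s.B, k₁, η₁⟩ : Row).GoodAt c m n' k₁ := fun h1 h2 h3 =>
    ⟨hr.hA, hs.hB, rfl, h1, h2, by dsimp only; linarith, h3⟩
  have hsgD : ∀ t, sg (m' - m) * t = 1 ∨ sg (m' - m) * t = -1 ↔ t = 1 ∨ t = -1 := fun t => by
    rcases sg_eq_or (m' - m) with e | e <;> rw [e] <;> omega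
  have hm1 : m1pow (s.A - r.A) = sg (m' - m) := m1pow_of_eq hD
  have hm2 : m1pow (s.A - r.A + 1) = - sg (m' - m) := by
    rw [m1pow_of_eq (n := m' - m + 1) (by rw [hD]; push_cast; ring), sg_add_one]
  have hm3 : m1pow (s.A - r.B) = sg (m' - m) * sg (m - n) := by
    rw [m1pow_of_eq (n := m' - m + (m - n)) (by rw [hr.hB, hs.hA]; push_cast; ring), sg_add]
  have hsq := sg_mul_self (m' - m)
  unfold uiT3
  rw [hr.len_eq, hs.len_eq]
  simp only [uiPair]
  simp only [q1, q2, q3, q4, q5, hm1, hm2, hr.m1pow_eq, hs.m1pow_eq] at hcase ⊢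
  have hη : sg (m - n) * r.eta * s.eta = 1 → sg (m - n) * s.eta = r.eta := fun e => by
    rcases sg_eq_or (m - n) with e1 | e1 <;> rcases hr.eta with e2 | e2 <;>
      rcases hs.eta with e3 | e3 <;> rw [e1, e2, e3] at e ⊢ <;> omega
  have hη' : sg (m - n) * r.eta * s.eta = -1 → sg (m - n) * s.eta = -r.eta := fun e => by
    rcases sg_eq_or (m - n) with e1 | e1 <;> rcases hr.eta with e2 | e2 <;>
      rcases hs.eta with e3 | e3 <;> rw [e1, e2, e3] at e ⊢ <;> omega
  have hneg : ∀ {t : ℤ}, (t = 1 ∨ t = -1) → (-t = 1 ∨ -t = -1) := by omega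
  have hi2 := (hsgD _).2 hs.eta
  rcases hcase with ⟨hε, hcase⟩ | ⟨hε, hcase⟩
  · have hη := hη hε
    rw [if_pos hε]
    by_cases h1 : m' - k' = m - k
    · rw [if_pos h1]
      have e1 : s.l - (s.A - r.A) = ((k' - (m' - m) : ℤ) : ℚ) := by rw [hs.hl, hD]; push_cast; ring
      rw [e1, hr.hl]
      have g1 := hu1 (k₁ := k) hr.eta (by omega)
      have g2 := hu2 (k₁ := k' - (m' - m)) hi2 (by omega) (by omega)
      refine ⟨r.eta, m' - m, n' - n, hr.eta, hD, hE, ?_, ⟨⟨_, _, _, g1⟩, rfl, rfl, ?_⟩,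
        fun _ => ⟨⟨_, _, _, g2⟩, rfl, rfl, ?_⟩, fun hh => ?_⟩
      · rw [← mul_assoc, hη, ← mul_sub]; congr 1; omega
      · rw [g1.len_eq]; dsimp only; ring
      · rw [g2.len_eq, hm3]; dsimp only
        have : m - n' + 1 - 2 * (k' - (m' - m)) = m' - n' + 1 - 2 * k' + (m' - m) := by omega
        rw [this]
        linear_combination (sg (m - n) * s.eta * (m' - n' + 1 - 2 * k' + (m' - m))) * hsq +
          (m' - m) * hη
      · omega
    · rw [if_neg h1]
      have h2 := hcase.resolve_left h1
      rw [hs.hl]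
      have g2 := hu2 (k₁ := k') hi2 (by omega) (by omega)
      have t1 : r.eta * (m - n + 1 - 2 * k) - sg (m - n) * (s.eta * (m' - n' + 1 - 2 * k')) =
          -r.eta * (m' - m + (n' - n)) := by
        have : m' - n' + 1 - 2 * k' = m - n + 1 - 2 * k + (m' - m + (n' - n)) := by omega
        rw [this]
        linear_combination (-(m - n + 1 - 2 * k + (m' - m + (n' - n)))) * hη
      have t2 : sg (m' - m) * sg (m - n) * (sg (m' - m) * s.eta * (m - n' + 1 - 2 * k')) =
          sg (m - n) * (s.eta * (m' - n' + 1 - 2 * k')) + -r.eta * (m' - m) := by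
        linear_combination (sg (m - n) * s.eta * (m - n' + 1 - 2 * k')) * hsq -
          (m' - m) * hη
      by_cases h3 : m' - m ≤ m - n + 1 - 2 * k
      · rw [if_pos h3]
        have e1 : r.l + (s.A - r.A) = ((k + (m' - m) : ℤ) : ℚ) := by
          rw [hr.hl, hD]; push_cast; ring
        rw [e1]
        have g1 := hu1 (k₁ := k + (m' - m)) hr.eta (by omega)
        refine ⟨-r.eta, m' - m, n' - n, hneg hr.eta, hD, hE, t1, ⟨⟨_, _, _, g1⟩, rfl, rfl, ?_⟩,
          fun _ => ⟨⟨_, _, _, g2⟩, rfl, rfl, ?_⟩, fun hh => ?_⟩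
        · rw [g1.len_eq]; dsimp only; ring
        · rw [g2.len_eq, hm3]; exact t2
        · omega
      · rw [if_neg h3]
        have e1 : r.b - r.l = ((m - n + 1 - k : ℤ) : ℚ) := by
          rw [hr.hl, hr.b_eq]; push_cast; ring
        rw [e1]
        have g1 := hu1 (k₁ := m - n + 1 - k) (hneg hr.eta) (by omega)
        refine ⟨-r.eta, m' - m, n' - n, hneg hr.eta, hD, hE, t1, ⟨⟨_, _, _, g1⟩, rfl, rfl, ?_⟩,
          fun _ => ⟨⟨_, _, _, g2⟩, rfl, rfl, ?_⟩, fun hh => ?_⟩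
        · rw [g1.len_eq]; dsimp only; ring
        · rw [g2.len_eq, hm3]; exact t2
        · omega
  · have hη := hη' hε
    rw [if_neg (by omega)]
    have t1 : r.eta * (m - n + 1 - 2 * k) - sg (m - n) * (s.eta * (m' - n' + 1 - 2 * k')) =
        r.eta * (m' - m + (n' - n)) := by
      have : m' - n' + 1 - 2 * k' = (m' - m + (n' - n)) - (m - n + 1 - 2 * k) := by omega
      rw [this]
      linear_combination (-((m' - m + (n' - n)) - (m - n + 1 - 2 * k))) * hη
    have g1 := hu1 (k₁ := k) hr.eta (by omega)
    have t2 : m' - n' + 1 - 2 * k' = (k - k') + (m' - m) := by omega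
    have t3 : r.l = 0 ∧ s.l = 0 ∧ sg (m - n) * r.eta * s.eta = -1 →
        r.A = s.B - 1 ∧ sg (m - n) * (s.eta * (m' - n' + 1 - 2 * k')) + r.eta * (m' - m) = 0 ∧
        m1pow (s.A - r.B) = -(sg (m - n) * sg (m' - n')) := by
      rintro ⟨z1, z2, -⟩
      rw [hr.hl] at z1
      rw [hs.hl] at z2
      have z1 : k = 0 := by exact_mod_cast z1
      have z2 : k' = 0 := by exact_mod_cast z2
      refine ⟨?_, ?_, ?_⟩
      · have : n' = m + 1 := by omega
        rw [hr.hA, hs.hB, this]; push_cast; ring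
      · rw [t2, z1, z2]
        linear_combination (m' - m) * hη
      · have e : m' - n' + 1 = m' - m := by omega
        rw [hm3, ← e, sg_add_one]
        ring
    by_cases h1 : k' ≤ k
    · rw [if_pos h1]
      rw [hr.hl, hs.hl] at *
      refine ⟨r.eta, m' - m, n' - n, hr.eta, hD, hE, t1, ⟨⟨_, _, _, g1⟩, rfl, rfl, ?_⟩,
        fun hh => ?_, t3⟩
      · rw [g1.len_eq]; dsimp only; ring
      · have hkk : ¬ (k = 0 ∧ k' = 0) := fun z => hh ⟨by simp [z.1], by simp [z.2], hε⟩
        have g2 := hu2 (k₁ := k') hi2 (by omega) (by omega)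
        refine ⟨⟨_, _, _, g2⟩, rfl, rfl, ?_⟩
        rw [g2.len_eq, hm3, t2]; dsimp only
        have : m - n' + 1 - 2 * k' = k - k' := by omega
        rw [this]
        linear_combination (sg (m - n) * s.eta * (k - k')) * hsq - (m' - m) * hη
    · rw [if_neg h1]
      rw [hr.hl, hs.hl] at *
      refine ⟨r.eta, m' - m, n' - n, hr.eta, hD, hE, t1, ⟨⟨_, _, _, g1⟩, rfl, rfl, ?_⟩,
        fun hh => ?_, t3⟩
      · rw [g1.len_eq]; dsimp only; ring
      · have hi3 : -sg (m' - m) * s.eta = 1 ∨ -sg (m' - m) * s.eta = -1 := by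
          rw [neg_mul]; exact hneg hi2
        have g2 := hu2 (k₁ := k) hi3 (by omega) (by omega)
        refine ⟨⟨_, _, _, g2⟩, rfl, rfl, ?_⟩
        rw [g2.len_eq, hm3, t2]; dsimp only
        have : m - n' + 1 - 2 * k = k' - k := by omega
        rw [this]
        linear_combination (sg (m - n) * s.eta * (k - k')) * hsq - (m' - m) * hη

theorem lenSign_pair (u v w : ℤ) : lenSign u * lenSign (-sg u * (u - w)) =
    lenSign v * lenSign (-sg v * (v - w)) := by
  have h : ∀ u, lenSign u * lenSign (-sg u * (u - w)) =
lenSign w := fun u => by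
    unfold lenSign sg
    split_ifs <;> omega
  rw [h, h]

end UnionIntersection

section UnionIntersectionBound

variable {A B : ℕ → ℚ} {c : ℚ}

theorem uiAtL_append (S T : List LRow) (i j : ℕ) (r s : Row) (h : uiApplicablePair r s) :
    uiAtL S.length (S ++ (i, r) :: (j, s) :: T) =
      S ++ (i, (uiPair r s).1) :: if uiT3 r s then T else (j, (uiPair r s).2) :: T := by
  have h1 : (S ++ (i, r) :: (j, s) :: T)[S.length]? = some (i, r) := by simp
  have h2 : (S ++ (i, r) :: (j, s) :: T)[S.length + 1]? = some (j, s) := by simp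
  unfold uiAtL
  rw [h1, h2]
  simp only [h, if_true]
  split_ifs <;> simp [List.drop_append]

theorem Row.Good.isInt_sub {r : Row} (h : r.Good c) : IsInt (r.A - r.B) := by
  obtain ⟨m, n, k, h⟩ := h
  exact isInt_iff.2 ⟨_, h.sub_eq⟩

theorem fits_uiA {S : List LRow} {i j : ℕ} (h : Fits A B S) (hi : i ∉ S.map Prod.fst)
    (hj : j ∉ S.map Prod.fst) : Fits (uiA A i j) B S := by
  intro p hp
  have h1 : p.1 ≠ i := fun e => hi (e ▸ List.mem_map.2 ⟨p, hp, rfl⟩)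
  have h2 : p.1 ≠ j := fun e => hj (e ▸ List.mem_map.2 ⟨p, hp, rfl⟩)
  simp only [uiA, if_neg h1, if_neg h2]
  exact h p hp

/-- Union-intersections preserve the bounds on signed lengths and the sign product. -/
theorem UIrel.spec (hc : c = 0 ∨ c = 1 / 2) {N M : List LRow} {i j : ℕ} {g : ℤ}
    (hg : g = 1 ∨ g = -1) (hf : Fits A B N) (hgood : AllGood c N)
    (hs : (N.map Prod.fst).Pairwise fun m n => B m ≤ B n) (hcore : Core A B (toZ g N))
    (hb : ∀ p ∈ toZ g N, |p.2| ≤ A p.1 - B p.1 + 1) (h : UIrel N i j M) :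
    ∃ A', Fits A' B M ∧ AllGood c M ∧ ((M.map Prod.fst).Pairwise fun m n => B m ≤ B n) ∧
      (∀ p ∈ toZ g M, |p.2| ≤ A' p.1 - B p.1 + 1) ∧
      ((∀ p ∈ toZ g N, |p.2 - 2 * c| ≤ A p.1 + B p.1 + 1) →
        ∀ p ∈ toZ g M, |p.2 - 2 * c| ≤ A' p.1 + B p.1 + 1) ∧
      signProd (rows M) = signProd (rows N) := by
  obtain ⟨L', k, r, s, hL', hk1, hk2, hui, -, hM, hMo⟩ := h
  obtain ⟨u, O, hO, hOs, hgl, hru, hbdd⟩ := hcore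
  obtain ⟨hf', hgood', hreach, hsign⟩ := hL'.spec hf hgood g
  have hru' := hru.trans hreach
  have hb0 : Bdd A B u 0 (-1) O := hbdd 0 (-1) fun p hp => by
    have := hb p hp
    rw [sub_zero]; linarith
  have hbr := hgl.bound_reach hO hOs hb0 hru'
  have hk3 := eq_append_of_getElem? hk1 hk2
  have hlen : (L'.take k).length = k := by
    obtain ⟨h1, -⟩ := List.getElem?_eq_some_iff.1 hk1
    simp; omega
  generalize L'.take k = P at hk3 hlen
  generalize L'.drop (k + 2) = T at hk3
  subst hk3 hlen
  rw [uiAtL_append _ _ _ _ _ _ hui] at hM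
  have hMs : (M.map Prod.fst).Pairwise fun m n => B m ≤ B n := by
    rw [hMo]; exact hs.filter _
  have hOp : O.Perm ((P ++ (i, r) :: (j, s) :: T).map Prod.fst) := by
    have := ZReach.perm hru'
    rwa [labs_withVal, labs_toZ] at this
  have hnd := hOp.nodup_iff.1 hO
  have hne : ∀ n ∈ O, B n ≤ A n := fun n hn => by
    obtain ⟨p, hp, rfl⟩ := List.mem_map.1 (hOp.mem_iff.1 hn)
    obtain ⟨m, n, k, hh⟩ := hgood' p hp
    rw [← (hf' p hp).1, ← (hf' p hp).2, hh.hA, hh.hB]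
    have := hh.le
    have : (n : ℚ) ≤ m := by exact_mod_cast this
    linarith
  rw [toZ_append, toZ, toZ] at hru' hbr
  have hγ := mul_sign hg (parity_eq_or P)
  generalize hγe : g * parity P = γ at hru' hbr hγ
  have hfc := hf'
  have hgc := hgood'
  simp only [Fits.append, Fits.cons, AllGood.append, AllGood.cons] at hf' hgood'
  obtain ⟨hfP, ⟨fr1, fr2⟩, ⟨fs1, fs2⟩, hfT⟩ := hf'
  obtain ⟨hgP, hgr, hgs, hgT⟩ := hgood'
  have hlr : 0 ≤ r.l := by
    have h1 := hbr (i, ((γ * r.len : ℤ) : ℚ)) (by simp)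
    dsimp only at h1
    rw [abs_sign_mul hγ, hgr.abs_len, ← fr1, ← fr2, Row.b] at h1
    linarith
  have hls : 0 ≤ s.l := by
    have h1 := hbr (j, ((γ * m1pow (r.A - r.B) * s.len : ℤ) : ℚ)) (by simp)
    dsimp only at h1
    rw [abs_sign_mul (mul_sign hγ (m1pow_eq_or _)), hgs.abs_len, ← fs1, ← fs2, Row.b] at h1
    linarith
  obtain ⟨σ, D, E, hσ, hD, hE, hz, ⟨g1, a1, b1, l1⟩, hn3, ht3⟩ :=
    uiPair_spec hgr hgs hlr hls hui
  have hA : A i < A j := by rw [← fr1, ← fs1]; exact hui.1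
  have hB : B i < B j := by rw [← fr2, ← fs2]; exact hui.2.1
  have hij : j ≠ i := by rintro rfl; exact lt_irrefl _ hA
  simp only [List.map_append, List.map_cons, List.nodup_append, List.nodup_cons,
    List.mem_cons, not_or] at hnd
  obtain ⟨-, ⟨⟨-, hiT⟩, hjT, -⟩, hPd⟩ := hnd
  have hiP : i ∉ P.map Prod.fst := fun hh => hPd i hh i (.inl rfl) rfl
  have hjP : j ∉ P.map Prod.fst := fun hh => hPd j hh j (.inr (.inl rfl)) rfl
  have hfP' := fits_uiA hfP hiP hjP
  have hfT' := fits_uiA hfT hiT hjT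
  have hsσ : (((γ * σ : ℤ) : ℚ) = 1 ∨ ((γ * σ : ℤ) : ℚ) = -1) := by
    rcases mul_sign hγ hσ with e | e <;> rw [e] <;> simp
  have hD' : A j - A i = D := by rw [← fr1, ← fs1, hD]
  have hE' : B j - B i = E := by rw [← fr2, ← fs2, hE]
  have hz' : ((γ * r.len : ℤ) : ℚ) - ((γ * m1pow (r.A - r.B) * s.len : ℤ) : ℚ) =
      ((γ * σ : ℤ) : ℚ) * (A j - A i + (B j - B i)) := by
    rw [hD', hE']
    have : γ * r.len - γ * m1pow (r.A - r.B) * s.len = γ * σ * (D + E) := by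
      linear_combination γ * hz
    exact_mod_cast this
  have hz1 : ((γ * (uiPair r s).1.len : ℤ) : ℚ) =
      ((γ * r.len : ℤ) : ℚ) + ((γ * σ : ℤ) : ℚ) * (A j - A i) := by
    rw [l1, hD']; push_cast; ring
  have hw : s.len = -sg r.len * (r.len - σ * (D + E)) := by
    rw [← hgr.m1pow_eq]
    linear_combination (-s.len) * m1pow_mul_self (r.A - r.B) - m1pow (r.A - r.B) * hz
  have hpair := lenSign_pair r.len (r.len + σ * D) (σ * (D + E))
  have hf1 : (uiPair r s).1.A = uiA A i j i ∧ (uiPair r s).1.B = B i := by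
    rw [a1, b1]; simp [uiA, fs1, fr2]
  by_cases hT : uiT3 r s
  · rw [if_pos hT] at hM
    obtain ⟨hadj, hzero, hpar⟩ := ht3 hT
    have hKf : Fits (uiA A i j) B (P ++ (i, (uiPair r s).1) :: T) := by
      rw [Fits.append, Fits.cons]
      exact ⟨hfP', hf1, hfT'⟩
    have hKg : AllGood c (P ++ (i, (uiPair r s).1) :: T) := by
      rw [AllGood.append, AllGood.cons]
      exact ⟨hgP, g1, hgT⟩
    obtain ⟨hMf, hMg, hMr, hMsign⟩ := hM.spec hKf hKg g
    have hKz : toZ g (P ++ (i, (uiPair r s).1) :: T) = toZ g P ++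
        (i, ((γ * r.len : ℤ) : ℚ) + ((γ * σ : ℤ) : ℚ) * (A j - A i)) ::
        negZ (toZ (γ * m1pow (r.A - r.B) * m1pow (s.A - s.B)) T) := by
      rw [toZ_append, toZ, hγe, ← toZ_neg, ← hz1]
      congr 3
      linear_combination γ * hpar
    rw [hKz] at hMr
    have hMs' : (labs (toZ g M)).Pairwise fun m n => B m ≤ B n := by rwa [labs_toZ]
    have hj : A i = B j - 1 := by rw [← fr1, ← fs2]; exact hadj
    have hzj : ((γ * m1pow (r.A - r.B) * s.len : ℤ) : ℚ) +
        ((γ * σ : ℤ) : ℚ) * (A j - A i) = 0 := by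
      rw [hD']
      have : γ * m1pow (r.A - r.B) * s.len + γ * σ * D = 0 := by linear_combination γ * hzero
      exact_mod_cast this
    have hb1 : ∀ p ∈ toZ g M, |p.2| ≤ uiA A i j p.1 - B p.1 + 1 := by
      intro p hp
      have := ui_bound_empty hO hOs hgl hru' hA hB hsσ hz' le_rfl hb0 hne hj hzj hMr hMs' p hp
      rw [sub_zero, sub_zero, abs_neg] at this
      rcases this with h1 | h1
      · linarith
      · linarith [h1.2]
    refine ⟨uiA A i j, hMf, hMg, hMs, hb1, ?_, ?_⟩
    · intro hb2 p hp
      have hb3 : Bdd A B u (2 * c) 1 O := hbdd _ _ fun p hp => by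
        have := hb2 p hp
        linarith
      have := ui_bound_empty hO hOs hgl hru' hA hB hsσ hz' (by norm_num) hb3 hne hj hzj hMr hMs' p hp
      rcases this with h1 | ⟨h1, -⟩
      · linarith
      · have h2 := hb1 p hp
        have h3 : 0 ≤ A i := by
          obtain ⟨m, n, k, hh⟩ := hgr
          have h4 := hh.pos
          have h5 := hh.le
          have h5 : (n : ℚ) ≤ m := by exact_mod_cast h5
          rw [← fr1]
          rw [hh.hA, hh.hB] at h4
          rw [hh.hA]; linarith
        have h4 : 0 ≤ c ∧ c ≤ 1 / 2 := by rcases hc with rfl | rfl <;> norm_num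
        rw [abs_le] at h2 ⊢
        constructor <;> linarith [h2.1, h2.2, h4.1, h4.2]
    · rw [hMsign, ← hsign]
      rw [signProd_append, signProd_append, signProd_cons, signProd_cons, signProd_cons]
      dsimp only
      rw [g1.rowSign_eq, hgr.rowSign_eq, hgs.rowSign_eq, l1, hw, ← mul_assoc (lenSign r.len), hpair]
      have e0 : r.len + σ * D - σ * (D + E) = 0 := by linear_combination hzero + hz
      rw [e0]
      simp [lenSign]
  · rw [if_neg hT] at hM
    obtain ⟨g2, a2, b2, l2⟩ := hn3 hT
    have hf2 : (uiPair r s).2.A = uiA A i j j ∧ (uiPair r s).2.B = B j := by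
      rw [a2, b2]; simp [uiA, hij, fr1, fs2]
    have hKf : Fits (uiA A i j) B (P ++ (i, (uiPair r s).1) :: (j, (uiPair r s).2) :: T) := by
      rw [Fits.append, Fits.cons, Fits.cons]
      exact ⟨hfP', hf1, hf2, hfT'⟩
    have hKg : AllGood c (P ++ (i, (uiPair r s).1) :: (j, (uiPair r s).2) :: T) := by
      rw [AllGood.append, AllGood.cons, AllGood.cons]
      exact ⟨hgP, g1, g2, hgT⟩
    obtain ⟨hMf, hMg, hMr, hMsign⟩ := hM.spec hKf hKg g
    have hmm : m1pow ((uiPair r s).1.A - (uiPair r s).1.B) *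
        m1pow ((uiPair r s).2.A - (uiPair r s).2.B) =
        m1pow (r.A - r.B) * m1pow (s.A - s.B) := by
      rw [← m1pow_add g1.isInt_sub g2.isInt_sub, ← m1pow_add hgr.isInt_sub hgs.isInt_sub,
        a1, b1, a2, b2]
      congr 1; ring
    have hKz : toZ g (P ++ (i, (uiPair r s).1) :: (j, (uiPair r s).2) :: T) = toZ g P ++
        (i, ((γ * r.len : ℤ) : ℚ) + ((γ * σ : ℤ) : ℚ) * (A j - A i)) ::
        (j, ((γ * m1pow (r.A - r.B) * s.len : ℤ) : ℚ) + ((γ * σ : ℤ) : ℚ) * (A j - A i)) ::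
        toZ (γ * m1pow (r.A - r.B) * m1pow (s.A - s.B)) T := by
      rw [toZ_append, toZ, toZ, hγe, ← hz1]
      dsimp only
      have e1 : γ * m1pow ((uiPair r s).1.A - (uiPair r s).1.B) *
          m1pow ((uiPair r s).2.A - (uiPair r s).2.B) =
          γ * m1pow (r.A - r.B) * m1pow (s.A - s.B) := by linear_combination γ * hmm
      have e2 : γ * m1pow ((uiPair r s).1.A - (uiPair r s).1.B) * (uiPair r s).2.len =
          γ * m1pow (r.A - r.B) * s.len + γ * σ * D := by linear_combination γ * l2
      rw [e1, e2, hD']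
      congr 4
      push_cast; ring
    rw [hKz] at hMr
    have hMs' : (labs (toZ g M)).Pairwise fun m n => B m ≤ B n := by rwa [labs_toZ]
    refine ⟨uiA A i j, hMf, hMg, hMs, ?_, ?_, ?_⟩
    · intro p hp
      have := ui_bound hO hOs hgl hru' hA hB hsσ hz' le_rfl hb0 hMr hMs' p hp
      rw [sub_zero] at this
      linarith
    · intro hb2 p hp
      have hb3 : Bdd A B u (2 * c) 1 O := hbdd _ _ fun p hp => by
        have := hb2 p hp
        linarith
      have := ui_bound hO hOs hgl hru' hA hB hsσ hz' (by norm_num) hb3 hMr hMs' p hp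
      linarith
    · rw [hMsign, ← hsign]
      rw [signProd_append, signProd_append, signProd_cons, signProd_cons, signProd_cons,
        signProd_cons]
      dsimp only
      have hw2 : (uiPair r s).2.len = -sg (r.len + σ * D) * (r.len + σ * D - σ * (D + E)) := by
        rw [← l1, ← g1.m1pow_eq, l1]
        linear_combination (-(uiPair r s).2.len) * m1pow_mul_self _ +
          m1pow ((uiPair r s).1.A - (uiPair r s).1.B) * (l2 - hz)
      rw [g1.rowSign_eq, g2.rowSign_eq, hgr.rowSign_eq, hgs.rowSign_eq, hw2, l1, hw]
      linear_combination (-signProd (rows P) * signProd (rows T)) * hpair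

end UnionIntersectionBound

section Balanced

variable {A B : ℕ → ℚ} {c : ℚ}

theorem alphaAt_append (S : List LRow) (p : LRow) (T : List LRow) :
    alphaAt (rows (S ++ p :: T)) S.length = sumA S := by
  simp [alphaAt, rows, sumA]

theorem StarCond.bound (hc : c = 0 ∨ c = 1 / 2) {L : List LRow} (h : StarCond (rows L))
    (hf : Fits A B L) (hgood : AllGood c L) :
    ∀ p ∈ toZ 1 L, |p.2 - 2 * c| ≤ A p.1 + B p.1 + 1 := by
  intro p hp
  obtain ⟨S, T, n, r, rfl, rfl⟩ := exists_of_mem_toZ hp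
  have hm : (n, r) ∈ S ++ (n, r) :: T := by simp
  obtain ⟨h1, h2, h3⟩ := h S.length r (by simp [rows])
  obtain ⟨fA, fB⟩ := hf _ hm
  have habs := (hgood _ hm).abs_len
  have hpos : 0 ≤ r.A + r.B := by
    obtain ⟨m, n, k, hh⟩ := hgood _ hm
    exact hh.pos
  have hgS : AllGood c S := (AllGood.append.1 hgood).1
  have hS := parity_eq_or S
  dsimp only at fA fB habs ⊢
  rw [alphaAt_append] at h2 h3
  rw [← fA, ← fB, one_mul]
  rcases hc with rfl | rfl
  · have hi : IsInt r.B := by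
      obtain ⟨m, n, k, hh⟩ := hgood _ hm
      exact isInt_iff.2 ⟨n, by rw [hh.hB]; ring⟩
    have := h1 hi
    rw [mul_zero, sub_zero, abs_sign_mul hS, habs, Row.b]
    linarith
  · have hi : ¬ IsInt r.B := by
      obtain ⟨m, n, k, hh⟩ := hgood _ hm
      have := hh.hB
      dsimp only at this
      rw [this]
      exact not_isInt_half n
    have h2 := h2 hi
    have h3 := h3 hi
    rw [← parity_half hgS] at h2 h3
    obtain ⟨m, n, k, hh⟩ := hgood _ hm
    have hk := hh.two_l
    have hlen : parity S * r.len = parity S * r.eta * (m - n + 1 - 2 * k) := by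
      rw [hh.len_eq]; ring
    have hl := hh.hl
    have hA := hh.hA
    have hB := hh.hB
    dsimp only at hl hA hB
    rw [hl, hB] at h2 h3
    have hk : (2 * k : ℚ) ≤ m - n + 1 := by exact_mod_cast hk
    rw [hlen, hA, hB]
    rw [hA, hB] at hpos
    have he := hh.eta
    dsimp only at he
    rw [abs_le]
    rcases hS with e | e <;> rcases he with e' | e' <;> rw [e, e'] at h2 h3 ⊢ <;>
      norm_num at h2 h3 ⊢ <;> constructor <;> linarith

/-- A labeled symbol in an order compatible with `B` whose signed lengths satisfy the bounds
expressing that it and its dual are extended multi-segments. -/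
structure Balanced (c : ℚ) (A B : ℕ → ℚ) (g : ℤ) (L : List LRow) : Prop where
  initSign : InitSign c g
  fits : Fits A B L
  good : AllGood c L
  sorted : (L.map Prod.fst).Pairwise fun m n => B m ≤ B n
  bound : ∀ p ∈ toZ g L, |p.2| ≤ A p.1 - B p.1 + 1
  dual_bound : ∀ p ∈ toZ g L, |p.2 - 2 * c| ≤ A p.1 + B p.1 + 1

theorem Balanced.isEMS (hc : c = 0 ∨ c = 1 / 2) {g : ℤ} {L : List LRow} (h : Balanced c A B g L) :
    IsEMS (rows L) :=
  isEMS_of_bound hc h.initSign.eq_or h.fits h.good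
    (h.sorted.imp fun hmn hlt => absurd hlt.2 (not_lt.2 hmn)) h.bound

theorem Balanced.dual (hc : c = 0 ∨ c = 1 / 2) {g : ℤ} {L : List LRow} (h : Balanced c A B g L) :
    ∃ g', toZ g' (dualL L) = dualZ (2 * c) (toZ g L) ∧
      Balanced c A (fun n => - B n) g' (dualL L) := by
  obtain ⟨g', h1, h2⟩ := toZ_dualL hc h.good h.initSign
  have key : ∀ p ∈ toZ g' (dualL L), ∃ q ∈ toZ g L, p = (q.1, 2 * c - q.2) := by
    intro p hp
    rw [h2] at hp
    simp only [dualZ, List.mem_reverse, List.mem_map] at hp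
    obtain ⟨q, hq, rfl⟩ := hp
    exact ⟨q, hq, rfl⟩
  refine ⟨g', h2, h1, dualL_fits h.fits, dualL_good hc h.good, ?_, ?_, ?_⟩
  · rw [map_fst_dualL, List.pairwise_reverse]
    exact h.sorted.imp fun {m n} hmn => neg_le_neg hmn
  · intro p hp
    obtain ⟨q, hq, rfl⟩ := key p hp
    have := h.dual_bound q hq
    dsimp only
    rw [abs_sub_comm]; linarith
  · intro p hp
    obtain ⟨q, hq, rfl⟩ := key p hp
    have := h.bound q hq
    dsimp only
    rw [show 2 * c - q.2 - 2 * c = - q.2 by ring, abs_neg]; linarith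

theorem Balanced.ui (hc : c = 0 ∨ c = 1 / 2) {g : ℤ} {N M : List LRow} {i j : ℕ}
    (h : Balanced c A B g N) (hcore : Core A B (toZ g N)) (hui : UIrel N i j M) :
    (∃ A', Balanced c A' B g M) ∧ signProd (rows M) = signProd (rows N) := by
  obtain ⟨A', h1, h2, h3, h4, h5, h6⟩ :=
    hui.spec hc h.initSign.eq_or h.fits h.good h.sorted hcore h.bound
  exact ⟨⟨A', h.initSign, h1, h2, h3, h4, h5 h.dual_bound⟩, h6⟩

theorem NonVanishing.balanced {L : List LRow} (hE : IsEMS (rows L)) (hNV : NonVanishing (rows L))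
    (hP : Pprime (rows L)) (hlab : (L.map Prod.fst).Nodup) :
    ∃ c A B, (c = 0 ∨ c = 1 / 2) ∧ Balanced c A B 1 L ∧ LipAll A B (toZ 1 L) := by
  obtain ⟨c, hc, hgood⟩ := hE.allGood
  obtain ⟨A, B, hf⟩ := exists_fits hlab
  have hs : (L.map Prod.fst).Pairwise fun m n => B m ≤ B n :=
    (hf.pairwise_iff (P := fun _ b _ b' => b ≤ b')).1 hP
  exact ⟨c, A, B, hc, ⟨.inl rfl, hf, hgood, hs, hE.bound hf hgood (.inl rfl),
    hNV.1.bound hc hf hgood⟩, hNV.lipAll hf hgood (.inl rfl)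
      (hs.imp fun {m n} hmn hlt => absurd hlt.2 (not_lt.2 hmn))⟩

theorem Balanced.rex (hc : c = 0 ∨ c = 1 / 2) {g : ℤ} {L : List LRow} (h : Balanced c A B g L)
    (hcore : Core A B (toZ g L)) (k : ℕ) :
    IsEMS (rows (rexL k L)) ∧ signProd (rows (rexL k L)) = signProd (rows L) := by
  have hstep : ReorderL L (rexL k L) := .single ⟨k, rfl⟩
  obtain ⟨hf, hgood, hreach, hsign⟩ := hstep.spec h.fits h.good g
  obtain ⟨u, O, hO, hOs, hgl, hru, hbdd⟩ := hcore
  have hb0 : Bdd A B u 0 (-1) O := hbdd 0 (-1) fun p hp => by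
    have := h.bound p hp
    rw [sub_zero]; linarith
  have ha := ZReach.adm hreach (by
    rw [labs_toZ]
    exact h.sorted.imp fun {m n} hmn hlt => absurd hlt.2 (not_lt.2 hmn))
  rw [labs_toZ] at ha
  exact ⟨isEMS_of_bound hc h.initSign.eq_or hf hgood ha
    (hgl.bound_reach hO hOs hb0 (hru.trans hreach)), hsign⟩

theorem Balanced.dual_ui_dual (hc : c = 0 ∨ c = 1 / 2) {g : ℤ} {L N : List LRow} {i j : ℕ}
    (h : Balanced c A B g L) (hn : (L.map Prod.fst).Nodup) (hlip : LipAll A B (toZ g L))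
    (hui : UIrel (dualL L) i j N) :
    IsEMS (rows (dualL N)) ∧ signProd (rows (dualL N)) = signProd (rows L) := by
  obtain ⟨g', h1, h2⟩ := h.dual hc
  have hcore := hlip.core_dual (by rwa [labs_toZ]) (by rw [labs_toZ]; exact h.sorted) (2 * c)
  rw [← h1] at hcore
  obtain ⟨⟨A', h3⟩, h4⟩ := h2.ui hc hcore hui
  obtain ⟨g'', -, h5⟩ := h3.dual hc
  exact ⟨h5.isEMS hc, by rw [signProd_dualL hc h3.good, h4, signProd_dualL hc h.good]⟩

end Balanced

section PartialDual

variable {A B : ℕ → ℚ}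

theorem sumA_dmap (α β : ℚ) (L : List LRow) : sumA (dmap α β L) = sumB L := by
  induction L generalizing α with
  | nil => rfl
  | cons p L ih =>
    rw [dmap, sumA_cons, sumB_cons, ih]
    simp only [Row.a, Row.b, dualOf_A, dualOf_B]
    ring

theorem sumB_dmap (α β : ℚ) (L : List LRow) : sumB (dmap α β L) = sumA L := by
  induction L generalizing α with
  | nil => rfl
  | cons p L ih =>
    rw [dmap, sumA_cons, sumB_cons, ih]
    simp only [Row.a, Row.b, dualOf_A, dualOf_B]
    ring

theorem sumA_reverse (L : List LRow) : sumA L.reverse = sumA L := by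
  simp [sumA, rows]

theorem sumB_reverse (L : List LRow) : sumB L.reverse = sumB L := by
  simp [sumB, rows]

theorem dualL_append_cons (S T : List LRow) (p : LRow) :
    dualL (S ++ p :: T) = (dmap (sumA S + p.2.a) 0 T).reverse ++
      (p.1, dualOf (sumA S) (sumB T) p.2) :: (dmap 0 (sumB (p :: T)) S).reverse := by
  rw [dualL_eq, dmap_append, dmap]
  simp

/-- The rows before the distinguished row after a partial dual. -/
def partialPrefix (S T : List LRow) (r : Row) : List LRow :=
  (dmap (sumB T + r.b + 1) 0 (dmap 0 (sumB T + r.b) S).reverse).reverse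

theorem dualPlusL_append_cons (S T : List LRow) (n : ℕ) (r : Row) (hB : r.B = 1 / 2) :
    dualPlusL S.length (S ++ (n, r) :: T) =
      partialPrefix S T r ++ (n, ⟨r.A, -(1 / 2), 0, - r.eta⟩) :: T := by
  unfold dualPlusL
  have h1 : (S ++ (n, r) :: T)[S.length]? = some (n, r) := by simp
  rw [h1]
  dsimp only
  have h2 : (S ++ (n, r) :: T).length - 1 - S.length =
      (dmap (sumA S + r.a) 0 T).reverse.length := by simp [length_dmap]
  rw [dualL_append_cons, h2, List.set_append_right _ _ le_rfl, Nat.sub_self, List.set_cons_zero,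
    dualL_append_cons, List.take_append_of_le_length (by simp [length_dmap]), List.take_of_length_le
      (by simp [length_dmap]), partialPrefix, sumA_reverse, sumA_dmap, sumB_cons]
  have h3 : sumB T + Row.a ⟨r.A, 1 / 2, 0, - m1pow (gammaAt (rows (S ++ (n, r) :: T)) S.length)⟩ =
      sumB T + r.b + 1 := by
    simp only [Row.a, Row.b, hB]; ring
  have h4 : r.b + sumB T = sumB T + r.b := add_comm _ _
  simp only [h3, h4]
  simp [List.drop_append]

theorem m1pow_add_one {x : ℚ} (h : IsInt x) : m1pow (x + 1) = - m1pow x := by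
  rw [m1pow_add h isInt_one, m1pow_one]; ring

theorem toZ_partialPrefix {S T : List LRow} {r : Row} (hS : AllGood (1 / 2) S)
    (hx : IsInt (sumB T + r.b)) :
    toZ 1 (partialPrefix S T r) = (toZ 1 S).map fun p => (p.1, 2 - p.2) := by
  have hx1 := hx.add isInt_one
  have h1 : AllGood (1 / 2) (dmap 0 (sumB T + r.b) S).reverse :=
    AllGood.reverse.2 (dmap_good (.inr rfl) hS isInt_zero hx)
  have h2 := toZ_dmap_half h1 hx1 isInt_zero
  have h3 := toZ_dmap_half hS isInt_zero hx
  rw [m1pow_zero] at h2 h3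
  rw [partialPrefix, h2, m1pow_add_one hx, toZ_neg, h3]
  simp only [dualZ, negZ, List.map_reverse, List.reverse_reverse, List.map_map]
  refine List.map_congr_left fun p _ => ?_
  simp only [Function.comp, Prod.mk.injEq, true_and]
  ring

theorem signProd_partialPrefix {S T : List LRow} {r : Row} (hS : AllGood (1 / 2) S)
    (hx : IsInt (sumB T + r.b)) :
    signProd (rows (partialPrefix S T r)) = m1pow (sumA S) * signProd (rows S) := by
  have hx1 := hx.add isInt_one
  have h1 : AllGood (1 / 2) (dmap 0 (sumB T + r.b) S).reverse :=
    AllGood.reverse.2 (dmap_good (.inr rfl) hS isInt_zero hx)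
  have h2 := signProd_dmap (.inr rfl) h1 hx1 isInt_zero
  have h3 := signProd_dmap (.inr rfl) hS isInt_zero hx
  have h4 := signProd_mul_self h1
  have hs := hS.isInt_sumA (.inr rfl)
  have h5 := signProd_mul_self hS
  rw [partialPrefix, signProd_reverse]
  rw [sumB_reverse, sumB_dmap, zero_mul, add_zero, add_mul, one_mul, m1pow_add (hx.mul hs) hs]
    at h2
  rw [zero_mul, zero_add] at h3
  rw [signProd_reverse] at h2 h4
  have h6 := m1pow_mul_self ((sumB T + r.b) * sumA S)
  generalize signProd (rows (dmap (sumB T + r.b + 1) 0 (dmap 0 (sumB T + r.b) S).reverse)) = x at *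
  generalize signProd (rows (dmap 0 (sumB T + r.b) S)) = y at *
  generalize signProd (rows S) = z at *
  generalize m1pow ((sumB T + r.b) * sumA S) = e at *
  generalize m1pow (sumA S) = f at *
  calc x = (x * y) * y := by rw [mul_assoc, h4, mul_one]
    _ = e * f * (y * z * z) := by rw [h2, mul_assoc y, h5, mul_one]
    _ = e * e * (f * z) := by rw [h3]; ring
    _ = f * z := by rw [h6, one_mul]

theorem partialPrefix_good {S T : List LRow} {r : Row} (hS : AllGood (1 / 2) S)
    (hx : IsInt (sumB T + r.b)) : AllGood (1 / 2) (partialPrefix S T r) :=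
  AllGood.reverse.2 (dmap_good (.inr rfl) (AllGood.reverse.2 (dmap_good (.inr rfl) hS isInt_zero hx))
    (hx.add isInt_one) isInt_zero)

theorem partialPrefix_fits {S T : List LRow} {r : Row} (hS : Fits A B S) :
    Fits A B (partialPrefix S T r) := by
  have := Fits.reverse.2 (dmap_fits (Fits.reverse.2 (dmap_fits hS 0 (sumB T + r.b)))
    (sumB T + r.b + 1) 0)
  simp only [neg_neg] at this
  exact this

theorem parity_partialPrefix {S T : List LRow} {r : Row} (hS : AllGood (1 / 2) S)
    (hx : IsInt (sumB T + r.b)) : parity (partialPrefix S T r) = m1pow (sumA S) := by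
  rw [partialPrefix, parity_reverse, parity_dmap_half (AllGood.reverse.2
    (dmap_good (.inr rfl) hS isInt_zero hx)), sumB_reverse, sumB_dmap]

theorem map_fst_partialPrefix (S T : List LRow) (r : Row) :
    (partialPrefix S T r).map Prod.fst = S.map Prod.fst := by
  simp [partialPrefix, map_fst_dmap]

end PartialDual

section PartialDualBound

variable {A B : ℕ → ℚ} {c : ℚ}

theorem lenSign_neg_succ {a η : ℤ} (h : η = 1 ∨ η = -1) :
    lenSign (-η * (a + 1)) = - η * lenSign (η * a) := by
  unfold lenSign
  rcases h with rfl | rfl <;> norm_num <;> split_ifs <;> omega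

theorem Balanced.dualPlus (hc : c = 0 ∨ c = 1 / 2) {g : ℤ} {L : List LRow} {k : ℕ}
    (h : Balanced c A B g L) (hn : (L.map Prod.fst).Nodup) (hk : DualPlusApplicableLab k L) :
    (∃ B' g', Balanced c A B' g' (dualPlusLab k L)) ∧
      signProd (rows (dualPlusLab k L)) = signProd (rows L) := by
  obtain ⟨-, r, hr, hrB, hrl, hre, hlow⟩ := hk
  rw [dualPlusLab]
  generalize posOf L k = t at *
  obtain ⟨S, T, n, rfl, rfl⟩ : ∃ S T n, L = S ++ (n, r) :: T ∧ t = S.length := by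
    rw [rows, List.getElem?_map, Option.map_eq_some_iff] at hr
    obtain ⟨p, hp, rfl⟩ := hr
    obtain ⟨ht, rfl⟩ := List.getElem?_eq_some_iff.1 hp
    refine ⟨L.take t, L.drop (t + 1), L[t].1, ?_, by simp; omega⟩
    conv_lhs => rw [← List.take_append_drop t L, List.drop_eq_getElem_cons ht]
  rw [alphaAt_append] at hre
  rw [dualPlusL_append_cons _ _ _ _ hrB]
  have hgood := h.good
  have hfits := h.fits
  rw [AllGood.append, AllGood.cons] at hgood
  rw [Fits.append, Fits.cons] at hfits
  obtain ⟨hgS, hgr, hgT⟩ := hgood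
  obtain ⟨hfS, ⟨hfr1, hfr2⟩, hfT⟩ := hfits
  dsimp only at hgr hfr1 hfr2
  have hgr' := hgr
  obtain ⟨m, m', l, hr⟩ := hgr
  have hc2 : c = 1 / 2 := by
    refine hc.resolve_left fun e => not_isInt_half 0 (isInt_iff.2 ⟨m', ?_⟩)
    have := hr.hB
    rw [hrB, e] at this
    push_cast
    linarith
  subst hc2
  have hg : g = 1 := h.initSign.resolve_right fun e => by norm_num at e
  subst hg
  have hm' : m' = 0 := by
    have := hr.hB
    rw [hrB] at this
    exact_mod_cast (by linarith : (m' : ℚ) = 0)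
  have hl : l = 0 := by
    have := hr.hl
    rw [hrl] at this
    exact_mod_cast this.symm
  subst hm' hl
  have hm := hr.le
  have hrA := hr.hA
  have hx : IsInt (sumB T + r.b) := hgT.isInt_sumB.add hgr'.isInt_b
  have hsorted := h.sorted
  simp only [List.map_append, List.map_cons, List.pairwise_append, List.pairwise_cons,
    List.mem_cons, List.nodup_append, List.nodup_cons] at hsorted hn
  obtain ⟨hs1, ⟨hs2, hs3⟩, hs4⟩ := hsorted
  obtain ⟨-, ⟨hn1, -⟩, hn2⟩ := hn
  have hnS : n ∉ S.map Prod.fst := fun e => hn2 n e n (.inl rfl) rfl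
  have hlowS : ∀ i ∈ S.map Prod.fst, B i ≤ -(1 / 2) := by
    intro i hi
    obtain ⟨p, hp, rfl⟩ := List.mem_map.1 hi
    obtain ⟨t, ht, rfl⟩ := List.getElem_of_mem hp
    have h1 := hlow t ht S[t].2 (by
      rw [rows, List.map_append, List.getElem?_append_left (by simpa using ht)]
      simp [ht])
    obtain ⟨a, b, d, hh⟩ := hgS _ hp
    rw [← (hfS _ hp).2, hh.hB]
    rw [hh.hB] at h1
    have h2 : (b : ℚ) < 0 := by linarith
    have h3 : b ≤ -1 := by
      have : b < 0 := by exact_mod_cast h2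
      omega
    have h4 : (b : ℚ) ≤ -1 := by exact_mod_cast h3
    linarith
  have hnew : (⟨r.A, -(1 / 2), 0, - r.eta⟩ : Row).GoodAt (1 / 2) m (-1) 0 :=
    ⟨hr.hA, by push_cast; norm_num, by norm_num, by have := hr.eta; dsimp only; omega,
      by omega, by
        have : (0 : ℚ) ≤ m := by exact_mod_cast hm
        dsimp only
        rw [hrA]; linarith, by omega⟩
  have hlen : r.len = r.eta * (m + 1) := by rw [hr.len_eq]; ring
  have hlen' : (⟨r.A, -(1 / 2), 0, - r.eta⟩ : Row).len = - r.eta * (m + 1 + 1) := by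
    rw [hnew.len_eq]; dsimp only; ring
  have hηη : r.eta * r.eta = 1 := by rcases hr.eta with e | e <;> rw [e] <;> rfl
  have hne : ∀ i ∈ S.map Prod.fst, i ≠ n := fun i hi e => hnS (e ▸ hi)
  have hneT : ∀ i ∈ T.map Prod.fst, i ≠ n := fun i hi e => hn1 (e ▸ hi)
  have hfit' : ∀ X : List LRow, (∀ i ∈ X.map Prod.fst, i ≠ n) → Fits A B X →
      Fits A (Function.update B n (-(1 / 2))) X := fun X hX hX' p hp => by
    rw [Function.update_of_ne (hX _ (List.mem_map.2 ⟨p, hp, rfl⟩))]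
    exact hX' p hp
  have htoZ : toZ 1 (partialPrefix S T r ++ (n, ⟨r.A, -(1 / 2), 0, - r.eta⟩) :: T) =
      (toZ 1 S).map (fun p => (p.1, 2 - p.2)) ++ (n, r.A + 3 / 2) ::
        negZ (toZ (1 * parity S * m1pow (r.A - r.B)) T) := by
    rw [toZ_append, toZ, toZ_partialPrefix hgS hx, parity_partialPrefix hgS hx, ← toZ_neg,
      parity_half hgS, hlen']
    have e1 : m1pow (r.A - -(1 / 2)) = - m1pow (r.A - r.B) := by
      rw [← m1pow_add_one hgr'.isInt_sub, hrB]
      congr 1; ring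
    have e2 : m1pow (sumA S) = - r.eta := by rw [hre]; ring
    dsimp only
    rw [e1, e2]
    congr 2
    · rw [show 1 * -r.eta * (-r.eta * (m + 1 + 1)) = r.eta * r.eta * (m + 1 + 1) by ring, hηη, hrA]
      push_cast; ring_nf
    · congr 1; ring
  have horig : toZ 1 (S ++ (n, r) :: T) = toZ 1 S ++ (n, ((1 * parity S * r.len : ℤ) : ℚ)) ::
      toZ (1 * parity S * m1pow (r.A - r.B)) T := by rw [toZ_append, toZ]
  have hb := h.bound
  have hd := h.dual_bound
  rw [horig] at hb hd
  have hmem : ∀ p ∈ toZ 1 S, p.1 ∈ S.map Prod.fst := fun p hp => by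
    rw [← labs_toZ 1 S]; exact List.mem_map.2 ⟨p, hp, rfl⟩
  have hmemT : ∀ p ∈ toZ (1 * parity S * m1pow (r.A - r.B)) T, p.1 ∈ T.map Prod.fst :=
    fun p hp => by
      rw [← labs_toZ (1 * parity S * m1pow (r.A - r.B)) T]; exact List.mem_map.2 ⟨p, hp, rfl⟩
  have hm0 : (0 : ℚ) ≤ m := by exact_mod_cast hm
  refine ⟨⟨Function.update B n (-(1 / 2)), 1, .inl rfl, ?_, ?_, ?_, ?_, ?_⟩, ?_⟩
  · rw [Fits.append, Fits.cons]
    exact ⟨hfit' _ (by rwa [map_fst_partialPrefix]) (partialPrefix_fits hfS),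
      ⟨hfr1, by simp⟩, hfit' _ hneT hfT⟩
  · rw [AllGood.append, AllGood.cons]
    exact ⟨partialPrefix_good hgS hx, ⟨_, _, _, hnew⟩, hgT⟩
  · rw [List.map_append, List.map_cons, map_fst_partialPrefix]
    simp only [List.pairwise_append, List.pairwise_cons, List.mem_cons]
    refine ⟨?_, ⟨?_, ?_⟩, ?_⟩
    · refine hs1.imp_of_mem fun {i j} hi hj hij => ?_
      rwa [Function.update_of_ne (hne i hi), Function.update_of_ne (hne j hj)]
    · intro j hj
      rw [Function.update_self, Function.update_of_ne (hneT j hj)]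
      have := hs2 j hj
      rw [← hfr2, hrB] at this
      linarith
    · refine hs3.imp_of_mem fun {i j} hi hj hij => ?_
      rwa [Function.update_of_ne (hneT i hi), Function.update_of_ne (hneT j hj)]
    · rintro i hi j (rfl | hj)
      · rw [Function.update_self, Function.update_of_ne (hne i hi)]
        exact hlowS i hi
      · rw [Function.update_of_ne (hne i hi), Function.update_of_ne (hneT j hj)]
        exact hs4 i hi j (.inr hj)
  · rw [htoZ]
    intro p hp
    simp only [List.mem_append, List.mem_cons, negZ, List.mem_map] at hp
    rcases hp with ⟨q, hq, rfl⟩ | rfl | ⟨q, hq, rfl⟩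
    · have h1 := hd q (by simp [hq])
      have h2 := hlowS q.1 (hmem q hq)
      dsimp only
      rw [Function.update_of_ne (hne _ (hmem q hq))]
      rw [abs_le] at h1 ⊢
      constructor <;> linarith [h1.1, h1.2]
    · dsimp only
      rw [Function.update_self, ← hfr1, hrA, abs_of_nonneg (by linarith)]
      linarith
    · have h1 := hb q (List.mem_append_right _ (List.mem_cons_of_mem _ hq))
      dsimp only
      rw [Function.update_of_ne (hneT _ (hmemT q hq)), abs_neg]
      exact h1
  · rw [htoZ]
    intro p hp
    simp only [List.mem_append, List.mem_cons, negZ, List.mem_map] at hp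
    rcases hp with ⟨q, hq, rfl⟩ | rfl | ⟨q, hq, rfl⟩
    · have h1 := hd q (by simp [hq])
      dsimp only
      rw [Function.update_of_ne (hne _ (hmem q hq))]
      rw [abs_le] at h1 ⊢
      constructor <;> linarith [h1.1, h1.2]
    · dsimp only
      rw [Function.update_self, ← hfr1, hrA, abs_of_nonneg (by linarith)]
      linarith
    · have h1 := hb q (List.mem_append_right _ (List.mem_cons_of_mem _ hq))
      have h2 := hs2 q.1 (hmemT q hq)
      rw [← hfr2, hrB] at h2
      dsimp only
      rw [Function.update_of_ne (hneT _ (hmemT q hq))]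
      rw [abs_le] at h1 ⊢
      constructor <;> linarith [h1.1, h1.2]
  · rw [signProd_append, signProd_append, signProd_cons, signProd_cons,
      signProd_partialPrefix hgS hx]
    dsimp only
    rw [hnew.rowSign_eq, hr.rowSign_eq, hlen, hlen', lenSign_neg_succ hr.eta, hre]
    linear_combination (lenSign (-m1pow (sumA S) * (m + 1)) * signProd (rows S) *
      signProd (rows T)) * m1pow_mul_self (sumA S)

theorem Balanced.dualMinus (hc : c = 0 ∨ c = 1 / 2) {g : ℤ} {L : List LRow} {k : ℕ}
    (h : Balanced c A B g L) (hn : (L.map Prod.fst).Nodup) (hk : DualMinusApplicableLab k L) :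
    IsEMS (rows (dualMinusLab k L)) ∧
      signProd (rows (dualMinusLab k L)) = signProd (rows L) := by
  obtain ⟨g', -, h1⟩ := h.dual hc
  obtain ⟨⟨B', g'', h2⟩, h3⟩ :=
    h1.dualPlus hc (by rw [map_fst_dualL]; exact List.nodup_reverse.2 hn) hk
  obtain ⟨g''', -, h4⟩ := h2.dual hc
  exact ⟨h4.isEMS hc, by
    rw [dualMinusLab, signProd_dualL hc h2.good, h3, signProd_dualL hc h.good]⟩

end PartialDualBound

/-- Part (1) of the Main Theorem (combinatorial content): each of the four operators
`R_k`, `ui_{i,j}`, `dual ∘ ui_{i,j} ∘ dual` and `dual_k` sends a non-vanishing extended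
multi-segment datum to an extended multi-segment datum, and preserves the sign product
`∏ (-1)^{⌊b/2⌋+l} η^b`. -/
theorem operators_preserve_ems_and_sign (L : List LRow)
    (hlab : (L.map Prod.fst).Nodup)
    (hE : IsEMS (rows L)) (hNV : NonVanishing (rows L)) (hP : Pprime (rows L)) :
    (∀ k : ℕ, IsEMS (rows (rexL k L)) ∧
        signProd (rows (rexL k L)) = signProd (rows L)) ∧
    (∀ i j M, UIrel L i j M → IsEMS (rows M) ∧
        signProd (rows M) = signProd (rows L)) ∧
    (∀ i j N, UIrel (dualL L) i j N → IsEMS (rows (dualL N)) ∧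
        signProd (rows (dualL N)) = signProd (rows L)) ∧
    (∀ k, DualPlusApplicableLab k L → IsEMS (rows (dualPlusLab k L)) ∧
        signProd (rows (dualPlusLab k L)) = signProd (rows L)) ∧
    (∀ k, DualMinusApplicableLab k L → IsEMS (rows (dualMinusLab k L)) ∧
        signProd (rows (dualMinusLab k L)) = signProd (rows L)) := by
  obtain ⟨c, A, B, hc, hbal, hlip⟩ := hNV.balanced hE hP hlab
  have hcore := hlip.core (by rwa [labs_toZ]) (by rw [labs_toZ]; exact hbal.sorted)
  refine ⟨fun k => hbal.rex hc hcore k, fun i j M hM => ?_,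
    fun i j N hN => hbal.dual_ui_dual hc hlab hlip hN, fun k hk => ?_,
    fun k hk => hbal.dualMinus hc hlab hk⟩
  · obtain ⟨⟨A', h1⟩, h2⟩ := hbal.ui hc hcore hM
    exact ⟨h1.isEMS hc, h2⟩
  · obtain ⟨⟨B', g', h1⟩, h2⟩ := hbal.dualPlus hc hlab hk
    exact ⟨h1.isEMS hc, h2⟩

end LocalArthur
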